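/- Let k be an infinite Brauer field and let d = (d_1, ..., d_r) be a multi-degree. Then there exists a constant C, depending only on d and k, with the following property: for every finite-dimensional k-vector space V and every tuple f = (f_1, ..., f_r) of homogeneous polynomial functions on V of degrees d_1, ..., d_r with strength str(f) > C, the set Z(f)(k) of k-points of Z(f) is Zariski dense in Z(f). -/

import Mathlib

open MvPolynomial

/-- A field `k` is a *Brauer field* if for every `d ≥ 1` there is an `N` such that every
diagonal equation `a_1 x_1^d + ⋯ + a_n x_n^d = 0` with `n > N` has a nontrivial solution. -/
def IsBrauerField (k : Type*) [Field k] : Prop :=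
  ∀ d : ℕ, 1 ≤ d → ∃ N : ℕ, ∀ n : ℕ, N < n → ∀ a : Fin n → k,
    ∃ x : Fin n → k, x ≠ 0 ∧ ∑ i, a i * x i ^ d = 0

/-- `HasStrengthDecomp f d s` : `f` (of degree `d`) is a sum of `s` products of pairs of
homogeneous polynomials of degrees strictly between `0` and `d`. -/
def HasStrengthDecomp {σ : Type*} {k : Type*} [Field k]
    (f : MvPolynomial σ k) (d : ℕ) (s : ℕ) : Prop :=
  ∃ (g h : Fin s → MvPolynomial σ k) (a b : Fin s → ℕ),
    (∀ i, 0 < a i ∧ a i < d ∧ 0 < b i ∧ b i < d ∧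
      (g i).IsHomogeneous (a i) ∧ (h i).IsHomogeneous (b i)) ∧
    f = ∑ i, g i * h i

/-- The strength of a homogeneous polynomial `f` of degree `d`, as an extended natural
number (`∞` if no decomposition exists). -/
noncomputable def strength {σ k : Type*} [Field k] (f : MvPolynomial σ k) (d : ℕ) : ℕ∞ :=
  sInf {s : ℕ∞ | ∃ m : ℕ, s = m ∧ HasStrengthDecomp f d m}

/-- The strength of a tuple of homogeneous polynomials of degrees `d i` : the minimal
strength of a nontrivial `k`-linear combination of entries of equal degree. -/
noncomputable def tupleStrength {σ k : Type*} [Field k] {r : ℕ}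
    (f : Fin r → MvPolynomial σ k) (d : Fin r → ℕ) : ℕ∞ :=
  sInf {s : ℕ∞ | ∃ (c : Fin r → k) (e : ℕ), c ≠ 0 ∧ (∀ i, c i ≠ 0 → d i = e) ∧
    s = strength (∑ i, C (c i) * f i) e}

set_option linter.all false
namespace RatDense
set_option linter.unusedSectionVars false
universe u
section basics
variable {k : Type u} [Field k] {σ τ B : Type}

/-- `f` is a sum of at most `s` products of polynomials without constant term. -/
def LowRk (s : ℕ) (f : MvPolynomial σ k) : Prop :=
  ∃ g h : Fin s → MvPolynomial σ k, (∀ i, constantCoeff (g i) = 0) ∧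
    (∀ i, constantCoeff (h i) = 0) ∧ f = ∑ i, g i * h i

lemma LowRk.of_fintype {ι : Type*} [Fintype ι] {s : ℕ} (hs : Fintype.card ι ≤ s)
    (g h : ι → MvPolynomial σ k) (hg : ∀ i, constantCoeff (g i) = 0)
    (hh : ∀ i, constantCoeff (h i) = 0) : LowRk s (∑ i, g i * h i) := by
  classical
  obtain ⟨e⟩ : Nonempty (ι ↪ Fin s) := by
    rw [Function.Embedding.nonempty_iff_card_le]; simpa using hs
  refine ⟨fun j => if hj : ∃ i, e i = j then g hj.choose else 0,
    fun j => if hj : ∃ i, e i = j then h hj.choose else 0, ?_, ?_, ?_⟩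
  · intro j; dsimp only; split_ifs <;> simp [*]
  · intro j; dsimp only; split_ifs <;> simp [*]
  · have key : ∀ i, (∃ i', e i' = e i) := fun i => ⟨i, rfl⟩
    rw [← Finset.sum_subset (Finset.subset_univ (Finset.univ.map e))]
    · rw [Finset.sum_map]
      refine Finset.sum_congr rfl fun i _ => ?_
      have h2 : (key i).choose = i := e.injective (key i).choose_spec
      beta_reduce
      rw [dif_pos (key i), dif_pos (key i), h2]
    · intro j _ hj
      beta_reduce
      rw [dif_neg, zero_mul]
      rintro ⟨i, rfl⟩; simp at hj

lemma LowRk.zero (s : ℕ) : LowRk s (0 : MvPolynomial σ k) :=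
  ⟨0, 0, by simp, by simp, by simp⟩

lemma LowRk.mono {s t : ℕ} (hst : s ≤ t) {f : MvPolynomial σ k} (hf : LowRk s f) : LowRk t f := by
  obtain ⟨g, h, hg, hh, rfl⟩ := hf
  exact LowRk.of_fintype (by simpa using hst) g h hg hh

lemma LowRk.add {s t : ℕ} {f f' : MvPolynomial σ k} (hf : LowRk s f) (hf' : LowRk t f') :
    LowRk (s + t) (f + f') := by
  obtain ⟨g, h, hg, hh, rfl⟩ := hf
  obtain ⟨g', h', hg', hh', rfl⟩ := hf'
  have := LowRk.of_fintype (ι := Fin s ⊕ Fin t) (s := s + t) (by simp) (Sum.elim g g')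
    (Sum.elim h h') (by rintro (i | i) <;> simp [hg, hg']) (by rintro (i | i) <;> simp [hh, hh'])
  simpa using this

lemma LowRk.C_mul {s : ℕ} {f : MvPolynomial σ k} (hf : LowRk s f) (c : k) :
    LowRk s (C c * f) := by
  obtain ⟨g, h, hg, hh, rfl⟩ := hf
  refine ⟨fun i => C c * g i, h, by simp [hg], hh, ?_⟩
  simp [Finset.mul_sum, mul_assoc]

lemma LowRk.neg {s : ℕ} {f : MvPolynomial σ k} (hf : LowRk s f) : LowRk s (-f) := by
  simpa using hf.C_mul (-1)

lemma LowRk.sub {s t : ℕ} {f f' : MvPolynomial σ k} (hf : LowRk s f) (hf' : LowRk t f') :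
    LowRk (s + t) (f - f') := by
  rw [sub_eq_add_neg]; exact hf.add hf'.neg

lemma LowRk.sum {ι : Type*} (S : Finset ι) {s : ℕ} {f : ι → MvPolynomial σ k}
    (hf : ∀ i ∈ S, LowRk s (f i)) : LowRk (S.card * s) (∑ i ∈ S, f i) := by
  classical
  induction S using Finset.induction_on with
  | empty => simpa using LowRk.zero 0
  | insert a S ha ih =>
    rw [Finset.sum_insert ha, Finset.card_insert_of_notMem ha, add_mul, one_mul, add_comm _ s]
    exact (hf a (by simp)).add (ih fun i hi => hf i (by simp [hi]))

lemma LowRk.of_C_mul {s : ℕ} {f : MvPolynomial σ k} {c : k} (hc : c ≠ 0)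
    (hf : LowRk s (C c * f)) : LowRk s f := by
  have := hf.C_mul c⁻¹
  rwa [← mul_assoc, ← MvPolynomial.C_mul, inv_mul_cancel₀ hc, C_1, one_mul] at this

lemma constantCoeff_aeval_eq_zero (φ : σ → MvPolynomial τ k)
    (hφ : ∀ i, constantCoeff (φ i) = 0) {g : MvPolynomial σ k} (hg : constantCoeff g = 0) :
    constantCoeff (aeval φ g) = 0 := by
  have : (constantCoeff.comp (aeval φ).toRingHom : MvPolynomial σ k →+* k) = constantCoeff := by
    apply MvPolynomial.ringHom_ext <;> simp [hφ]
  have h2 := congrArg (fun F => F g) this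
  simp only [RingHom.comp_apply] at h2
  rw [← hg, ← h2]; rfl

lemma LowRk.aeval {s : ℕ} {f : MvPolynomial σ k} (hf : LowRk s f) (φ : σ → MvPolynomial τ k)
    (hφ : ∀ i, constantCoeff (φ i) = 0) : LowRk s (MvPolynomial.aeval φ f) := by
  obtain ⟨g, h, hg, hh, rfl⟩ := hf
  exact ⟨fun i => MvPolynomial.aeval φ (g i), fun i => MvPolynomial.aeval φ (h i),
    fun i => constantCoeff_aeval_eq_zero φ hφ (hg i),
    fun i => constantCoeff_aeval_eq_zero φ hφ (hh i), by simp⟩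

open Classical in
/-- The weight attached to a block map. -/
noncomputable def wt (β : σ → B) (i : σ) : B → ℕ := fun b => if β i = b then 1 else 0

/-- multihomogeneous -/
abbrev MH (β : σ → B) (f : MvPolynomial σ k) (a : B → ℕ) : Prop :=
  IsWeightedHomogeneous (wt β) f a

/-- multidegree component -/
noncomputable abbrev cmp (β : σ → B) (a : B → ℕ) (f : MvPolynomial σ k) : MvPolynomial σ k :=
  weightedHomogeneousComponent (wt β) a f

lemma cmp_MH (β : σ → B) (a : B → ℕ) (f : MvPolynomial σ k) : MH β (cmp β a f) a :=
  weightedHomogeneousComponent_isWeightedHomogeneous _ _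

lemma cmp_self {β : σ → B} {a : B → ℕ} {f : MvPolynomial σ k} (hf : MH β f a) :
    cmp β a f = f := weightedHomogeneousComponent_eq_self hf

lemma cmp_ne {β : σ → B} {a a' : B → ℕ} {f : MvPolynomial σ k} (hf : MH β f a) (h : a ≠ a') :
    cmp β a' f = 0 := hf.weightedHomogeneousComponent_ne _ h.symm

open Classical in
lemma coeff_cmp (β : σ → B) (a : B → ℕ) (f : MvPolynomial σ k) (m : σ →₀ ℕ) :
    coeff m (cmp β a f) = if Finsupp.weight (wt β) m = a then coeff m f else 0 :=
  coeff_weightedHomogeneousComponent _ _ _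

/-- degrees present in a polynomial -/
noncomputable def degs (β : σ → B) (f : MvPolynomial σ k) : Finset (B → ℕ) := by
  classical exact f.support.image (Finsupp.weight (wt β))

lemma cmp_eq_zero_of_notMem {β : σ → B} {a : B → ℕ} {f : MvPolynomial σ k}
    (h : a ∉ degs β f) : cmp β a f = 0 := by
  classical
  ext m
  rw [coeff_cmp]
  split_ifs with hm
  · by_contra hne
    exact h (by rw [degs, Finset.mem_image]; exact ⟨m, by simpa [mem_support_iff] using hne, hm⟩)
  · simp

lemma sum_cmp (β : σ → B) (f : MvPolynomial σ k) (S : Finset (B → ℕ)) (hS : degs β f ⊆ S) :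
    ∑ a ∈ S, cmp β a f = f := by
  classical
  ext m
  rw [coeff_sum]
  simp_rw [coeff_cmp]
  rw [Finset.sum_ite_eq]
  split_ifs with h
  · rfl
  · by_contra hne
    exact h (hS (by
      rw [degs, Finset.mem_image]; exact ⟨m, by simpa [mem_support_iff, eq_comm] using hne, rfl⟩))

variable [Fintype B]

lemma cmp_mul [DecidableEq B] (β : σ → B) (A : B → ℕ) (g h : MvPolynomial σ k) :
    cmp β A (g * h) = ∑ p ∈ Finset.Iic A, cmp β p g * cmp β (A - p) h := by
  classical
  set S := degs β g ∪ Finset.Iic A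
  set T := degs β h ∪ (Finset.Iic A).image (fun p => A - p)
  conv_lhs => rw [← sum_cmp β g S Finset.subset_union_left,
    ← sum_cmp β h T Finset.subset_union_left, Finset.sum_mul_sum]
  rw [cmp, map_sum]
  simp_rw [map_sum]
  have key : ∀ p q, weightedHomogeneousComponent (wt β) A (cmp β p g * cmp β q h) =
      if p + q = A then cmp β p g * cmp β q h else 0 := by
    intro p q
    split_ifs with hpq
    · subst hpq; exact cmp_self ((cmp_MH _ _ _).mul (cmp_MH _ _ _))
    · exact cmp_ne ((cmp_MH _ _ _).mul (cmp_MH _ _ _)) hpq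
  simp_rw [key]
  rw [← Finset.sum_subset (Finset.subset_union_right : Finset.Iic A ⊆ S)]
  · refine Finset.sum_congr rfl fun p hp => ?_
    have hp' : p ≤ A := by simpa using hp
    rw [Finset.sum_eq_single (A - p)]
    · rw [if_pos (add_tsub_cancel_of_le hp')]
    · intro q _ hq
      rw [if_neg]; rintro rfl; exact hq (by simp)
    · intro hq; exact absurd (by
        apply Finset.mem_union_right; exact Finset.mem_image_of_mem _ hp) hq
  · intro p _ hp
    refine Finset.sum_eq_zero fun q _ => if_neg ?_
    rintro rfl; exact hp (by simp)

/-- total degree of a multidegree -/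
def tdeg (a : B → ℕ) : ℕ := ∑ b, a b

lemma tdeg_add (a b : B → ℕ) : tdeg (a + b) = tdeg a + tdeg b := by
  simp [tdeg, Finset.sum_add_distrib]

lemma tdeg_eq_zero {a : B → ℕ} : tdeg a = 0 ↔ a = 0 := by
  simp [tdeg, funext_iff]

lemma tdeg_mono {a b : B → ℕ} (h : a ≤ b) : tdeg a ≤ tdeg b :=
  Finset.sum_le_sum fun i _ => h i

lemma tdeg_lt {a b : B → ℕ} (h : a < b) : tdeg a < tdeg b := by
  obtain ⟨c, rfl⟩ := le_iff_exists_add.mp h.le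
  rw [tdeg_add]
  have : c ≠ 0 := by rintro rfl; simp at h
  have := mt tdeg_eq_zero.mp this
  omega

lemma card_Iic_le [DecidableEq B] (A : B → ℕ) : (Finset.Iic A).card ≤ 2 ^ tdeg A := by
  rw [Pi.card_Iic, tdeg, ← Finset.prod_pow_eq_pow_sum]
  refine Finset.prod_le_prod' fun i _ => ?_
  simp only [Nat.card_Iic]
  exact Nat.lt_two_pow_self

lemma weight_zero_iff (β : σ → B) (m : σ →₀ ℕ) : Finsupp.weight (wt β) m = 0 ↔ m = 0 := by
  constructor
  · intro h
    rw [Finsupp.weight_apply, Finsupp.sum] at h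
    ext i
    by_contra hi
    have h1 := congrFun h (β i)
    rw [Finset.sum_apply] at h1
    have h2 := (Finset.sum_eq_zero_iff.mp h1) i (by simpa using hi)
    simp [wt] at h2; exact hi (by simpa using h2)
  · rintro rfl; simp

lemma tdeg_weight (β : σ → B) (m : σ →₀ ℕ) : tdeg (Finsupp.weight (wt β) m) = m.degree := by
  classical
  rw [Finsupp.weight_apply, Finsupp.sum, tdeg, Finsupp.degree]
  simp only [Finset.sum_apply]
  rw [Finset.sum_comm]
  refine Finset.sum_congr rfl fun i _ => ?_
  simp [wt]

lemma cmp_zero (β : σ → B) (f : MvPolynomial σ k) : cmp β 0 f = C (constantCoeff f) := by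
  classical
  ext m
  rw [coeff_cmp, weight_zero_iff, coeff_C]
  by_cases hm : m = 0
  · subst hm; simp [constantCoeff_eq]
  · simp [hm, Ne.symm hm]

lemma constantCoeff_cmp {β : σ → B} {a : B → ℕ} (ha : a ≠ 0) (f : MvPolynomial σ k) :
    constantCoeff (cmp β a f) = 0 := by
  classical
  rw [constantCoeff_eq, coeff_cmp, if_neg]
  rw [map_zero]; exact ha.symm

lemma MH.constantCoeff {β : σ → B} {a : B → ℕ} (ha : a ≠ 0) {f : MvPolynomial σ k}
    (hf : MH β f a) : constantCoeff f = 0 := by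
  rw [← cmp_self hf]; exact constantCoeff_cmp ha f

/-- Decomposition of a low-rank multi-homogeneous form in multi-homogeneous products. -/
lemma LowRk.cmp_decomp [DecidableEq B] {β : σ → B} {s : ℕ} {f : MvPolynomial σ k}
    (hf : LowRk s f) (A : B → ℕ) :
    ∃ (g h : Fin s × Finset.Iic A → MvPolynomial σ k) (p q : Fin s × Finset.Iic A → B → ℕ),
      (∀ i, p i ≠ 0 ∧ q i ≠ 0 ∧ p i + q i = A ∧ MH β (g i) (p i) ∧ MH β (h i) (q i)
        ∨ g i = 0 ∧ h i = 0) ∧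
      cmp β A f = ∑ i, g i * h i := by
  obtain ⟨g, h, hg, hh, rfl⟩ := hf
  refine ⟨fun i => if i.2.1 ≠ 0 ∧ A - i.2.1 ≠ 0 then cmp β i.2.1 (g i.1) else 0,
    fun i => if i.2.1 ≠ 0 ∧ A - i.2.1 ≠ 0 then cmp β (A - i.2.1) (h i.1) else 0,
    fun i => i.2.1, fun i => A - i.2.1, ?_, ?_⟩
  · rintro ⟨i, p, hp⟩
    by_cases h1 : p ≠ 0 ∧ A - p ≠ 0
    · left
      refine ⟨h1.1, h1.2, add_tsub_cancel_of_le (by simpa using hp), ?_, ?_⟩ <;>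
      · simp only [h1, ne_eq, not_false_eq_true, and_self, if_true]; exact cmp_MH _ _ _
    · right; simp only [h1, if_false, and_self]
  · rw [cmp, map_sum, Fintype.sum_prod_type]
    refine Finset.sum_congr rfl fun i _ => ?_
    have := cmp_mul β A (g i) (h i)
    rw [cmp] at this
    rw [this, ← Finset.sum_coe_sort (Finset.Iic A)]
    refine Finset.sum_congr rfl fun p _ => ?_
    dsimp only
    split_ifs with h1
    · rfl
    · rw [not_and_or, not_not, not_not] at h1
      rcases h1 with h1 | h1
      · rw [h1, cmp_zero, hg]; simp
      · rw [h1, cmp_zero β (h i), hh]; simp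

lemma LowRk.cmp {β : σ → B} {s : ℕ} {f : MvPolynomial σ k}
    (hf : LowRk s f) (A : B → ℕ) : LowRk (s * 2 ^ tdeg A) (cmp β A f) := by
  classical
  obtain ⟨g, h, p, q, H, e⟩ := hf.cmp_decomp (β := β) A
  rw [e]
  refine LowRk.of_fintype ?_ g h ?_ ?_
  · rw [Fintype.card_prod, Fintype.card_fin, Fintype.card_coe]
    exact Nat.mul_le_mul_left _ (card_Iic_le A)
  · intro i
    rcases H i with ⟨h1, _, _, h2, _⟩ | ⟨h1, _⟩
    · exact h2.constantCoeff h1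
    · simp [h1]
  · intro i
    rcases H i with ⟨_, h1, _, _, h2⟩ | ⟨_, h1⟩
    · exact h2.constantCoeff h1
    · simp [h1]

/-- Collective strength. -/
def CS {ι : Type} [Fintype ι] (K : ℕ) (f : ι → MvPolynomial σ k) (a : ι → B → ℕ) : Prop :=
  ∀ c : ι → k, c ≠ 0 → ∀ A : B → ℕ, (∀ i, c i ≠ 0 → a i = A) → ¬ LowRk K (∑ i, C (c i) * f i)

end basics
end RatDense

namespace RatDense
set_option linter.unusedSectionVars false
universe u
section brauer
variable {k : Type u} [Field k]

lemma sum_extend {ι ι' : Type} [Fintype ι] [Fintype ι'] (φ : ι' ↪ ι) (x : ι' → k)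
    (F : ι → k → k) (hF : ∀ a, F a 0 = 0) :
    ∑ a, F a (Function.extend φ x 0 a) = ∑ a', F (φ a') (x a') := by
  classical
  rw [← Finset.sum_subset (Finset.subset_univ (Finset.univ.map φ))]
  · rw [Finset.sum_map]
    refine Finset.sum_congr rfl fun i _ => ?_
    rw [φ.injective.extend_apply]
  · intro j _ hj
    rw [Function.extend_apply', Pi.zero_apply, hF]
    rintro ⟨i, rfl⟩; simp at hj

lemma extend_ne_zero {ι ι' : Type} (φ : ι' ↪ ι) (x : ι' → k) (hx : x ≠ 0) :
    Function.extend φ x 0 ≠ 0 := by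
  obtain ⟨i, hi⟩ := Function.ne_iff.mp hx
  refine Function.ne_iff.mpr ⟨φ i, ?_⟩
  rwa [φ.injective.extend_apply]

/-- Simultaneous diagonal equations. -/
lemma br (hk : IsBrauerField k) (e : ℕ) (he : 1 ≤ e) (E : ℕ) :
    ∃ n₀ : ℕ, ∀ (ι : Type) [Fintype ι], n₀ ≤ Fintype.card ι → ∀ β : Fin E → ι → k,
      ∃ x : ι → k, x ≠ 0 ∧ ∀ q, ∑ a, β q a * x a ^ e = 0 := by
  suffices h : ∃ (κ : Type) (_ : Fintype κ), ∀ β : Fin E → κ → k,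
      ∃ x : κ → k, x ≠ 0 ∧ ∀ q, ∑ a, β q a * x a ^ e = 0 by
    obtain ⟨κ, _, H⟩ := h
    refine ⟨Fintype.card κ, fun ι _ hι β => ?_⟩
    obtain ⟨φ⟩ := Function.Embedding.nonempty_of_card_le hι
    obtain ⟨x, hx, hx'⟩ := H (fun q a => β q (φ a))
    refine ⟨Function.extend φ x 0, extend_ne_zero φ x hx, fun q => ?_⟩
    rw [sum_extend φ x (fun a t => β q a * t ^ e)]
    · exact hx' q
    · intro a; simp [show e ≠ 0 by omega]
  induction E with
  | zero => exact ⟨Unit, inferInstance, fun β => ⟨1, one_ne_zero, fun q => q.elim0⟩⟩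
  | succ E ih =>
    obtain ⟨κ, _, H⟩ := ih
    obtain ⟨N, hN⟩ := hk e he
    refine ⟨Fin (N + 1) × κ, inferInstance, fun β => ?_⟩
    choose x hx hx' using fun g : Fin (N + 1) => H (fun q a => β q.castSucc (g, a))
    obtain ⟨y, hy, hy'⟩ := hN (N + 1) (by omega)
      (fun g => ∑ a, β (Fin.last E) (g, a) * x g a ^ e)
    refine ⟨fun p => y p.1 * x p.1 p.2, ?_, fun q => ?_⟩
    · obtain ⟨g, hg⟩ := Function.ne_iff.mp hy
      obtain ⟨a, ha⟩ := Function.ne_iff.mp (hx g)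
      exact Function.ne_iff.mpr ⟨(g, a), mul_ne_zero hg ha⟩
    · rw [Fintype.sum_prod_type]
      refine Fin.lastCases ?_ (fun q => ?_) q
      · rw [← hy']
        refine Finset.sum_congr rfl fun g _ => ?_
        rw [Finset.sum_mul]
        exact Finset.sum_congr rfl fun a _ => by ring
      · refine Finset.sum_eq_zero fun g _ => ?_
        have := hx' g q
        calc _ = y g ^ e * ∑ a, β q.castSucc (g, a) * x g a ^ e := by
              rw [Finset.mul_sum]; exact Finset.sum_congr rfl fun a _ => by ring
          _ = 0 := by rw [this, mul_zero]

/-- Splitting lemma for exponents at least two. -/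
lemma br2 (hk : IsBrauerField k) (e : ℕ) (he : 2 ≤ e) (E : ℕ) :
    ∃ n₁ : ℕ, ∀ n, n₁ ≤ n → ∀ (β β' : Fin E → Fin n → k) (s : Matrix (Fin n) (Fin n) k),
      s.det ≠ 0 → ∃ Y Z : Fin n → k, (∀ q, ∑ a, β q a * Y a ^ e = 0) ∧
        (∀ q, ∑ a, β' q a * Z a ^ e = 0) ∧ ∑ a, ∑ a', s a a' * (Y a * Z a' ^ (e - 1)) ≠ 0 := by
  classical
  obtain ⟨n₀, hn₀⟩ := br hk e (by omega) E
  refine ⟨n₀ * n₀, fun n hn β β' s hs => ?_⟩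
  obtain ⟨φ⟩ : Nonempty (Fin n₀ × Fin n₀ ↪ Fin n) :=
    Function.Embedding.nonempty_of_card_le (by simpa using hn)
  choose z hz hz' using fun κ : Fin n₀ => hn₀ (Fin n₀) (by simp) (fun q a => β' q (φ (κ, a)))
  -- the vectors Z^κ
  let emb : Fin n₀ → (Fin n₀ ↪ Fin n) := fun κ =>
    ⟨fun a => φ (κ, a), fun a b h => by simpa using h⟩
  let Zv : Fin n₀ → Fin n → k := fun κ => Function.extend (emb κ) (z κ) 0
  have hZv : ∀ κ a, Zv κ (φ (κ, a)) = z κ a := fun κ a =>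
    (emb κ).injective.extend_apply (z κ) 0 a
  have hZv0 : ∀ κ κ' a, κ ≠ κ' → Zv κ (φ (κ', a)) = 0 := fun κ κ' a h => by
    apply Function.extend_apply'
    rintro ⟨b, hb⟩
    have : (κ, b) = (κ', a) := φ.injective hb
    exact h (by simpa using congrArg Prod.fst this)
  let W : Fin n₀ → Fin n → k := fun κ a => Zv κ a ^ (e - 1)
  have hW : LinearIndependent k W := by
    rw [Fintype.linearIndependent_iff]
    intro c hc κ
    obtain ⟨a, ha⟩ := Function.ne_iff.mp (hz κ)
    have h1 := congrFun hc (φ (κ, a))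
    rw [Finset.sum_apply, Finset.sum_eq_single κ] at h1
    · simp only [Pi.smul_apply, smul_eq_mul, W, hZv, Pi.zero_apply, mul_eq_zero] at h1
      rcases h1 with h1 | h1
      · exact h1
      · exact absurd (pow_eq_zero_iff (by omega) |>.mp h1) ha
    · intro κ' _ h
      simp [W, hZv0 κ' κ a h, show e - 1 ≠ 0 by omega]
    · simp
  let T : Matrix (Fin n₀) (Fin n) k := Matrix.of fun κ => s.mulVec (W κ)
  have hinj : Function.Injective s.mulVec :=
    Matrix.mulVec_injective_iff_isUnit.mpr ((Matrix.isUnit_iff_isUnit_det s).mpr hs.isUnit)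
  have hT : LinearIndependent k T.row := by
    have := hW.map' (Matrix.mulVecLin s) (LinearMap.ker_eq_bot.mpr hinj)
    exact this
  have hr := hT.rank_matrix
  rw [Matrix.rank_eq_finrank_span_cols] at hr
  obtain ⟨κ', g, hg, hspan, hli⟩ := exists_linearIndependent' k T.col
  have : Finite κ' := Finite.of_injective g hg
  let _ := Fintype.ofFinite κ'
  have hcard : Fintype.card κ' = n₀ := by
    rw [linearIndependent_iff_card_eq_finrank_span.mp hli, Set.finrank, hspan, hr]; simp
  let eq := Fintype.equivFin κ'
  have hgi : Function.Injective (g ∘ eq.symm) := hg.comp eq.symm.injective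
  let γ : Fin (Fintype.card κ') ↪ Fin n := ⟨g ∘ eq.symm, hgi⟩
  obtain ⟨y, hy, hy'⟩ := hn₀ (Fin (Fintype.card κ')) (by simp [hcard]) (fun q a => β q (γ a))
  let Y := Function.extend γ y 0
  have hne : ∑ a, y a • T.col (γ a) ≠ 0 := by
    intro h0
    have hli' : LinearIndependent k (fun a => T.col (γ a)) := hli.comp _ eq.symm.injective
    exact hy (funext fun a => Fintype.linearIndependent_iff.mp hli' y h0 a)
  obtain ⟨κ, hκ⟩ := Function.ne_iff.mp hne
  refine ⟨Y, Zv κ, fun q => ?_, fun q => ?_, ?_⟩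
  · rw [sum_extend γ y (fun a t => β q a * t ^ e)]
    · exact hy' q
    · intro a; simp [show e ≠ 0 by omega]
  · rw [sum_extend (emb κ) (z κ) (fun a t => β' q a * t ^ e)]
    · exact hz' κ q
    · intro a; simp [show e ≠ 0 by omega]
  · have h1 : ∑ a, ∑ a', s a a' * (Y a * Zv κ a' ^ (e - 1)) = ∑ a, Y a * T κ a := by
      refine Finset.sum_congr rfl fun a _ => ?_
      simp only [T, Matrix.of_apply, Matrix.mulVec, dotProduct, Finset.mul_sum, W]
      exact Finset.sum_congr rfl fun a' _ => by ring
    rw [h1, sum_extend γ y (fun a t => t * T κ a)]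
    · simpa [Finset.sum_apply, Matrix.col] using hκ
    · simp

/-- `k` is finite over its `p`-th powers. -/
lemma pbasis (hk : IsBrauerField k) (p : ℕ) [Fact p.Prime] [CharP k p] :
    ∃ (q : ℕ) (e : Fin q → k), ∀ a : k, ∃ x : Fin q → k, a = ∑ c, e c * x c ^ p := by
  classical
  have hp := (Fact.out : p.Prime)
  obtain ⟨N, hN⟩ := hk p hp.one_lt.le
  let P : ℕ → Prop := fun q => ∃ e : Fin q → k, ∀ x : Fin q → k, ∑ i, e i * x i ^ p = 0 → x = 0
  have h0 : P 0 := ⟨0, fun x _ => Subsingleton.elim _ _⟩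
  have hb : ∀ q, P q → q ≤ N := by
    rintro q ⟨e, he⟩
    by_contra hq
    obtain ⟨x, hx, hx'⟩ := hN q (by omega) e
    exact hx (he x hx')
  obtain ⟨e, he⟩ : P (Nat.findGreatest P N) := Nat.findGreatest_spec (Nat.zero_le N) h0
  refine ⟨_, e, fun a => ?_⟩
  have hmax : ¬ P (Nat.findGreatest P N + 1) := fun h => by
    have := Nat.le_findGreatest (hb _ h) h
    omega
  simp only [P, not_exists, not_forall] at hmax
  obtain ⟨x, hx, hx'⟩ := hmax (Fin.snoc (α := fun _ => k) e a)
  rw [Fin.sum_univ_castSucc] at hx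
  simp only [Fin.snoc_castSucc, Fin.snoc_last] at hx
  have hy : x (Fin.last _) ≠ 0 := by
    intro hy
    rw [hy, zero_pow hp.ne_zero, mul_zero, add_zero] at hx
    have := he _ hx
    apply hx'
    funext i
    refine Fin.lastCases hy (fun i => ?_) i
    exact congrFun this i
  refine ⟨fun c => -(x c.castSucc / x (Fin.last _)), ?_⟩
  have hneg : ∀ z : k, (-z) ^ p = -(z ^ p) := fun z => by
    have := sub_pow_char (p := p) (0:k) z
    simpa [zero_pow hp.ne_zero] using this
  simp_rw [hneg, div_pow]
  have : ∑ i : Fin (Nat.findGreatest P N), e i * x i.castSucc ^ p = -(a * x (Fin.last _) ^ p) := by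
    linear_combination hx
  have h3 : ∑ c : Fin (Nat.findGreatest P N), e c * -(x c.castSucc ^ p / x (Fin.last _) ^ p)
      = -((∑ i : Fin (Nat.findGreatest P N), e i * x i.castSucc ^ p) / x (Fin.last _) ^ p) := by
    rw [Finset.sum_div, ← Finset.sum_neg_distrib]
    exact Finset.sum_congr rfl fun c _ => by ring
  rw [h3, this]
  field_simp

lemma plemma (hk : IsBrauerField k) (p : ℕ) [Fact p.Prime] [CharP k p] :
    ∃ q : ℕ, ∀ (σ : Type) (h : MvPolynomial σ k), constantCoeff h = 0 →
      (∀ m i, coeff m h ≠ 0 → p ∣ m i) → LowRk q h := by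
  classical
  have hp := (Fact.out : p.Prime)
  obtain ⟨q, e, he⟩ := pbasis hk p
  refine ⟨q, fun σ h h0 hd => ?_⟩
  choose x hx using he
  let r : (σ →₀ ℕ) → (σ →₀ ℕ) := fun m => m.mapRange (· / p) (Nat.zero_div p)
  have hr : ∀ m ∈ h.support, p • r m = m := by
    intro m hm
    ext i
    simp only [r, Finsupp.smul_apply, Finsupp.mapRange_apply, smul_eq_mul]
    exact Nat.mul_div_cancel' (hd m i (mem_support_iff.mp hm))
  let G : Fin q → MvPolynomial σ k := fun c => ∑ m ∈ h.support, monomial (r m) (x (coeff m h) c)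
  have hG : ∀ c, constantCoeff (G c) = 0 := by
    intro c
    simp only [G, map_sum]
    refine Finset.sum_eq_zero fun m hm => ?_
    rw [constantCoeff_monomial, if_neg]
    intro h2
    have := hr m hm
    rw [h2, smul_zero] at this
    subst this
    exact mem_support_iff.mp hm (by rwa [← constantCoeff_eq])
  have hfin : h = ∑ c, (C (e c) * G c ^ (p - 1)) * G c := by
    have hGp : ∀ c, C (e c) * G c ^ (p - 1) * G c =
        ∑ m ∈ h.support, monomial m (e c * x (coeff m h) c ^ p) := by
      intro c
      rw [mul_assoc, ← pow_succ, Nat.sub_add_cancel hp.one_lt.le]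
      simp only [G]
      rw [sum_pow_char, Finset.mul_sum]
      refine Finset.sum_congr rfl fun m hm => ?_
      rw [monomial_pow, C_mul_monomial, hr m hm]
    simp_rw [hGp]
    rw [Finset.sum_comm]
    conv_lhs => rw [h.as_sum]
    refine Finset.sum_congr rfl fun m _ => ?_
    rw [← map_sum, ← hx]
  rw [hfin]
  refine LowRk.of_fintype (by simp) _ _ (fun c => ?_) hG
  rw [map_mul, map_pow, hG, zero_pow (by have := hp.two_le; omega), mul_zero]
end brauer
end RatDense

namespace RatDense
universe u

/-- `g` only involves variables in `T`. -/
def SuppIn {k : Type u} [Field k] {σ : Type} (T : Set σ) (g : MvPolynomial σ k) : Prop :=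
  ∀ m, coeff m g ≠ 0 → ∀ i, m i ≠ 0 → i ∈ T

theorem exists_T_equiv {k : Type u} [Field k] {α β : Type} (e : α ≃ β)
    (ih : ∀ (P : Ideal (MvPolynomial α k)) [P.IsPrime],
    ∃ T : Set α, (∀ g ∈ P, SuppIn T g → g = 0) ∧ ((Tᶜ.ncard : ℕ) : ℕ∞) ≤ P.height) (P : Ideal (MvPolynomial β k)) [P.IsPrime] :
    ∃ T : Set β, (∀ g ∈ P, SuppIn T g → g = 0) ∧ ((Tᶜ.ncard : ℕ) : ℕ∞) ≤ P.height := by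
  let E : MvPolynomial α k ≃ₐ[k] MvPolynomial β k := renameEquiv k e
  obtain ⟨T, hT, hc⟩ := ih (P.comap (E : MvPolynomial α k →+* MvPolynomial β k))
  refine ⟨e '' T, ?_, ?_⟩
  · intro g hg hgT
    have h1 : E.symm g = 0 := by
      refine hT _ ?_ ?_
      · change E (E.symm g) ∈ P
        rwa [AlgEquiv.apply_symm_apply]
      · intro m hm i hi
        have h2 : E.symm g = rename e.symm g := rfl
        have h3 : m = Finsupp.mapDomain e.symm (Finsupp.mapDomain e m) := by
          rw [← Finsupp.mapDomain_comp]; simp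
        rw [h2, h3, coeff_rename_mapDomain _ e.symm.injective] at hm
        have := hgT _ hm (e i) (by rw [Finsupp.mapDomain_apply e.injective]; exact hi)
        simpa using this
    simpa using h1
  · have h1 : (e '' T)ᶜ = e '' Tᶜ := by rw [Set.image_compl_eq e.bijective]
    rw [h1, Set.ncard_image_of_injective _ e.injective]
    refine hc.trans ?_
    have : (P.comap (E : MvPolynomial α k →+* MvPolynomial β k)).height = P.height :=
      RingEquiv.height_comap (E : MvPolynomial α k ≃+* MvPolynomial β k) P
    exact this.le

theorem height_aux {R : Type u} [CommRing R] [IsNoetherianRing R] (Q : Ideal (Polynomial R)) [Q.IsPrime] :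
    (Q.comap (Polynomial.C)).height ≤ Q.height ∧ 
    ((∃ f ∈ Q, ∃ n, f.coeff n ∉ Q.comap Polynomial.C) → (Q.comap (Polynomial.C)).height + 1 ≤ Q.height) := by
  let p : Ideal R := Q.comap (Polynomial.C)
  have hp : p.IsPrime := Ideal.IsPrime.comap _
  have hover : Q.LiesOver p := ⟨rfl⟩
  have hheight := Ideal.height_eq_height_add_of_liesOver_of_hasGoingDown p Q
  refine ⟨by change p.height ≤ _; rw [hheight]; exact le_self_add, ?_⟩
  rintro ⟨f, hf, n, hn⟩
  have hf2 : f ∉ p.map (Polynomial.C : R →+* Polynomial R) := by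
    intro h
    rw [Ideal.mem_map_C_iff] at h
    exact hn (h n)
  have hpp : (p.map (Polynomial.C : R →+* Polynomial R)).IsPrime := Ideal.isPrime_map_C_of_isPrime
  have hlt : p.map (Polynomial.C : R →+* Polynomial R) < Q := by
    refine lt_of_le_of_ne Ideal.map_comap_le ?_
    intro h
    exact hf2 (h ▸ hf)
  have h3 : (p.map (Polynomial.C : R →+* Polynomial R)).height < Q.height :=
    Ideal.height_strict_mono_of_isPrime hlt
  have hover2 : (p.map (Polynomial.C : R →+* Polynomial R)).LiesOver p := by
    constructor
    ext a
    simp only [Ideal.under, Ideal.mem_comap]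
    rw [show algebraMap R (Polynomial R) = Polynomial.C from rfl, Ideal.mem_map_C_iff]
    constructor
    · intro ha n; rw [Polynomial.coeff_C]; split_ifs <;> simp [ha]
    · intro h; simpa using h 0
  have h4 := Ideal.height_eq_height_add_of_liesOver_of_hasGoingDown p (p.map (Polynomial.C : R →+* Polynomial R))
  have h5 : p.height < Q.height := lt_of_le_of_lt (by rw [h4]; exact le_self_add) h3
  exact Order.add_one_le_of_lt h5

theorem exists_T_option {k : Type u} [Field k] {α : Type} [Finite α] 
    (ih : ∀ (P : Ideal (MvPolynomial α k)) [P.IsPrime],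
    ∃ T : Set α, (∀ g ∈ P, SuppIn T g → g = 0) ∧ ((Tᶜ.ncard : ℕ) : ℕ∞) ≤ P.height) (P : Ideal (MvPolynomial (Option α) k)) [P.IsPrime] :
    ∃ T : Set (Option α), (∀ g ∈ P, SuppIn T g → g = 0) ∧ ((Tᶜ.ncard : ℕ) : ℕ∞) ≤ P.height := by
  let E : MvPolynomial (Option α) k ≃ₐ[k] Polynomial (MvPolynomial α k) := optionEquivLeft k α
  let Q : Ideal (Polynomial (MvPolynomial α k)) := P.comap (E.symm : Polynomial (MvPolynomial α k) →+* MvPolynomial (Option α) k)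
  have hQ : Q.IsPrime := Ideal.IsPrime.comap _
  have hQh : Q.height = P.height :=
    RingEquiv.height_comap (E.symm : Polynomial (MvPolynomial α k) ≃+* MvPolynomial (Option α) k) P
  have hp : (Q.comap Polynomial.C).IsPrime := Ideal.IsPrime.comap _
  obtain ⟨T, hT, hc⟩ := ih (Q.comap Polynomial.C)
  obtain ⟨hh1, hh2⟩ := height_aux Q
  by_cases htr : ∀ g ∈ P, SuppIn (insert none (some '' T)) g → g = 0
  · refine ⟨_, htr, ?_⟩
    have h1 : (insert none (some '' T))ᶜ = some '' Tᶜ := by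
      ext (_ | i) <;> simp
    rw [h1, Set.ncard_image_of_injective _ (Option.some_injective _), ← hQh]
    exact hc.trans hh1
  · push Not at htr
    obtain ⟨g, hgP, hgT, hg0⟩ := htr
    refine ⟨some '' T, ?_, ?_⟩
    · intro g hg hgT
      have h0 : ∀ m, coeff m g ≠ 0 → m none = 0 := by
        intro m hm
        by_contra h
        simpa using hgT m hm none h
      have hE : E g = Polynomial.C ((E g).coeff 0) := by
        ext n m
        rw [Polynomial.coeff_C]
        split_ifs with h
        · rw [h]
        · rw [optionEquivLeft_coeff_coeff, coeff_zero]
          by_contra hne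
          have := h0 _ hne
          simp at this
          exact h this
      have : (E g).coeff 0 = 0 := by
        refine hT _ ?_ ?_
        · change E.symm (Polynomial.C _) ∈ P
          rw [← hE]; simpa using hg
        · intro m hm i hi
          rw [optionEquivLeft_coeff_coeff] at hm
          have := hgT _ hm (some i) (by simpa using hi)
          simpa using this
      rw [this] at hE
      simpa using hE
    · have h1 : (some '' T)ᶜ = insert none (some '' Tᶜ) := by
        ext (_ | i) <;> simp
      have hfin : (some '' Tᶜ).Finite := Set.toFinite _
      rw [h1, Set.ncard_insert_of_notMem (by simp) hfin, Set.ncard_image_of_injective _ (Option.some_injective _), ← hQh]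
      refine le_trans ?_ (hh2 ?_)
      · push_cast; gcongr
      · refine ⟨E g, by change E.symm (E g) ∈ P; simpa using hgP, ?_⟩
        have hEg : E g ≠ 0 := by simpa using hg0
        obtain ⟨n, hn⟩ := Polynomial.support_nonempty.mpr hEg
        refine ⟨n, fun hmem => Polynomial.mem_support_iff.mp hn (hT _ hmem ?_)⟩
        intro m hm i hi
        rw [optionEquivLeft_coeff_coeff] at hm
        have := hgT _ hm (some i) (by simpa using hi)
        simpa using this

theorem exists_T {k : Type u} [Field k] (σ : Type) [Finite σ] : ∀ (P : Ideal (MvPolynomial σ k)) [P.IsPrime],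
    ∃ T : Set σ, (∀ g ∈ P, SuppIn T g → g = 0) ∧
      ((Tᶜ.ncard : ℕ) : ℕ∞) ≤ P.height := by
  induction σ using Finite.induction_empty_option with
  | of_equiv e ih => intro P _; exact exists_T_equiv e ih P
  | h_empty =>
    intro P hP
    refine ⟨∅, ?_, by simp⟩
    intro g hg _
    by_contra h
    rw [eq_C_of_isEmpty g] at hg h
    have hc : coeff 0 g ≠ 0 := by rintro h'; rw [h'] at h; simp at h
    exact hP.ne_top (Ideal.eq_top_of_isUnit_mem _ hg ((isUnit_iff_ne_zero.mpr hc).map C))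
  | h_option ih => intro P _; exact exists_T_option ih P
end RatDense

namespace RatDense
universe u

lemma chev {R : Type u} [CommRing R] [IsDomain R] {ι : Type} [Finite ι] {r : ℕ} (F : Fin r → MvPolynomial ι R)
    (G : MvPolynomial ι R) {D : Type u} [CommRing D] [IsDomain D] (Φ : MvPolynomial ι R →+* D)
    (hF : ∀ j, Φ (F j) = 0) (hG : Φ G ≠ 0) (hinj : ∀ a, Φ (C a) = 0 → a = 0) :
    ∃ H : R, H ≠ 0 ∧ ∀ p : Ideal R, p.IsPrime → H ∉ p → ∃ q : Ideal (MvPolynomial ι R), q.IsPrime ∧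
      q.comap C = p ∧ (∀ j, F j ∈ q) ∧ G ∉ q := by
  let Z : PrimeSpectrum.ConstructibleSetData (MvPolynomial ι R) := {⟨G, r, F⟩}
  have hZ := Z.isConstructible_toSet
  have hfp : (C : R →+* MvPolynomial ι R).FinitePresentation := by
    have : Algebra.FinitePresentation R (MvPolynomial ι R) := inferInstance
    exact RingHom.finitePresentation_algebraMap.mpr this
  have hc := PrimeSpectrum.isConstructible_comap_image hfp hZ
  rw [← PrimeSpectrum.exists_constructibleSetData_iff] at hc
  obtain ⟨S, hS⟩ := hc
  have hmem : ∀ q : PrimeSpectrum (MvPolynomial ι R), q ∈ Z.toSet ↔ (∀ j, F j ∈ q.asIdeal) ∧ G ∉ q.asIdeal := by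
    intro q
    simp [Z, PrimeSpectrum.ConstructibleSetData.toSet, PrimeSpectrum.BasicConstructibleSetData.toSet,
      PrimeSpectrum.mem_zeroLocus, Set.range_subset_iff]
  have hbot : (⟨⊥, Ideal.isPrime_bot⟩ : PrimeSpectrum R) ∈ S.toSet := by
    rw [hS]
    refine ⟨⟨RingHom.ker Φ, RingHom.ker_isPrime Φ⟩, ?_, ?_⟩
    · rw [hmem]
      exact ⟨fun j => hF j, hG⟩
    · ext a
      simp only [PrimeSpectrum.comap_asIdeal, Ideal.mem_comap, RingHom.mem_ker, Ideal.mem_bot]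
      exact ⟨hinj a, fun h => by simp [h]⟩
  simp only [PrimeSpectrum.ConstructibleSetData.toSet, Set.mem_iUnion, 
    PrimeSpectrum.BasicConstructibleSetData.toSet] at hbot
  obtain ⟨c, hcS, hc1, hc2⟩ := hbot
  have hg0 : ∀ i, c.g i = 0 := by
    intro i
    rw [PrimeSpectrum.mem_zeroLocus] at hc1
    simpa using hc1 ⟨i, rfl⟩
  refine ⟨c.f, ?_, ?_⟩
  · intro h
    apply hc2
    rw [PrimeSpectrum.mem_zeroLocus]
    simp [h]
  · intro p hp hH
    have : (⟨p, hp⟩ : PrimeSpectrum R) ∈ S.toSet := by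
      simp only [PrimeSpectrum.ConstructibleSetData.toSet, Set.mem_iUnion, 
        PrimeSpectrum.BasicConstructibleSetData.toSet]
      refine ⟨c, hcS, ?_, ?_⟩
      · rw [PrimeSpectrum.mem_zeroLocus]
        rintro _ ⟨i, rfl⟩
        simp [hg0]
      · rw [PrimeSpectrum.mem_zeroLocus]
        simpa using hH
    rw [hS] at this
    obtain ⟨q, hq, hqp⟩ := this
    refine ⟨q.asIdeal, q.2, ?_, (hmem q).1 hq⟩
    rw [← PrimeSpectrum.comap_asIdeal, hqp]

variable {k : Type u} [Field k] {σ : Type}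

/-- the parametrized affine subspace -/
noncomputable def line {r : ℕ} (W : σ × (Fin r ⊕ Unit) → k) (i : σ) : MvPolynomial (Fin r) k :=
  ∑ j, C (W (i, Sum.inl j)) * X j + C (W (i, Sum.inr ()))

/-- generic version -/
noncomputable def gline (r : ℕ) (k : Type u) [Field k] {σ : Type} (i : σ) :
    MvPolynomial (Fin r) (MvPolynomial (σ × (Fin r ⊕ Unit)) k) :=
  ∑ j, C (X (i, Sum.inl j)) * X j + C (X (i, Sum.inr ()))

lemma map_gline {r : ℕ} (W : σ × (Fin r ⊕ Unit) → k) (F : MvPolynomial σ k) :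
    MvPolynomial.map (eval W) (aeval (gline r k) F) = aeval (line W) F := by
  let φ : MvPolynomial (Fin r) (MvPolynomial (σ × (Fin r ⊕ Unit)) k) →ₐ[k] MvPolynomial (Fin r) k :=
    mapAlgHom (aeval W)
  have : φ.comp (aeval (gline r k)) = aeval (line (σ := σ) W) := by
    apply MvPolynomial.algHom_ext
    intro i
    simp [φ, gline, line]
  have h2 := DFunLike.congr_fun this F
  rw [← h2]
  simp only [φ, AlgHom.comp_apply, mapAlgHom_apply]
  rw [MvPolynomial.map, ← coe_aeval_eq_eval]
  rfl

theorem slice_of_hom {r : ℕ} (f : Fin r → MvPolynomial σ k) (G : MvPolynomial σ k)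
    {D : Type u} [CommRing D] [IsDomain D] (Φ : MvPolynomial (Fin r) (MvPolynomial (σ × (Fin r ⊕ Unit)) k) →+* D)
    (hF : ∀ j, Φ (aeval (gline r k) (f j)) = 0) (hG : Φ (aeval (gline r k) G) ≠ 0) (hinj : ∀ a, Φ (C a) = 0 → a = 0) :
    ∃ H : MvPolynomial (σ × (Fin r ⊕ Unit)) k, H ≠ 0 ∧ ∀ W, eval W H ≠ 0 →
      aeval (line W) G ∉ Ideal.span (Set.range fun j => aeval (line W) (f j)) := by
  obtain ⟨H, hH0, hH⟩ := chev (fun j => aeval (gline r k) (f j)) (aeval (gline r k) G) Φ hF hG hinj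
  refine ⟨H, hH0, fun W hW hmem => ?_⟩
  obtain ⟨q, hq, hqp, hqF, hqG⟩ := hH (RingHom.ker (eval W)) (RingHom.ker_isPrime _) hW
  apply hqG
  rw [Ideal.mem_span_range_iff_exists_fun] at hmem
  obtain ⟨c, hc⟩ := hmem
  let c' : Fin r → MvPolynomial (Fin r) (MvPolynomial (σ × (Fin r ⊕ Unit)) k) := fun j => MvPolynomial.map C (c j)
  have hdiff : aeval (gline r k) G - ∑ j, c' j * aeval (gline r k) (f j) ∈ q := by
    have h1 : aeval (gline r k) G - ∑ j, c' j * aeval (gline r k) (f j) ∈ (RingHom.ker (eval W)).map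
        (C : _ →+* MvPolynomial (Fin r) (MvPolynomial (σ × (Fin r ⊕ Unit)) k)) := by
      rw [MvPolynomial.mem_map_C_iff]
      intro m
      rw [RingHom.mem_ker, ← coeff_map]
      have : MvPolynomial.map (eval W) (aeval (gline r k) G - ∑ j, c' j * aeval (gline r k) (f j)) = 0 := by
        rw [map_sub, map_sum, map_gline, ← hc, sub_eq_zero]
        refine Finset.sum_congr rfl fun j _ => ?_
        rw [map_mul, map_gline]
        congr 1
        simp only [c', MvPolynomial.map_map]
        have : (eval W).comp C = RingHom.id k := by ext; simp
        rw [this, MvPolynomial.map_id]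
      rw [this, coeff_zero]
    rw [← hqp] at h1
    exact Ideal.map_comap_le h1
  have h3 : ∑ j, c' j * aeval (gline r k) (f j) ∈ q :=
    Ideal.sum_mem _ fun j _ => Ideal.mul_mem_left _ _ (hqF j)
  simpa using Ideal.add_mem _ hdiff h3

/-- Step B -/
lemma stepB {r : ℕ} (P : Ideal (MvPolynomial σ k)) [P.IsPrime] (T : Set σ) 
    (hT : ∀ g ∈ P, SuppIn T g → g = 0) (ε : ↥(Tᶜ) ↪ Fin r) :
    ∃ e : σ → Fin r → k, ∀ g : MvPolynomial σ k,
      aeval (fun i => (C (Ideal.Quotient.mk P (X i)) - ∑ j, algebraMap k (MvPolynomial (Fin r) (MvPolynomial σ k ⧸ P)) (e i j) * X j : 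
        MvPolynomial (Fin r) (MvPolynomial σ k ⧸ P))) g = 0 → g = 0 := by
  classical
  let A := MvPolynomial σ k ⧸ P
  let x : σ → A := fun i => Ideal.Quotient.mk P (X i)
  refine ⟨fun i j => if h : i ∈ Tᶜ then (if ε ⟨i, h⟩ = j then 1 else 0) else 0, ?_⟩
  intro g hg
  -- automorphism
  have hx : AlgebraicIndependent k (fun i : T => x i) := by
    rw [AlgebraicIndependent, injective_iff_map_eq_zero]
    intro a ha
    have h1 : (aeval (fun i : T => x i)) a = Ideal.Quotient.mk P (rename (fun i : T => (i:σ)) a) := by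
      have : aeval (fun i : T => x i) = (Ideal.Quotient.mkₐ k P).comp (rename (fun i : T => (i:σ))) := by
        apply MvPolynomial.algHom_ext; intro i; simp [x]
      rw [this]; rfl
    rw [h1, Ideal.Quotient.eq_zero_iff_mem] at ha
    have h2 := hT _ ha (by
      intro m hm i hi
      obtain ⟨m', hm', -⟩ := coeff_rename_ne_zero _ _ _ hm
      rw [← hm'] at hi
      by_contra hiT
      apply hi
      exact Finsupp.mapDomain_of_notMem_range _ _ (by simpa using hiT))
    exact rename_injective _ Subtype.val_injective (by simpa using h2)
  have hy : AlgebraicIndependent A (fun i : ↥Tᶜ => (X (ε i) : MvPolynomial (Fin r) A)) :=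
    (MvPolynomial.algebraicIndependent_X (Fin r) A).comp ε ε.injective
  have hs := AlgebraicIndependent.sumElim_comp hx hy
  let y : σ → MvPolynomial (Fin r) A := fun i => if h : i ∈ Tᶜ then X (ε ⟨i, h⟩) else C (x i)
  have hyind : AlgebraicIndependent k y := by
    let eq : (↥Tᶜ ⊕ ↥T) ≃ σ := (Equiv.sumComm _ _).trans (Equiv.Set.sumCompl T)
    rw [← algebraicIndependent_equiv eq]
    convert hs using 1
    funext i
    rcases i with ⟨i, hi⟩ | ⟨i, hi⟩
    · simp [eq, y, (show i ∉ T from hi)]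
    · simp [eq, y, hi]
  let ρ : MvPolynomial (Fin r) A →ₐ[k] MvPolynomial (Fin r) A :=
    (aeval (R := A) (fun j : Fin r => if h : ∃ i, ε i = j then C (x h.choose) - X j else 0)).restrictScalars k
  have hρ : (ρ.comp (aeval (fun i => (C (x i) - ∑ j, algebraMap k (MvPolynomial (Fin r) A) ((fun i j => if h : i ∈ Tᶜ then (if ε ⟨i, h⟩ = j then 1 else 0) else 0) i j) * X j : 
        MvPolynomial (Fin r) A)))) = aeval y := by
    apply MvPolynomial.algHom_ext
    intro i
    by_cases hi : i ∈ Tᶜ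
    · have hex : ∃ i', ε i' = ε ⟨i, hi⟩ := ⟨_, rfl⟩
      have hch : hex.choose = ⟨i, hi⟩ := ε.injective hex.choose_spec
      have hρC : ρ (C (x i)) = C (x i) := by simp [ρ]
      have hρX : ρ (X (ε ⟨i, hi⟩)) = C (x i) - X (ε ⟨i, hi⟩) := by
        simp only [ρ, AlgHom.restrictScalars_apply, aeval_X]
        rw [dif_pos hex, hch]
      simp only [AlgHom.comp_apply, aeval_X, hi, dite_true, map_sub, y]
      rw [Finset.sum_eq_single (ε ⟨i, hi⟩)]
      · rw [if_pos rfl, map_one, one_mul, hρC, hρX]; ring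
      · intro b _ hb; simp [Ne.symm hb]
      · simp
    · have hi' : i ∈ T := by simpa using hi
      simp [hi', y, ρ]
  have h1 := DFunLike.congr_fun hρ g
  rw [AlgHom.comp_apply, hg, map_zero] at h1
  exact (injective_iff_map_eq_zero _).mp hyind _ h1.symm

lemma exists_eval_ne_zero [Infinite k] {τ : Type} {F : MvPolynomial τ k} (hF : F ≠ 0) : ∃ x : τ → k, eval x F ≠ 0 := by
  by_contra h
  push Not at h
  exact hF (MvPolynomial.funext (fun x => by simp [h x]))

/-- the map from generic coordinates -/
noncomputable def wmap {r : ℕ} {A : Type u} [CommRing A] (x : σ → A) (v : σ × (Fin r ⊕ Unit)) :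
    MvPolynomial (σ × Fin r) (MvPolynomial (Fin r) A) :=
  Sum.elim (fun j => X (v.1, j)) (fun _ => C (C (x v.1)) - ∑ j : Fin r, X (v.1, j) * C (X j)) v.2

theorem stepC [Infinite k] {r : ℕ} {A : Type u} [CommRing A] [IsDomain A] [Algebra k A] (x : σ → A) (e : σ → Fin r → k)
    (he : ∀ g : MvPolynomial σ k,
      aeval (fun i => (C (x i) - ∑ j, algebraMap k (MvPolynomial (Fin r) A) (e i j) * X j : 
        MvPolynomial (Fin r) A)) g = 0 → g = 0)
    (F : MvPolynomial (σ × (Fin r ⊕ Unit)) k)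
    (hF : aeval (wmap (r := r) x) F = 0) : F = 0 := by
  by_contra hF0
  obtain ⟨W, hW⟩ := exists_eval_ne_zero hF0
  let path : σ → Fin r → Polynomial k := fun i j => Polynomial.C (e i j) + Polynomial.X * Polynomial.C (W (i, Sum.inl j) - e i j)
  let α : MvPolynomial (σ × (Fin r ⊕ Unit)) k →ₐ[k] Polynomial (MvPolynomial σ k) :=
    aeval (fun v => Sum.elim (fun j => Polynomial.mapAlgHom (Algebra.ofId k (MvPolynomial σ k)) (path v.1 j)) (fun _ => Polynomial.C (X v.1)) v.2)
  let s : Polynomial (MvPolynomial (Fin r) A) := Polynomial.X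
  let pathA : σ → Fin r → Polynomial (MvPolynomial (Fin r) A) := fun i j => Polynomial.aeval s (path i j)
  let Y : σ → Polynomial (MvPolynomial (Fin r) A) := fun i => 
    Polynomial.C (C (x i)) - ∑ j, pathA i j * Polynomial.C (X j)
  let Θ : Polynomial (MvPolynomial σ k) →+* Polynomial (MvPolynomial (Fin r) A) :=
    Polynomial.eval₂RingHom (aeval Y : MvPolynomial σ k →ₐ[k] _).toRingHom s
  let π : MvPolynomial (σ × Fin r) (MvPolynomial (Fin r) A) →+* Polynomial (MvPolynomial (Fin r) A) :=
    eval₂Hom Polynomial.C (fun v => pathA v.1 v.2)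
  have hcomm : ∀ F, Θ (α F) = π (aeval (wmap (r := r) x) F) := by
    intro F
    have hΘs : ∀ i j, Θ (Polynomial.mapAlgHom (Algebra.ofId k (MvPolynomial σ k)) (path i j)) = pathA i j := by
      intro i j
      simp [Θ, path, pathA, s, Algebra.ofId_apply]
    induction F using MvPolynomial.induction_on with
    | C a => 
      simp only [α, aeval_C]
      simp [Θ, π, Polynomial.algebraMap_apply, MvPolynomial.algebraMap_eq, Polynomial.algebraMap_def]
    | add p q hp hq => simp [hp, hq]
    | mul_X p v hp =>
      rw [map_mul, map_mul, hp, map_mul, map_mul]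
      congr 1
      rcases v with ⟨i, j | u⟩
      · simp only [α, aeval_X, Sum.elim_inl, hΘs]; simp [π, wmap]
      · simp only [α, aeval_X, Sum.elim_inr]
        simp [π, Θ, Y, wmap]
  have h1 : Θ (α F) = 0 := by rw [hcomm, hF, map_zero]
  have hα : α F ≠ 0 := by
    intro h0
    have : eval (fun i => W (i, Sum.inr ())) ((α F).eval 1) = eval W F := by
      clear hF0 hW h1 h0 hF
      induction F using MvPolynomial.induction_on with
      | C a => simp [α, Polynomial.algebraMap_def]
      | add p q hp hq => simp [hp, hq]
      | mul_X p v hp =>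
        rw [map_mul, Polynomial.eval_mul, map_mul, hp, map_mul]
        congr 1
        rcases v with ⟨i, j | u⟩
        · simp [α, path, Algebra.ofId_apply]
        · simp [α]
    rw [h0] at this
    simp at this
    exact hW this.symm
  obtain ⟨F1, hF1, hnd⟩ := Polynomial.exists_eq_pow_rootMultiplicity_mul_and_not_dvd (α F) hα 0
  rw [map_zero, sub_zero, Polynomial.X_dvd_iff] at hnd
  rw [map_zero, sub_zero] at hF1
  have h2 : Θ F1 = 0 := by
    rw [hF1, map_mul, map_pow] at h1
    have hX : Θ Polynomial.X = Polynomial.X := by simp [Θ, s]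
    rw [hX] at h1
    rcases mul_eq_zero.mp h1 with h | h
    · exact absurd h (pow_ne_zero _ Polynomial.X_ne_zero)
    · exact h
  apply hnd
  apply he
  have h3 : (Θ F1).eval 0 = 0 := by rw [h2]; simp
  rw [← h3]
  have key : ∀ a : MvPolynomial σ k, (aeval Y a).eval 0 = aeval (fun i => (C (x i) - ∑ j, algebraMap k (MvPolynomial (Fin r) A) (e i j) * X j : 
        MvPolynomial (Fin r) A)) a := by
    intro a
    induction a using MvPolynomial.induction_on with
    | C a => simp [Polynomial.algebraMap_def]
    | add p q hp hq => simp [hp, hq]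
    | mul_X p i hp =>
      rw [map_mul, Polynomial.eval_mul, hp, map_mul]
      congr 1
      simp [Y, pathA, path, s, Polynomial.eval_finsetSum, Polynomial.algebraMap_def]
  rw [← key]
  simp only [Θ, Polynomial.coe_eval₂RingHom, s]
  rw [Polynomial.eval₂_eq_sum_range, Polynomial.eval_finsetSum, Finset.sum_eq_single 0]
  · simp
  · intro b _ hb; simp [hb]
  · simp


theorem slice_core [Infinite k] [Finite σ] {r : ℕ} {A : Type u} [CommRing A] [IsDomain A] [Algebra k A] (x : σ → A) (e : σ → Fin r → k)
    (he : ∀ g : MvPolynomial σ k,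
      aeval (fun i => (C (x i) - ∑ j, algebraMap k (MvPolynomial (Fin r) A) (e i j) * X j : 
        MvPolynomial (Fin r) A)) g = 0 → g = 0)
    (f : Fin r → MvPolynomial σ k) (G : MvPolynomial σ k) (hf : ∀ j, aeval x (f j) = 0) (hG : aeval x G ≠ 0) :
    ∃ H : MvPolynomial (σ × (Fin r ⊕ Unit)) k, H ≠ 0 ∧ ∀ W, eval W H ≠ 0 →
      aeval (line W) G ∉ Ideal.span (Set.range fun j => aeval (line W) (f j)) := by
  let ψ : MvPolynomial (σ × (Fin r ⊕ Unit)) k →ₐ[k] MvPolynomial (σ × Fin r) (MvPolynomial (Fin r) A) :=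
    aeval (wmap x)
  have hψ1 : ∀ i j, ψ (X (i, Sum.inl j)) = X (i, j) := fun i j => by simp only [ψ, aeval_X, wmap, Sum.elim_inl]
  have hψ2 : ∀ i, ψ (X (i, Sum.inr ())) = C (C (x i)) - ∑ j : Fin r, X (i, j) * C (X j) := 
    fun i => by simp only [ψ, aeval_X, wmap, Sum.elim_inr]
  have hψ3 : ∀ a, ψ a = 0 → a = 0 := fun a ha => stepC (k := k) x e he a ha
  clear_value ψ
  let Φ : MvPolynomial (Fin r) (MvPolynomial (σ × (Fin r ⊕ Unit)) k) →+* MvPolynomial (σ × Fin r) (MvPolynomial (Fin r) A) :=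
    eval₂Hom (ψ : _ →+* _) (fun j => C (X j))
  have hΦC : ∀ a, Φ (C a) = ψ a := fun a => by simp only [Φ, eval₂Hom_C]; rfl
  have hΦX : ∀ a, Φ (X a) = C (X a) := fun a => by simp only [Φ, eval₂Hom_X']
  clear_value Φ
  have hΦ : ∀ g : MvPolynomial σ k, Φ (aeval (gline r k) g) = C (C (aeval x g)) := by
    intro g
    induction g using MvPolynomial.induction_on with
    | C a => 
      rw [aeval_C, aeval_C]
      have : algebraMap k (MvPolynomial (Fin r) (MvPolynomial (σ × (Fin r ⊕ Unit)) k)) a = C (C a) := rfl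
      rw [this, hΦC]
      exact ψ.commutes a
    | add p q hp hq => simp only [map_add, hp, hq]
    | mul_X p i hp =>
      rw [map_mul, map_mul, hp, map_mul, map_mul, map_mul]
      congr 1
      rw [aeval_X, aeval_X, gline, map_add, map_sum, hΦC, hψ2]
      simp only [map_mul, hΦC, hΦX, hψ1]
      ring
  refine slice_of_hom f G Φ ?_ ?_ ?_
  · intro j
    rw [hΦ, hf]; simp
  · rw [hΦ]
    intro h
    apply hG
    rw [C_eq_zero, C_eq_zero] at h
    exact h
  · intro a ha
    exact hψ3 a (by rw [← hΦC]; exact ha)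

theorem slice [Infinite k] [Finite σ] {r : ℕ} (f : Fin r → MvPolynomial σ k) (G : MvPolynomial σ k)
    (hG : G ∉ (Ideal.span (Set.range f)).radical) :
    ∃ H : MvPolynomial (σ × (Fin r ⊕ Unit)) k, H ≠ 0 ∧ ∀ W, eval W H ≠ 0 →
      aeval (line W) G ∉ Ideal.span (Set.range fun j => aeval (line W) (f j)) := by
  classical
  rw [← Ideal.sInf_minimalPrimes, Ideal.mem_sInf] at hG
  push Not at hG
  obtain ⟨P, hP, hGP⟩ := hG
  have hPp : P.IsPrime := hP.1.1
  have hfP : ∀ j, f j ∈ P := fun j => hP.1.2 (Ideal.subset_span ⟨j, rfl⟩)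
  have hht : P.height ≤ r := by
    have hfin : (Set.range f) = ((Finset.univ.image f : Finset _) : Set _) := by simp
    rw [hfin] at hP
    refine (Ideal.height_le_card_of_mem_minimalPrimes_span_finset hP).trans ?_
    have := Finset.card_image_le (s := Finset.univ) (f := f)
    simp at this
    exact_mod_cast this
  obtain ⟨T, hT, hTc⟩ := exists_T σ P
  have hcard : Tᶜ.ncard ≤ r := by exact_mod_cast hTc.trans hht
  have : Fintype σ := Fintype.ofFinite σ
  have hemb : Nonempty (↥Tᶜ ↪ Fin r) := by
    rw [Function.Embedding.nonempty_iff_card_le]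
    rw [Fintype.card_fin, ← Nat.card_eq_fintype_card]
    exact hcard
  obtain ⟨ε⟩ := hemb
  obtain ⟨e, he⟩ := stepB P T hT ε
  have hx : ∀ g, aeval (fun i => Ideal.Quotient.mk P (X i)) g = Ideal.Quotient.mk P g := by
    intro g
    have : aeval (fun i => Ideal.Quotient.mk P (X i)) = Ideal.Quotient.mkₐ k P := by
      apply MvPolynomial.algHom_ext; intro i; simp
    rw [this]; rfl
  refine slice_core (fun i => Ideal.Quotient.mk P (X i)) e he f G ?_ ?_
  · intro j; rw [hx]; exact Ideal.Quotient.eq_zero_iff_mem.mpr (hfP j)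
  · rw [hx]; intro h; exact hGP (Ideal.Quotient.eq_zero_iff_mem.mp h)
end RatDense

namespace RatDense
universe u
variable {k : Type u} [Field k] {σ : Type}

/-- radical ideal of a family -/
noncomputable abbrev rad {ι : Type} (f : ι → MvPolynomial σ k) : Ideal (MvPolynomial σ k) :=
  (Ideal.span (Set.range f)).radical

/-- gradient of `f` at `P` -/
noncomputable def grad (P : σ → k) (f : MvPolynomial σ k) : σ → k := fun i => eval P (pderiv i f)

structure Good {ι : Type} (f : ι → MvPolynomial σ k) : Prop where
  prime : (rad f).IsPrime
  dense : ∀ G, G ∉ rad f → ∃ P : σ → k, (∀ j, eval P (f j) = 0) ∧ eval P G ≠ 0 ∧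
    LinearIndependent k (fun j => grad P (f j))

lemma aeval_sub_mem {A : Type*} [CommRing A] [Algebra k A] (I : Ideal A) (x x' : σ → A)
    (h : ∀ i, x i - x' i ∈ I) (f : MvPolynomial σ k) : aeval x f - aeval x' f ∈ I := by
  rw [← Ideal.Quotient.eq]
  have : (Ideal.Quotient.mkₐ k I).comp (aeval x) = (Ideal.Quotient.mkₐ k I).comp (aeval x') := by
    apply MvPolynomial.algHom_ext
    intro i
    simp only [AlgHom.comp_apply, aeval_X, Ideal.Quotient.mkₐ_eq_mk]
    exact Ideal.Quotient.eq.mpr (h i)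
  exact DFunLike.congr_fun this f

lemma taylor2 [Fintype σ] {A : Type*} [CommRing A] [Algebra k A] (f : MvPolynomial σ k) (x δ : σ → A)
    (I : Ideal A) (hδ : ∀ i j, δ i * δ j ∈ I) :
    aeval (x + δ) f - aeval x f - ∑ i, δ i * aeval x (pderiv i f) ∈ I := by
  classical
  induction f using MvPolynomial.induction_on with
  | C a => simp
  | add p q hp hq =>
    have := Ideal.add_mem _ hp hq
    convert this using 1
    simp only [map_add, mul_add, Finset.sum_add_distrib]
    ring
  | mul_X p n hp =>
    have h1 : ∑ i, δ i * aeval x (pderiv i (p * X n)) =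
        (∑ i, δ i * aeval x (pderiv i p)) * x n + aeval x p * δ n := by
      have : ∀ i, δ i * aeval x (pderiv i (p * X n)) = δ i * aeval x (pderiv i p) * x n + 
          (if i = n then aeval x p * δ n else 0) := by
        intro i
        rw [Derivation.leibniz, pderiv_X]
        by_cases h : i = n
        · subst h; simp; ring
        · simp [h, Pi.single_apply, Ne.symm h]; ring
      simp only [this, Finset.sum_add_distrib, Finset.sum_mul]
      simp
    rw [h1]
    simp only [map_mul, aeval_X, Pi.add_apply]
    have h2 : (∑ i, δ i * aeval x (pderiv i p)) * δ n ∈ I := by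
      rw [Finset.sum_mul]
      refine Ideal.sum_mem _ fun i _ => ?_
      have := Ideal.mul_mem_right (aeval x (pderiv i p)) I (hδ i n)
      convert this using 1; ring
    have h3 := Ideal.add_mem _ (Ideal.mul_mem_right (x n + δ n) I hp) h2
    convert h3 using 1
    ring

/-- directional derivative from linear expansion -/
lemma grad_of_expand [Fintype σ] (f : MvPolynomial σ k) (P u : σ → k) (a c : k)
    (h : aeval (fun i => (Polynomial.C (P i) + Polynomial.C (u i) * Polynomial.X : Polynomial k)) f = 
      Polynomial.C a + Polynomial.C c * Polynomial.X) : ∑ i, u i * grad P f i = c := by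
  have h1 := taylor2 f (fun i => Polynomial.C (P i)) (fun i => Polynomial.C (u i) * Polynomial.X)
    (Ideal.span {(Polynomial.X : Polynomial k)^2}) (fun i j => by
      rw [Ideal.mem_span_singleton]
      exact ⟨Polynomial.C (u i * u j), by rw [Polynomial.C_mul]; ring⟩)
  have h2 : ∀ g : MvPolynomial σ k, aeval (fun i => (Polynomial.C (P i) : Polynomial k)) g = Polynomial.C (eval P g) := by
    intro g
    have : aeval (fun i => (Polynomial.C (P i) : Polynomial k)) = (Algebra.ofId k (Polynomial k)).comp (aeval P) := by
      apply MvPolynomial.algHom_ext; intro i; simp [Algebra.ofId_apply]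
    rw [this]; simp [Algebra.ofId_apply, aeval_eq_eval]
  rw [Ideal.mem_span_singleton, Polynomial.X_pow_dvd_iff] at h1
  have h3 := h1 1 (by norm_num)
  have h4 : ((fun i => Polynomial.C (P i)) + fun i => Polynomial.C (u i) * Polynomial.X : σ → Polynomial k) = 
    fun i => (Polynomial.C (P i) + Polynomial.C (u i) * Polynomial.X : Polynomial k) := rfl
  rw [h4, h] at h3
  simp only [h2] at h3
  have h5 : ∀ i, (Polynomial.C (u i) * Polynomial.X * Polynomial.C (eval P (pderiv i f)) : Polynomial k) =
     Polynomial.C (u i * grad P f i) * Polynomial.X := by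
    intro i; rw [grad, Polynomial.C_mul]; ring
  simp only [h5] at h3
  rw [← Finset.sum_mul, ← map_sum] at h3
  simp [Polynomial.coeff_X, Polynomial.coeff_C] at h3
  rw [sub_eq_zero] at h3
  simpa using h3.symm

/-- the affine family in an algebra -/
noncomputable def pt {r : ℕ} (W : σ × (Fin r ⊕ Unit) → k) (v : Fin r → σ → k) (A : Type u) [CommRing A] [Algebra k A]
    (ξ y : Fin r → A) (i : σ) : A :=
  ∑ j, W (i, Sum.inl j) • ξ j + algebraMap k A (W (i, Sum.inr ())) + ∑ l, v l i • y l

def EE {r : ℕ} (f : Fin r → MvPolynomial σ k) : Prop :=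
  ∀ H : MvPolynomial (σ × (Fin r ⊕ Unit)) k, H ≠ 0 → ∃ W, eval W H ≠ 0 ∧
    ∃ (v : Fin r → σ → k) (c : Fin r → k), (∀ l, c l ≠ 0) ∧
      ∀ (A : Type u) [CommRing A] [Algebra k A] (ξ y : Fin r → A) (j : Fin r),
        aeval (pt W v A ξ y) (f j) = aeval (pt W v A ξ (fun l => if l < j then y l else 0)) (f j) + c j • y j

lemma exists_tri {A : Type*} {r : ℕ} [Zero A] (Φ : Fin r → (Fin r → A) → A) : 
    ∃ y : Fin r → A, ∀ j, y j = Φ j (fun l => if l < j then y l else 0) := by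
  have : ∀ m, m ≤ r → ∃ y : Fin r → A, ∀ j : Fin r, (j:ℕ) < m → y j = Φ j (fun l => if l < j then y l else 0) := by
    intro m
    induction m with
    | zero => intro _; exact ⟨fun _ => 0, fun j hj => by omega⟩
    | succ m ih =>
      intro hm
      obtain ⟨y, hy⟩ := ih (by omega)
      refine ⟨Function.update y ⟨m, hm⟩ (Φ ⟨m, hm⟩ (fun l => if l < ⟨m, hm⟩ then y l else 0)), ?_⟩
      intro j hj
      have key : (fun l => if l < j then Function.update y ⟨m, hm⟩ (Φ ⟨m, hm⟩ (fun l => if l < ⟨m, hm⟩ then y l else 0)) l else 0) = 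
          fun l => if l < j then y l else 0 := by
        funext l
        by_cases hl : l < j
        · have : l ≠ ⟨m, hm⟩ := by
            rintro rfl
            have : m < (j:ℕ) := hl
            omega
          simp [hl, Function.update_of_ne this]
        · simp [hl]
      rw [key]
      by_cases hjm : j = ⟨m, hm⟩
      · subst hjm; simp
      · rw [Function.update_of_ne hjm]
        apply hy
        have : (j:ℕ) ≠ m := fun h => hjm (Fin.ext h)
        omega
  obtain ⟨y, hy⟩ := this r le_rfl
  exact ⟨y, fun j => hy j j.2⟩

theorem psi_exists {r : ℕ} (f : Fin r → MvPolynomial σ k) (W : σ × (Fin r ⊕ Unit) → k) (v : Fin r → σ → k) (c : Fin r → k)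
    (hc : ∀ l, c l ≠ 0)
    (hE : ∀ (A : Type u) [CommRing A] [Algebra k A] (ξ y : Fin r → A) (j : Fin r),
        aeval (pt W v A ξ y) (f j) = aeval (pt W v A ξ (fun l => if l < j then y l else 0)) (f j) + c j • y j) :
    ∃ y : Fin r → MvPolynomial (Fin r) k, (∀ j, aeval (pt W v (MvPolynomial (Fin r) k) X y) (f j) = 0) ∧
      ∀ G : MvPolynomial σ k, aeval (line W) G ∉ Ideal.span (Set.range fun j => aeval (line W) (f j)) → 
        aeval (pt W v (MvPolynomial (Fin r) k) X y) G ≠ 0 := by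
  obtain ⟨y, hy⟩ := exists_tri (A := MvPolynomial (Fin r) k) (fun j y => -(c j)⁻¹ • aeval (pt W v (MvPolynomial (Fin r) k) X y) (f j))
  set I := Ideal.span (Set.range fun j => aeval (line W) (f j)) with hI
  have hsub : ∀ z : Fin r → MvPolynomial (Fin r) k, (∀ l, z l ∈ I) → ∀ i, pt W v _ X z i - line W i ∈ I := by
    intro z hz i
    have : pt W v _ X z i - line W i = ∑ l, v l i • z l := by
      simp only [pt, line, MvPolynomial.smul_eq_C_mul, MvPolynomial.algebraMap_eq]; ring
    rw [this]
    refine Ideal.sum_mem _ fun l _ => ?_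
    rw [MvPolynomial.smul_eq_C_mul]
    exact Ideal.mul_mem_left _ _ (hz l)
  have hyI : ∀ j, y j ∈ I := by
    intro j
    induction j using WellFoundedLT.induction with
    | ind j ih =>
      rw [hy j, MvPolynomial.smul_eq_C_mul]
      refine Ideal.mul_mem_left _ _ ?_
      have h1 := aeval_sub_mem I _ _ (hsub (fun l => if l < j then y l else 0) (fun l => by
        by_cases hl : l < j
        · simpa [hl] using ih l hl
        · simp [hl])) (f j)
      have h2 : aeval (line W) (f j) ∈ I := Ideal.subset_span ⟨j, rfl⟩
      simpa using Ideal.add_mem _ h1 h2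
  refine ⟨y, ?_, ?_⟩
  · intro j
    rw [hE, ]
    conv_lhs => rw [hy j]
    rw [smul_smul]
    rw [mul_neg, mul_inv_cancel₀ (hc j)]
    simp
  · intro G hG h0
    apply hG
    have h1 := aeval_sub_mem I _ _ (hsub y hyI) G
    rw [h0, zero_sub] at h1
    exact neg_mem_iff.mp h1

lemma aeval_rad_zero {ι : Type} {A : Type*} [CommRing A] [IsDomain A] [Algebra k A] {f : ι → MvPolynomial σ k} {x : σ → A}
    (hx : ∀ j, aeval x (f j) = 0) {G : MvPolynomial σ k} (hG : G ∈ rad f) : aeval x G = 0 := by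
  obtain ⟨n, hn⟩ := hG
  have : Ideal.span (Set.range f) ≤ RingHom.ker (aeval x : MvPolynomial σ k →ₐ[k] A) := by
    rw [Ideal.span_le]; rintro _ ⟨j, rfl⟩; exact hx j
  have h := this hn
  rw [RingHom.mem_ker, map_pow] at h
  by_contra ha; exact pow_ne_zero n ha h

theorem good_of_EE [Infinite k] [Fintype σ] {r : ℕ} (f : Fin r → MvPolynomial σ k) (hf : EE f) : Good f := by
  refine ⟨?_, ?_⟩
  · refine ⟨?_, ?_⟩
    · intro htop
      obtain ⟨W, -, v, c, hc, hE⟩ := hf 1 one_ne_zero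
      obtain ⟨y, hy, -⟩ := psi_exists f W v c hc hE
      have h1 : (1 : MvPolynomial σ k) ∈ rad f := by rw [htop]; trivial
      have := aeval_rad_zero hy h1
      simp at this
    · intro G1 G2 h12
      by_contra hcon
      push Not at hcon
      obtain ⟨h1, h2⟩ := hcon
      obtain ⟨H1, hH1, hs1⟩ := slice f G1 h1
      obtain ⟨H2, hH2, hs2⟩ := slice f G2 h2
      obtain ⟨W, hW, v, c, hc, hE⟩ := hf (H1 * H2) (mul_ne_zero hH1 hH2)
      rw [map_mul, mul_ne_zero_iff] at hW
      obtain ⟨y, hy, hyG⟩ := psi_exists f W v c hc hE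
      have := aeval_rad_zero hy h12
      rw [map_mul, mul_eq_zero] at this
      rcases this with h | h
      · exact hyG G1 (hs1 W hW.1) h
      · exact hyG G2 (hs2 W hW.2) h
  · intro G hG
    obtain ⟨H, hH, hs⟩ := slice f G hG
    obtain ⟨W, hW, v, c, hc, hE⟩ := hf H hH
    obtain ⟨y, hy, hyG⟩ := psi_exists f W v c hc hE
    obtain ⟨p, hp⟩ := exists_eval_ne_zero (hyG G (hs W hW))
    let P : σ → k := fun i => eval p (pt W v _ X y i)
    have hev : ∀ g : MvPolynomial σ k, eval P g = eval p (aeval (pt W v _ X y) g) := by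
      intro g
      have : (aeval P : MvPolynomial σ k →ₐ[k] k) = (aeval p).comp (aeval (pt W v _ X y)) := by
        apply MvPolynomial.algHom_ext; intro i; simp [P, aeval_eq_eval]
      have h2 := DFunLike.congr_fun this g
      simpa [aeval_eq_eval] using h2
    refine ⟨P, fun j => by rw [hev, hy, map_zero], by rw [hev]; exact hp, ?_⟩
    have hder : ∀ j l, j ≤ l → ∑ i, v l i * grad P (f j) i = if l = j then c j else 0 := by
      intro j l hjl
      have h1 := hE (Polynomial k) (fun j => Polynomial.C (p j)) (fun l' => Polynomial.C (eval p (y l')) + if l' = l then Polynomial.X else 0) j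
      have h2 : pt W v (Polynomial k) (fun j => Polynomial.C (p j)) (fun l' => Polynomial.C (eval p (y l')) + if l' = l then Polynomial.X else 0)
          = fun i => (Polynomial.C (P i) + Polynomial.C (v l i) * Polynomial.X : Polynomial k) := by
        funext i
        simp only [pt, P, smul_add, Finset.sum_add_distrib, map_add, map_sum]
        simp [Polynomial.smul_eq_C_mul, MvPolynomial.smul_eq_C_mul, Polynomial.algebraMap_apply]
        ring
      have h3 : pt W v (Polynomial k) (fun j => Polynomial.C (p j)) (fun l' => if l' < j then Polynomial.C (eval p (y l')) + (if l' = l then Polynomial.X else 0) else 0)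
          = fun i => algebraMap k (Polynomial k) (pt W v k p (fun l' => if l' < j then eval p (y l') else 0) i) := by
        funext i
        have : ∀ l', (if l' < j then Polynomial.C (eval p (y l')) + (if l' = l then Polynomial.X else 0) else 0 : Polynomial k) = 
            algebraMap k (Polynomial k) (if l' < j then eval p (y l') else 0) := by
          intro l'
          by_cases h : l' < j
          · have : l' ≠ l := fun h' => by subst h'; exact absurd h (not_lt.mpr hjl)
            simp [h, this]
          · simp [h]
        simp only [pt, this, map_add, map_sum, Algebra.smul_def, map_mul]
        simp
      rw [h2, h3] at h1
      have h4 : ∀ (z : σ → k), aeval (fun i => algebraMap k (Polynomial k) (z i)) (f j) = Polynomial.C (aeval z (f j)) := by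
        intro z
        rw [← Polynomial.algebraMap_eq, ← aeval_algebraMap_apply]
        rfl
      rw [h4] at h1
      refine grad_of_expand (f j) P (v l) (aeval (pt W v k p (fun l' => if l' < j then eval p (y l') else 0)) (f j) + c j * eval p (y j)) _ ?_
      rw [h1]
      by_cases h : j = l
      · subst h; simp [Polynomial.smul_eq_C_mul]; ring
      · simp [h, Ne.symm h, Polynomial.smul_eq_C_mul]
    let M : Matrix (Fin r) (Fin r) k := fun j l => ∑ i, v l i * grad P (f j) i
    have hdet : M.det ≠ 0 := by
      rw [Matrix.det_of_lowerTriangular]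
      · rw [Finset.prod_ne_zero_iff]
        intro j _
        have : M j j = c j := by simp [M, hder j j le_rfl]
        rw [this]; exact hc j
      · intro i j hij
        have hij' : i < j := by simpa using hij
        have := hder i j hij'.le
        rw [if_neg hij'.ne'] at this
        exact this
    rw [Fintype.linearIndependent_iff]
    intro a ha
    have : Matrix.vecMul a M = 0 := by
      funext l
      simp only [Matrix.vecMul, dotProduct, M, Pi.zero_apply]
      simp only [Finset.mul_sum]
      rw [Finset.sum_comm]
      refine Finset.sum_eq_zero fun i _ => ?_
      have := congrFun ha i
      simp only [Finset.sum_apply, Pi.smul_apply, smul_eq_mul, Pi.zero_apply] at this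
      have h2 : ∑ x, a x * (v l i * grad P (f x) i) = v l i * ∑ x, a x * grad P (f x) i := by
        rw [Finset.mul_sum]; exact Finset.sum_congr rfl fun _ _ => by ring
      rw [h2, this, mul_zero]
    have := Matrix.eq_zero_of_vecMul_eq_zero hdet this
    intro i; exact congrFun this i
end RatDense

namespace RatDense
universe u
variable {k : Type u} [Field k] {σ : Type}

section adic
/-- maximal ideal at the origin -/
noncomputable abbrev mm (k : Type u) [Field k] (σ : Type) : Ideal (MvPolynomial σ k) := idealOfVars σ k

lemma mem_mm {f : MvPolynomial σ k} : f ∈ mm k σ ↔ constantCoeff f = 0 := by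
  have := mem_pow_idealOfVars_iff' 1 f
  rw [pow_one] at this
  rw [mm, this]
  constructor
  · intro h; exact h 0 (by simp)
  · intro h x hx
    have : x = 0 := by rw [← Finsupp.degree_eq_zero_iff]; omega
    subst this; exact h

lemma mem_of_pow_mem {f : MvPolynomial σ k} {n N : ℕ} (h : f ^ n ∈ (mm k σ) ^ (n * N)) (hn : n ≠ 0) :
    f ∈ (mm k σ) ^ N := by
  classical
  rw [mem_pow_idealOfVars_iff'] at h ⊢
  have h1 : ((n * N : ℕ) : ℕ∞) ≤ ((f : MvPowerSeries σ k) ^ n).order := by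
    apply MvPowerSeries.nat_le_order
    intro d hd
    rw [← MvPolynomial.coe_pow, MvPolynomial.coeff_coe]; exact h d hd
  have hp : ∀ n : ℕ, ((f : MvPowerSeries σ k) ^ n).order = n * (f : MvPowerSeries σ k).order := by
    intro n
    induction n with
    | zero => rw [pow_zero, Nat.cast_zero, zero_mul, show (1 : MvPowerSeries σ k) = MvPowerSeries.monomial 0 1 from rfl, MvPowerSeries.order_monomial_of_ne_zero one_ne_zero]; simp
    | succ n ih => rw [pow_succ, MvPowerSeries.order_mul, ih]; push_cast; ring
  rw [hp] at h1
  have h2 : (N : ℕ∞) ≤ (f : MvPowerSeries σ k).order := by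
    rcases eq_or_ne (f : MvPowerSeries σ k).order ⊤ with h | h
    · rw [h]; exact le_top
    · lift (f : MvPowerSeries σ k).order to ℕ using h with o
      norm_cast at h1 ⊢
      exact Nat.le_of_mul_le_mul_left h1 (Nat.pos_of_ne_zero hn)
  intro x hx
  rw [← MvPolynomial.coeff_coe]
  apply MvPowerSeries.coeff_of_lt_order
  exact lt_of_lt_of_le (by exact_mod_cast hx) h2

/-- translate -/
noncomputable def tr (P : σ → k) : MvPolynomial σ k →ₐ[k] MvPolynomial σ k :=
  aeval (fun i => X i + C (P i))

lemma constantCoeff_aeval (φ : σ → MvPolynomial σ k) (f : MvPolynomial σ k) :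
    constantCoeff (aeval φ f) = eval (fun i => constantCoeff (φ i)) f := by
  have : (constantCoeff.comp (aeval φ).toRingHom : MvPolynomial σ k →+* k) = eval (fun i => constantCoeff (φ i)) := by
    apply MvPolynomial.ringHom_ext <;> simp
  exact DFunLike.congr_fun this f

lemma constantCoeff_tr (P : σ → k) (f : MvPolynomial σ k) : constantCoeff (tr P f) = eval P f := by
  rw [tr, constantCoeff_aeval]; simp

variable {B : Type}

lemma cmp_pow_mm [Fintype B] {β : σ → B} {A : B → ℕ} {f : MvPolynomial σ k} {N : ℕ} (h : f ∈ (mm k σ) ^ N) (hA : tdeg A < N) :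
    cmp β A f = 0 := by
  classical
  rw [mem_pow_idealOfVars_iff'] at h
  ext m
  rw [coeff_cmp, coeff_zero]
  split_ifs with hm
  · apply h; rw [← tdeg_weight β, hm]; exact hA
  · rfl

lemma MH.pderiv [Fintype B] {β : σ → B} {f : MvPolynomial σ k} {a : B → ℕ} (hf : MH β f a) (i : σ) (m : σ →₀ ℕ)
   (hm : coeff m (MvPolynomial.pderiv i f) ≠ 0) : Finsupp.weight (wt β) m + wt β i = a := by
  rw [coeff_pderiv] at hm
  have := hf (left_ne_zero_of_mul hm)
  rw [← this, map_add]
  congr 1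
  simp [Finsupp.weight_single]

def LTd (n : ℕ) (q : MvPolynomial σ k) : Prop := ∀ m : σ →₀ ℕ, n ≤ m.degree → coeff m q = 0

lemma LTd.mul_X {n : ℕ} {q : MvPolynomial σ k} (h : LTd n q) (i : σ) : LTd (n+1) (q * X i) := by
  classical
  intro m hm
  rw [coeff_mul_X']
  split_ifs with hi
  · apply h
    have h1 : m - Finsupp.single i 1 + Finsupp.single i 1 = m := by
      ext j
      by_cases hj : j = i
      · subst hj; simp; have := Finsupp.mem_support_iff.mp hi; omega
      · simp [Finsupp.single_apply, Ne.symm hj]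
    have h2 := congrArg Finsupp.degree h1
    rw [map_add, Finsupp.degree_single] at h2
    omega
  · rfl

lemma LTd_monomial (m : σ →₀ ℕ) (c : k) : LTd (m.degree + 1) (monomial m c) := by
  classical
  intro m' hm'
  rw [coeff_monomial, if_neg]
  rintro rfl; omega

lemma tr_mono' (P : σ → k) (n : ℕ) : ∀ m : σ →₀ ℕ, m.degree = n → LTd n (tr P (monomial m (1:k)) - monomial m 1) := by
  classical
  induction n with
  | zero => intro m hm m' hm'; rw [Finsupp.degree_eq_zero_iff] at hm; subst hm; simp [tr]
  | succ n ih =>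
    intro m hm
    obtain ⟨i, hi⟩ : ∃ i, m i ≠ 0 := by
      by_contra! h
      have : m = 0 := by ext i; exact h i
      subst this; simp at hm
    have h1 : m - Finsupp.single i 1 + Finsupp.single i 1 = m := by
      ext j
      by_cases hj : j = i
      · subst hj; simp; omega
      · simp [Finsupp.single_apply, Ne.symm hj]
    set m₁ := m - Finsupp.single i 1
    have h2 : m₁.degree = n := by
      have h2 := congrArg Finsupp.degree h1
      rw [map_add, Finsupp.degree_single] at h2; omega
    have h3 : monomial m (1:k) = monomial m₁ 1 * X i := by
      rw [← h1, monomial_add_single, pow_one]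
    have h4 : tr P (X i) = X i + C (P i) := by simp [tr]
    have h5 : tr P (monomial m (1:k)) - monomial m 1 = (tr P (monomial m₁ 1) - monomial m₁ 1) * X i +
      C (P i) * (tr P (monomial m₁ 1) - monomial m₁ 1) + C (P i) * monomial m₁ 1 := by
      rw [h3, map_mul, h4]; ring
    rw [h5]
    have h6 := (ih m₁ h2)
    intro m' hm'
    rw [coeff_add, coeff_add, coeff_C_mul, coeff_C_mul, h6.mul_X i m' hm', h6 m' (by omega), 
      LTd_monomial m₁ 1 m' (by omega)]
    simp

lemma TopComp [Fintype B] {β : σ → B} {f : MvPolynomial σ k} {a : B → ℕ} (hf : MH β f a) (P : σ → k) (A : B → ℕ)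
    (hA : tdeg a ≤ tdeg A) : cmp β A (tr P f) = cmp β A f := by
  classical
  have h : LTd (tdeg a) (tr P f - f) := by
    intro m hm
    have : tr P f - f = ∑ n ∈ f.support, C (coeff n f) * (tr P (monomial n (1:k)) - monomial n 1) := by
      conv_lhs => rw [f.as_sum]
      rw [map_sum, ← Finset.sum_sub_distrib]
      refine Finset.sum_congr rfl fun n _ => ?_
      have : monomial n (coeff n f) = C (coeff n f) * monomial n 1 := by rw [C_mul_monomial, mul_one]
      rw [this, map_mul, mul_sub]
      congr 2
      simp [tr]
    rw [this, coeff_sum]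
    refine Finset.sum_eq_zero fun n hn => ?_
    rw [coeff_C_mul, tr_mono' P _ n rfl m, mul_zero]
    rw [← tdeg_weight β n, hf (mem_support_iff.mp hn)]; exact hm
  ext m
  rw [coeff_cmp, coeff_cmp]
  split_ifs with hm
  · rw [← sub_eq_zero, ← coeff_sub]
    apply h; rw [← tdeg_weight β, hm]; exact hA
  · rfl

variable {ι : Type} [Fintype ι] [Fintype σ]

/-- shifted point -/
noncomputable def sh (P : σ → k) (n : ι → σ → k) (ψ : ι → MvPolynomial σ k) (i : σ) : MvPolynomial σ k :=
  X i + C (P i) + ∑ c, C (n c i) * ψ c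

lemma aeval_sh_const (P : σ → k) (n : ι → σ → k) (ψ : ι → MvPolynomial σ k) (hψ : ∀ c, ψ c ∈ mm k σ)
   (G : MvPolynomial σ k) : aeval (sh P n ψ) G - C (eval P G) ∈ mm k σ := by
  rw [mem_mm, map_sub, constantCoeff_C, constantCoeff_aeval, sub_eq_zero]
  congr 2
  funext i
  simp only [sh, map_add, map_sum, map_mul, constantCoeff_X, constantCoeff_C]
  simp [fun c => mem_mm.mp (hψ c)]

lemma newton [DecidableEq ι] (P : σ → k) (n : ι → σ → k) (η : ι → MvPolynomial σ k) (h0 : ∀ j, eval P (η j) = 0)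
    (hn : ∀ c j, ∑ i, n c i * grad P (η j) i = if c = j then 1 else 0) (D : ℕ) :
    ∃ ψ : ι → MvPolynomial σ k, (∀ c, ψ c ∈ mm k σ) ∧ ∀ j, aeval (sh P n ψ) (η j) ∈ (mm k σ) ^ (D+1) := by
  induction D with
  | zero =>
    refine ⟨0, fun c => Ideal.zero_mem _, fun j => ?_⟩
    have := aeval_sh_const P n 0 (fun c => Ideal.zero_mem _) (η j)
    rw [h0] at this
    simpa using this
  | succ D ih =>
    obtain ⟨ψ, hψ, hη⟩ := ih
    have hle : ∀ a b : ℕ, a ≤ b → ∀ x, x ∈ (mm k σ)^b → x ∈ (mm k σ)^a := fun a b hab x hx => Ideal.pow_le_pow_right hab hx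
    refine ⟨fun c => ψ c - aeval (sh P n ψ) (η c), fun c => Ideal.sub_mem _ (hψ c) (by
      have := hle 1 (D+1) (by omega) _ (hη c); rwa [pow_one] at this), fun j => ?_⟩
    set ε : ι → MvPolynomial σ k := fun c => aeval (sh P n ψ) (η c) with hε
    have e1 : sh P n (fun c => ψ c - ε c) = sh P n ψ + fun i => -∑ c, C (n c i) * ε c := by
      funext i
      simp only [sh, Pi.add_apply, mul_sub, Finset.sum_sub_distrib]; ring
    have hδ : ∀ i, (-∑ c, C (n c i) * ε c) ∈ (mm k σ)^(D+1) := fun i =>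
      Ideal.neg_mem_iff _ |>.mpr (Ideal.sum_mem _ fun c _ => Ideal.mul_mem_left _ _ (hη c))
    have t := taylor2 (η j) (sh P n ψ) (fun i => -∑ c, C (n c i) * ε c) ((mm k σ)^(D+1+1)) (fun i i' => 
      hle _ (D+1+(D+1)) (by omega) _ (by rw [pow_add]; exact Ideal.mul_mem_mul (hδ i) (hδ i')))
    rw [← e1] at t
    have t2 : ∑ i, (-∑ c, C (n c i) * ε c) * (aeval (sh P n ψ) (pderiv i (η j)) - C (grad P (η j) i)) ∈ (mm k σ)^(D+1+1) := by
      refine Ideal.sum_mem _ fun i _ => ?_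
      rw [pow_succ]
      exact Ideal.mul_mem_mul (hδ i) (aeval_sh_const P n ψ hψ _)
    have t3 : ∑ i, (-∑ c, C (n c i) * ε c) * C (grad P (η j) i) = - ε j := by
      simp only [neg_mul, Finset.sum_mul, Finset.sum_neg_distrib]
      rw [Finset.sum_comm]
      have : ∀ c, ∑ i, C (n c i) * ε c * C (grad P (η j) i) = if c = j then ε c else 0 := by
        intro c
        have e : ∀ i, C (n c i) * ε c * C (grad P (η j) i) = C (n c i * grad P (η j) i) * ε c := by
          intro i; rw [C_mul]; ring
        simp only [e]
        rw [← Finset.sum_mul, ← map_sum, hn]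
        split_ifs <;> simp
      simp [this]
    have t4 := Ideal.add_mem _ t t2
    have t5 : (aeval (sh P n fun c => ψ c - ε c)) (η j) = (aeval (sh P n fun c => ψ c - ε c)) (η j) - (aeval (sh P n ψ)) (η j) -
        ∑ i, (-∑ c, C (n c i) * ε c) * (aeval (sh P n ψ)) (pderiv i (η j)) +
      ∑ i, (-∑ c, C (n c i) * ε c) * ((aeval (sh P n ψ)) (pderiv i (η j)) - C (grad P (η j) i)) := by
      simp only [mul_sub, Finset.sum_sub_distrib]
      rw [t3]
      have : (aeval (sh P n ψ)) (η j) = ε j := rfl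
      rw [this]; ring
    rw [t5]; exact t4

lemma LowRk.of_mem {s : ℕ} (ψ : ι → MvPolynomial σ k) (hψ : ∀ c, ψ c ∈ mm k σ) (G : MvPolynomial σ k)
    (hG : G ∈ mm k σ * Ideal.span (Set.range ψ)) (hs : Fintype.card ι ≤ s) : LowRk s G := by
  rw [← smul_eq_mul, Ideal.span, Submodule.mem_ideal_smul_span_iff_exists_sum] at hG
  obtain ⟨a, ha, rfl⟩ := hG
  rw [Finsupp.sum_fintype _ _ (by simp)]
  exact LowRk.of_fintype hs a ψ (fun i => mem_mm.mp (ha i)) (fun i => mem_mm.mp (hψ i))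

lemma sh_sub (P : σ → k) (n : ι → σ → k) (ψ : ι → MvPolynomial σ k) (hψ : ∀ c, ψ c ∈ mm k σ) (G : MvPolynomial σ k)
    (hG : ∀ c, ∑ i, n c i * grad P G i = 0) : LowRk (Fintype.card ι) (aeval (sh P n ψ) G - tr P G) := by
  refine LowRk.of_mem ψ hψ _ ?_ le_rfl
  have hδ : ∀ i, ∑ c, C (n c i) * ψ c ∈ Ideal.span (Set.range ψ) := fun i => 
    Ideal.sum_mem _ fun c _ => Ideal.mul_mem_left _ _ (Ideal.subset_span ⟨c, rfl⟩)
  have hδ' : ∀ i, ∑ c, C (n c i) * ψ c ∈ mm k σ := fun i => 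
    Ideal.sum_mem _ fun c _ => Ideal.mul_mem_left _ _ (hψ c)
  have t := taylor2 G (fun i => X i + C (P i)) (fun i => ∑ c, C (n c i) * ψ c) _ (fun i j => Ideal.mul_mem_mul (hδ' i) (hδ j))
  have t2 : ∑ i, (∑ c, C (n c i) * ψ c) * (tr P (pderiv i G) - C (grad P G i)) ∈ mm k σ * Ideal.span (Set.range ψ) := by
    refine Ideal.sum_mem _ fun i _ => ?_
    rw [mul_comm (∑ c, C (n c i) * ψ c)]
    refine Ideal.mul_mem_mul ?_ (hδ i)
    rw [mem_mm, map_sub, constantCoeff_tr, constantCoeff_C, grad, sub_self]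
  have t3 : ∑ i, (∑ c, C (n c i) * ψ c) * C (grad P G i) = 0 := by
    simp only [Finset.sum_mul]
    rw [Finset.sum_comm]
    refine Finset.sum_eq_zero fun c _ => ?_
    have e : ∀ i, C (n c i) * ψ c * C (grad P G i) = C (n c i * grad P G i) * ψ c := by
      intro i; rw [C_mul]; ring
    simp only [e]
    rw [← Finset.sum_mul, ← map_sum, hG]; simp
  have t4 := Ideal.add_mem _ t t2
  convert t4 using 1
  simp only [mul_sub, Finset.sum_sub_distrib]
  rw [t3]
  have : (sh P n ψ) = (fun i => X i + C (P i)) + fun i => ∑ c, C (n c i) * ψ c := rfl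
  rw [this]
  simp only [tr]
  ring

lemma exists_dual [DecidableEq ι] {v : ι → σ → k} (hv : LinearIndependent k v) :
    ∃ n : ι → σ → k, ∀ c j, ∑ i, n c i * v j i = if c = j then 1 else 0 := by
  classical
  have : ∀ c, ∃ φ : (σ → k) →ₗ[k] k, ∀ j, φ (v j) = if c = j then 1 else 0 := by
    intro c
    obtain ⟨φ, hφ⟩ := LinearMap.exists_extend ((Finsupp.lapply c).comp hv.repr)
    refine ⟨φ, fun j => ?_⟩
    have hm : v j ∈ Submodule.span k (Set.range v) := Submodule.subset_span ⟨j, rfl⟩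
    have h1 := LinearMap.congr_fun hφ ⟨v j, hm⟩
    simp only [LinearMap.comp_apply, Submodule.subtype_apply] at h1
    rw [h1]
    have h2 := hv.repr_eq_single j ⟨v j, hm⟩ rfl
    simp [h2, Finsupp.single_apply, eq_comm]
  choose φ hφ using this
  refine ⟨fun c i => φ c (fun j => if i = j then 1 else 0), fun c j => ?_⟩
  rw [← hφ c j, LinearMap.pi_apply_eq_sum_univ (φ c) (v j)]
  refine Finset.sum_congr rfl fun i _ => ?_
  rw [smul_eq_mul, mul_comm]

/-- expansion of elements of the radical at a smooth point -/
lemma expand (η : ι → MvPolynomial σ k) (P : σ → k) (h0 : ∀ j, eval P (η j) = 0)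
    (hl : LinearIndependent k (fun j => grad P (η j))) (G : MvPolynomial σ k) (hG : G ∈ rad η) :
    ∃ lam : ι → k, ∀ D : ℕ, ∃ L E : MvPolynomial σ k, LowRk (Fintype.card ι) L ∧ E ∈ (mm k σ)^(D+1) ∧
      tr P G = ∑ c, C (lam c) * tr P (η c) + L + E := by
  classical
  obtain ⟨n, hn⟩ := exists_dual hl
  refine ⟨fun c => ∑ i, n c i * grad P G i, fun D => ?_⟩
  set lam : ι → k := fun c => ∑ i, n c i * grad P G i with hlam
  obtain ⟨N, hN⟩ := hG
  have hN' : G ^ (N+1) ∈ Ideal.span (Set.range η) := by rw [pow_succ]; exact Ideal.mul_mem_right _ _ hN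
  obtain ⟨ψ, hψ, hη⟩ := newton P n η h0 hn ((N+1)*(D+1))
  have hle : ∀ a b : ℕ, a ≤ b → ∀ x, x ∈ (mm k σ)^b → x ∈ (mm k σ)^a := fun a b hab x hx => Ideal.pow_le_pow_right hab hx
  have h1 : aeval (sh P n ψ) G ∈ (mm k σ)^(D+1) := by
    apply mem_of_pow_mem (n := N+1) _ (by omega)
    rw [← map_pow]
    apply hle _ ((N+1)*(D+1)+1) (by omega)
    have : Ideal.span (Set.range η) ≤ Ideal.comap (aeval (sh P n ψ)) ((mm k σ)^((N+1)*(D+1)+1)) := by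
      rw [Ideal.span_le]; rintro _ ⟨j, rfl⟩; exact hη j
    exact this hN'
  set G' := G - ∑ c, C (lam c) * η c with hG'
  have hg : ∀ c, ∑ i, n c i * grad P G' i = 0 := by
    intro c
    have e : ∀ i, grad P G' i = grad P G i - ∑ c, lam c * grad P (η c) i := by
      intro i; simp only [grad, hG', map_sub, map_sum, pderiv_C_mul, map_mul, eval_C]
    simp only [e, mul_sub, Finset.sum_sub_distrib, Finset.mul_sum]
    rw [Finset.sum_comm]
    have e2 : ∀ c', ∑ i, n c i * (lam c' * grad P (η c') i) = lam c' * if c = c' then 1 else 0 := by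
      intro c'; rw [← hn c c', Finset.mul_sum]; exact Finset.sum_congr rfl fun _ _ => by ring
    simp only [e2]
    simp [hlam]
  have h2 := sh_sub P n ψ hψ G' hg
  refine ⟨_, aeval (sh P n ψ) G', h2.neg, ?_, ?_⟩
  · rw [hG', map_sub, map_sum]
    refine Ideal.sub_mem _ h1 (Ideal.sum_mem _ fun c _ => ?_)
    rw [map_mul]
    refine Ideal.mul_mem_left _ _ (hle _ _ ?_ _ (hη c))
    nlinarith
  · have : tr P G' = tr P G - ∑ c, C (lam c) * tr P (η c) := by
      simp only [hG', map_sub, map_sum, map_mul]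
      simp [tr]
    rw [this]; ring
end adic
end RatDense

namespace RatDense
universe u
variable {k : Type u} [Field k] {σ : Type} {B : Type} [Fintype B] [Fintype σ]

lemma CS.mono {ι : Type} [Fintype ι] {K K' : ℕ} (h : K ≤ K') {f : ι → MvPolynomial σ k} {a : ι → B → ℕ}
    (hf : CS K' f a) : CS K f a := fun c hc A hA hl => hf c hc A hA (hl.mono h)

lemma cmp_add (β : σ → B) (A : B → ℕ) (f g : MvPolynomial σ k) : cmp β A (f + g) = cmp β A f + cmp β A g := map_add _ _ _
lemma cmp_sub (β : σ → B) (A : B → ℕ) (f g : MvPolynomial σ k) : cmp β A (f - g) = cmp β A f - cmp β A g := map_sub _ _ _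
lemma cmp_sum {ι : Type*} (β : σ → B) (A : B → ℕ) (S : Finset ι) (f : ι → MvPolynomial σ k) : cmp β A (∑ i ∈ S, f i) = ∑ i ∈ S, cmp β A (f i) := map_sum _ _ _
lemma cmp_C_mul (β : σ → B) (A : B → ℕ) (c : k) (f : MvPolynomial σ k) : cmp β A (C c * f) = C c * cmp β A f := 
  weightedHomogeneousComponent_C_mul _ _ _

lemma tr_C (P : σ → k) (c : k) : tr P (C c) = C c := by simp [tr]

theorem delta {ι κ : Type} [Fintype ι] [Fintype κ] {β : σ → B} {η : ι → MvPolynomial σ k} {a : ι → B → ℕ}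
    {s : κ → MvPolynomial σ k} {A : κ → B → ℕ} {d : ℕ}
    (hη : ∀ i, MH β (η i) (a i)) (hs : ∀ i, MH β (s i) (A i)) (ha : ∀ i, a i ≠ 0) (hA : ∀ i, A i ≠ 0)
    (had : ∀ i, tdeg (a i) ≤ d) (hAd : ∀ i, tdeg (A i) ≤ d) (hg : Good η)
    (hcs : CS ((Fintype.card ι + Fintype.card κ) * 2 ^ d) (Sum.elim η s) (Sum.elim a A))
    (F : MvPolynomial κ k) (hF : aeval s F ∈ rad η) (i0 : κ) : aeval s (pderiv i0 F) ∈ rad η := by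
  classical
  by_contra hcon
  obtain ⟨P, h0, h1, hl⟩ := hg.dense _ hcon
  obtain ⟨lam, hlam⟩ := expand η P h0 hl _ hF
  let q : κ → k := fun i => eval P (s i)
  let δ : κ → MvPolynomial σ k := fun i => tr P (s i) - C (q i)
  have hδ : ∀ i, δ i ∈ mm k σ := fun i => by
    rw [mem_mm, map_sub, constantCoeff_tr, constantCoeff_C, sub_self]
  have t := taylor2 F (fun i => (C (q i) : MvPolynomial σ k)) δ (mm k σ * Ideal.span (Set.range δ)) (fun i j => 
    Ideal.mul_mem_mul (hδ i) (Ideal.subset_span ⟨j, rfl⟩))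
  have hL2 := LowRk.of_mem δ hδ _ t le_rfl
  have e1 : ((fun i => (C (q i) : MvPolynomial σ k)) + δ) = fun i => tr P (s i) := by
    funext i; simp [δ]
  have e2 : aeval (fun i => tr P (s i)) F = tr P (aeval s F) := by
    have : (aeval fun i => tr P (s i)) = (tr P).comp (aeval s) := by
      apply MvPolynomial.algHom_ext; intro i; simp
    rw [this]; rfl
  have e3 : ∀ F : MvPolynomial κ k, aeval (fun i => (C (q i) : MvPolynomial σ k)) F = C (eval q F) := by
    intro F
    have : (aeval fun i => (C (q i) : MvPolynomial σ k)) = (Algebra.ofId k (MvPolynomial σ k)).comp (aeval q) := by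
      apply MvPolynomial.algHom_ext; intro i; simp [Algebra.ofId_apply, algebraMap_eq]
    rw [this]; simp [Algebra.ofId_apply, algebraMap_eq, aeval_eq_eval]
  rw [e1, e2] at hL2
  simp only [e3] at hL2
  -- combined coefficients
  let mu : ι ⊕ κ → k := Sum.elim (fun c => lam c) (fun i => - eval q (pderiv i F))
  let fam := Sum.elim η s
  let deg := Sum.elim a A
  have hi0 : mu (Sum.inr i0) ≠ 0 := by
    simp only [mu, Sum.elim_inr, neg_ne_zero]
    have : ∀ G : MvPolynomial κ k, eval P (aeval s G) = eval q G := by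
      intro G
      have : (aeval q : MvPolynomial κ k →ₐ[k] k) = (aeval P).comp (aeval s) := by
        apply MvPolynomial.algHom_ext; intro i; simp [q, aeval_eq_eval]
      have h2 := DFunLike.congr_fun this G
      simpa [aeval_eq_eval] using h2.symm
    rw [← this]; exact h1
  obtain ⟨x, hx, hmax⟩ := Finset.exists_max_image (Finset.univ.filter fun x => mu x ≠ 0) (fun x => tdeg (deg x)) 
    ⟨Sum.inr i0, by simp [hi0]⟩
  simp only [Finset.mem_filter, Finset.mem_univ, true_and] at hx hmax
  have hdeg0 : deg x ≠ 0 := by rcases x with x | x; exact ha x; exact hA x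
  have hdegd : tdeg (deg x) ≤ d := by rcases x with x | x; exact had x; exact hAd x
  have hMH : ∀ y, MH β (fam y) (deg y) := by rintro (y | y); exact hη y; exact hs y
  obtain ⟨L, E, hL, hE, hG⟩ := hlam (tdeg (deg x))
  rw [hG] at hL2
  have key : LowRk (Fintype.card ι + Fintype.card κ) (∑ y, C (mu y) * tr P (fam y) + E - 
      C (eval q F - ∑ i, eval q (pderiv i F) * q i)) := by
    have := hL2.sub hL
    rw [add_comm (Fintype.card ι)]
    convert this using 1
    simp only [Fintype.sum_sum_type, mu, fam, Sum.elim_inl, Sum.elim_inr, δ]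
    simp only [map_neg, neg_mul, Finset.sum_neg_distrib, sub_mul, Finset.sum_sub_distrib, map_sub, map_sum, map_mul]
    have e : ∀ i, tr P (s i) * C (eval q (pderiv i F)) = C (eval q (pderiv i F)) * tr P (s i) := fun i => mul_comm _ _
    have e' : ∀ i, (C (q i) : MvPolynomial σ k) * C (eval q (pderiv i F)) = C (eval q (pderiv i F)) * C (q i) := fun i => mul_comm _ _
    simp only [e, e']
    ring
  have key2 := key.cmp (β := β) (deg x)
  have e5 : cmp β (deg x) (∑ y, C (mu y) * tr P (fam y) + E - C (eval q F - ∑ i, eval q (pderiv i F) * q i)) =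
     ∑ y, C (if deg y = deg x then mu y else 0) * fam y := by
    rw [cmp_sub, cmp_add, cmp_pow_mm hE (Nat.lt_succ_self _)]
    have e6 : cmp β (deg x) (C (eval q F - ∑ i, eval q (pderiv i F) * q i) : MvPolynomial σ k) = 0 :=
      cmp_ne (a := 0) (isWeightedHomogeneous_C _ _) hdeg0.symm
    rw [e6, add_zero, sub_zero, cmp_sum]
    refine Finset.sum_congr rfl fun y _ => ?_
    rw [cmp_C_mul]
    by_cases hy : mu y = 0
    · simp [hy]
    · rw [TopComp (hMH y) P _ (hmax y hy)]
      by_cases hyx : deg y = deg x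
      · rw [if_pos hyx, ← hyx, cmp_self (hMH y)]
      · rw [if_neg hyx, cmp_ne (hMH y) hyx]; simp
  rw [e5] at key2
  refine hcs (fun y => if deg y = deg x then mu y else 0) ?_ (deg x) ?_ (key2.mono ?_)
  · intro h; have := congrFun h x; simp at this; exact hx this
  · intro i hi; by_contra hne; exact hi (if_neg hne)
  · exact Nat.mul_le_mul_left _ (Nat.pow_le_pow_right (by norm_num) hdegd)

/-- multi-affine -/
def MAff {κ : Type} (F : MvPolynomial κ k) : Prop := ∀ m, coeff m F ≠ 0 → ∀ i, m i ≤ 1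

theorem maff_not_mem {ι κ : Type} [Fintype ι] [Fintype κ] {β : σ → B} {η : ι → MvPolynomial σ k} {a : ι → B → ℕ}
    {s : κ → MvPolynomial σ k} {A : κ → B → ℕ} {d : ℕ}
    (hη : ∀ i, MH β (η i) (a i)) (hs : ∀ i, MH β (s i) (A i)) (ha : ∀ i, a i ≠ 0) (hA : ∀ i, A i ≠ 0)
    (had : ∀ i, tdeg (a i) ≤ d) (hAd : ∀ i, tdeg (A i) ≤ d) (hg : Good η)
    (hcs : CS ((Fintype.card ι + Fintype.card κ) * 2 ^ d) (Sum.elim η s) (Sum.elim a A)) (n : ℕ) :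
    ∀ (F : MvPolynomial κ k) (hF : MAff F) (m : κ →₀ ℕ) (hm : coeff m F ≠ 0) (hmax : ∀ m', coeff m' F ≠ 0 → m'.degree ≤ n), aeval s F ∉ rad η := by
  classical
  induction n with
  | zero =>
    intro F hF m hm hmax hmem
    have : F = C (coeff 0 F) := by
      ext m'
      rw [coeff_C]
      split_ifs with h
      · rw [h]
      · by_contra hne
        exact h ((Finsupp.degree_eq_zero_iff m').mp (Nat.le_zero.mp (hmax m' hne))).symm
    have hne : coeff 0 F ≠ 0 := by
      have := (Finsupp.degree_eq_zero_iff m).mp (Nat.le_zero.mp (hmax m hm))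
      rwa [this] at hm
    rw [this, aeval_C, algebraMap_eq] at hmem
    apply hg.prime.ne_top
    exact Ideal.eq_top_of_isUnit_mem _ hmem ((isUnit_iff_ne_zero.mpr hne).map C)
  | succ n ih =>
    intro F hF m hm hmax hmem
    by_cases h0 : ∃ m, coeff m F ≠ 0 ∧ m ≠ 0
    · obtain ⟨m, hm, hm0⟩ := h0
      obtain ⟨i, hi⟩ : ∃ i, m i ≠ 0 := by
        by_contra! h; exact hm0 (by ext i; exact h i)
      have hi1 : m i = 1 := le_antisymm (hF m hm i) (Nat.one_le_iff_ne_zero.mpr hi)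
      refine ih (pderiv i F) ?_ (m - Finsupp.single i 1) ?_ ?_ (delta hη hs ha hA had hAd hg hcs F hmem i)
      · intro m' hm' j
        rw [coeff_pderiv] at hm'
        have := hF _ (left_ne_zero_of_mul hm') j
        simp at this
        omega
      · have h1 : m - Finsupp.single i 1 + Finsupp.single i 1 = m := by
          ext j
          by_cases hj : j = i
          · subst hj; simp; omega
          · simp [Finsupp.single_apply, Ne.symm hj]
        rw [coeff_pderiv, h1]
        simp [hi1, hm]
      · intro m' hm'
        rw [coeff_pderiv] at hm'
        have := hmax _ (left_ne_zero_of_mul hm')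
        rw [map_add, Finsupp.degree_single] at this
        omega
    · push Not at h0
      refine ih F hF m hm ?_ hmem
      intro m' hm'
      rw [h0 m' hm']; simp

lemma det_maff (n : ℕ) : MAff (Matrix.mvPolynomialX (Fin n) (Fin n) k).det := by
  classical
  intro m hm i
  rw [Matrix.det_apply', coeff_sum] at hm
  obtain ⟨p, -, hp⟩ := Finset.exists_ne_zero_of_sum_ne_zero hm
  have h1 : ∏ x, Matrix.mvPolynomialX (Fin n) (Fin n) k (p x) x = monomial (∑ x, Finsupp.single (p x, x) 1) (1:k) := by
    rw [monomial_sum_one]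
    rfl
  have h2 : (((Equiv.Perm.sign p : ℤ) : k) : k) = ((Equiv.Perm.sign p : ℤ) : k) := rfl
  rw [h1, ← map_intCast (C : k →+* MvPolynomial (Fin n × Fin n) k), coeff_C_mul, coeff_monomial] at hp
  have hp2 := right_ne_zero_of_mul hp
  have h3 : (∑ x, Finsupp.single (p x, x) 1) = m := by by_contra h; exact hp2 (if_neg h)
  rw [← h3, Finsupp.finsetSum_apply]
  obtain ⟨i, j⟩ := i
  rw [Finset.sum_eq_single j]
  · rw [Finsupp.single_apply]; split_ifs <;> simp
  · intro b _ hb; rw [Finsupp.single_apply, if_neg]; simp [hb]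
  · simp

theorem det_not_mem {ι : Type} [Fintype ι] {n : ℕ} {β : σ → B} {η : ι → MvPolynomial σ k} {a : ι → B → ℕ}
    {M : Fin n → Fin n → MvPolynomial σ k} {A : Fin n → Fin n → B → ℕ} {d : ℕ}
    (hη : ∀ i, MH β (η i) (a i)) (hs : ∀ i j, MH β (M i j) (A i j)) (ha : ∀ i, a i ≠ 0) (hA : ∀ i j, A i j ≠ 0)
    (had : ∀ i, tdeg (a i) ≤ d) (hAd : ∀ i j, tdeg (A i j) ≤ d) (hg : Good η)
    (hcs : CS ((Fintype.card ι + n * n) * 2 ^ d) (Sum.elim η (fun p : Fin n × Fin n => M p.1 p.2)) (Sum.elim a (fun p => A p.1 p.2))) :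
    (Matrix.of M).det ∉ rad η := by
  classical
  have e : (Matrix.of M).det = aeval (fun p : Fin n × Fin n => M p.1 p.2) (Matrix.mvPolynomialX (Fin n) (Fin n) k).det := by
    rw [AlgHom.map_det]
    congr 1
    ext i j
    simp [Matrix.mvPolynomialX]
  rw [e]
  have hne := Matrix.det_mvPolynomialX_ne_zero (Fin n) k
  have hma := det_maff (k := k) n
  generalize (Matrix.mvPolynomialX (Fin n) (Fin n) k).det = F at hne hma
  obtain ⟨m, hm⟩ := MvPolynomial.ne_zero_iff.mp hne
  have hcard : Fintype.card (Fin n × Fin n) = n * n := by rw [Fintype.card_prod, Fintype.card_fin]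
  rw [← hcard] at hcs
  intro hmem
  refine maff_not_mem (κ := Fin n × Fin n) (s := fun p => M p.1 p.2) (A := fun p => A p.1 p.2) hη ?_ ha ?_ had ?_ hg hcs
    F.totalDegree F hma m hm (fun m' hm' => le_totalDegree (mem_support_iff.mpr hm')) hmem
  · intro p; exact hs p.1 p.2
  · intro p; exact hA p.1 p.2
  · intro p; exact hAd p.1 p.2

lemma Good.of_span {ι ι' : Type} [Fintype ι] [Fintype ι'] {f : ι → MvPolynomial σ k} {f' : ι' → MvPolynomial σ k}
    (hspan : Submodule.span k (Set.range f) = Submodule.span k (Set.range f')) (hcard : Fintype.card ι = Fintype.card ι')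
    (hf : Good f') : Good f := by
  have hle : ∀ {ι ι' : Type} (f : ι → MvPolynomial σ k) (f' : ι' → MvPolynomial σ k), 
    Submodule.span k (Set.range f) ≤ Submodule.span k (Set.range f') → Ideal.span (Set.range f) ≤ Ideal.span (Set.range f') := by
    intro ι ι' f f' h
    rw [Ideal.span_le]
    rintro _ ⟨j, rfl⟩
    have h1 : f j ∈ Submodule.span k (Set.range f') := h (Submodule.subset_span ⟨j, rfl⟩)
    have h2 : Submodule.span k (Set.range f') ≤ (Ideal.span (Set.range f')).restrictScalars k := by
      rw [Submodule.span_le]; exact Ideal.subset_span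
    exact h2 h1
  have hI : Ideal.span (Set.range f) = Ideal.span (Set.range f') := le_antisymm (hle _ _ hspan.le) (hle _ _ hspan.ge)
  have hr : rad f = rad f' := by rw [rad, rad, hI]
  refine ⟨hr ▸ hf.prime, fun G hG => ?_⟩
  obtain ⟨P, h0, h1, hl⟩ := hf.dense G (hr ▸ hG)
  refine ⟨P, fun j => ?_, h1, ?_⟩
  · have : f j ∈ Submodule.span k (Set.range f') := hspan ▸ Submodule.subset_span ⟨j, rfl⟩
    have h2 : Submodule.span k (Set.range f') ≤ LinearMap.ker (aeval P : MvPolynomial σ k →ₐ[k] k).toLinearMap := by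
      rw [Submodule.span_le]; rintro _ ⟨i, rfl⟩
      simp [aeval_eq_eval, h0 i]
    have h3 := h2 this
    simpa [aeval_eq_eval] using h3
  · let g : MvPolynomial σ k →ₗ[k] (σ → k) := LinearMap.pi fun i => (aeval P : MvPolynomial σ k →ₐ[k] k).toLinearMap.comp (pderiv i).toLinearMap
    have hg : ∀ x, g x = grad P x := by intro x; funext i; simp [g, grad, aeval_eq_eval]
    rw [linearIndependent_iff_card_eq_finrank_span] at hl ⊢
    rw [hcard, hl, Set.finrank, Set.finrank]
    have e : ∀ {ι : Type} (f : ι → MvPolynomial σ k), Submodule.span k (Set.range fun j => grad P (f j)) = (Submodule.span k (Set.range f)).map g := by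
      intro ι f
      rw [Submodule.map_span, ← Set.range_comp]
      congr 2
    rw [e, e, hspan]
end RatDense

namespace RatDense
universe u
variable {k : Type u} [Field k] {σ : Type} {B : Type} [Fintype B]

def Prov {ι : Type} (μ : (B → ℕ) → ℕ) (F : ι → MvPolynomial σ k) (a : ι → B → ℕ) (x : MvPolynomial σ k) (b : B → ℕ) : Prop :=
  (∃ i, x = F i ∧ b = a i) ∨ ∃ i, b < a i ∧ μ b = μ (a i)

lemma Prov.trans {ι ι' : Type} {μ : (B → ℕ) → ℕ} {F : ι → MvPolynomial σ k} {a : ι → B → ℕ} {F' : ι' → MvPolynomial σ k} {a' : ι' → B → ℕ}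
    {x : MvPolynomial σ k} {b : B → ℕ} (h : Prov μ F a x b) (h' : ∀ i, Prov μ F' a' (F i) (a i)) : Prov μ F' a' x b := by
  rcases h with ⟨i, rfl, rfl⟩ | ⟨i, hb, hm⟩
  · exact h' i
  · rcases h' i with ⟨i', -, e⟩ | ⟨i', hb', hm'⟩
    · exact Or.inr ⟨i', e ▸ hb, e ▸ hm⟩
    · exact Or.inr ⟨i', hb.trans hb', hm.trans hm'⟩

structure RegOut {ι : Type} (M : ℕ) (φ : ℕ → ℕ) (β : σ → B) (μ : (B → ℕ) → ℕ) (F : ι → MvPolynomial σ k) (a : ι → B → ℕ)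
   (J : Type) [Fintype J] (η : J → MvPolynomial σ k) (b : J → B → ℕ) : Prop where
  card : Fintype.card J ≤ M
  mh : ∀ j, MH β (η j) (b j)
  ne : ∀ j, b j ≠ 0
  mem : ∀ i, F i ∈ Ideal.span (Set.range η)
  cs : CS (φ (Fintype.card J)) η b
  prov : ∀ j, Prov μ F a (η j) (b j)

def Reg (k : Type u) [Field k] (δ : ℕ) : Prop := ∀ (R : ℕ) (φ : ℕ → ℕ), ∃ M, ∀ (σ B : Type) [Fintype B] (β : σ → B) (μ : (B → ℕ) → ℕ) 
    (hμ : ∀ A A', μ (A + A') = max (μ A) (μ A')) (ι : Type) [Fintype ι] (F : ι → MvPolynomial σ k) (a : ι → B → ℕ), Fintype.card ι ≤ R → 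
    (∀ i, MH β (F i) (a i)) → (∀ i, a i ≠ 0) → (∀ i, tdeg (a i) ≤ δ) → 
    ∃ (J : Type) (_ : Fintype J) (η : J → MvPolynomial σ k) (b : J → B → ℕ), RegOut M φ β μ F a J η b

def RegH (k : Type u) [Field k] (δ m : ℕ) : Prop := ∀ (R : ℕ) (φ : ℕ → ℕ), ∃ M, ∀ (σ B : Type) [Fintype B] (β : σ → B) (μ : (B → ℕ) → ℕ) 
    (hμ : ∀ A A', μ (A + A') = max (μ A) (μ A')) (ι ι' : Type) [Fintype ι] [Fintype ι'] (H : ι → MvPolynomial σ k) (a : ι → B → ℕ)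
    (L : ι' → MvPolynomial σ k) (a' : ι' → B → ℕ), Fintype.card ι ≤ m → Fintype.card ι' ≤ R →
    (∀ i, MH β (H i) (a i)) → (∀ i, MH β (L i) (a' i)) → (∀ i, a' i ≠ 0) → (∀ i, tdeg (a i) = δ + 1) → (∀ i, tdeg (a' i) ≤ δ) →
    ∃ (J : Type) (_ : Fintype J) (η : J → MvPolynomial σ k) (b : J → B → ℕ), RegOut M φ β μ (Sum.elim H L) (Sum.elim a a') J η b

lemma reg_zero : Reg k 0 := by
  intro R φ
  refine ⟨0, ?_⟩
  intro σ B _ β μ hμ ι _ F a _ _ ha0 ha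
  have hem : IsEmpty ι := ⟨fun i => ha0 i (tdeg_eq_zero.mp (Nat.le_zero.mp (ha i)))⟩
  refine ⟨Empty, inferInstance, Empty.elim, Empty.elim, by simp, by simp, by simp, fun i => hem.elim i, ?_, by simp⟩
  intro c hc
  exact absurd (funext fun x => x.elim) hc

lemma mem_span_trans {J J' : Type} {η : J → MvPolynomial σ k} {η' : J' → MvPolynomial σ k} (h : ∀ j, η j ∈ Ideal.span (Set.range η'))
    {x : MvPolynomial σ k} (hx : x ∈ Ideal.span (Set.range η)) : x ∈ Ideal.span (Set.range η') := by
  have : Ideal.span (Set.range η) ≤ Ideal.span (Set.range η') := by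
    rw [Ideal.span_le]; rintro _ ⟨j, rfl⟩; exact h j
  exact this hx

lemma le_sum_range (φ : ℕ → ℕ) {x n : ℕ} (h : x ≤ n) : φ x ≤ ∑ y ∈ Finset.range (n+1), φ y :=
  Finset.single_le_sum (f := φ) (fun _ _ => Nat.zero_le _) (Finset.mem_range.mpr (by omega))

lemma regH {δ : ℕ} (hδ : Reg k δ) (m : ℕ) : RegH k δ m := by
  classical
  induction m with
  | zero =>
    intro R φ
    obtain ⟨M, hM⟩ := hδ R φ
    refine ⟨M, ?_⟩
    intro σ B _ β μ hμ ι ι' _ _ H a L a' hm hR hH hL ha' hta hta'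
    have hem : IsEmpty ι := Fintype.card_eq_zero_iff.mp (Nat.le_zero.mp hm)
    obtain ⟨J, _, η, b, h⟩ := hM σ B β μ hμ ι' L a' hR hL ha' hta'
    refine ⟨J, _, η, b, h.card, h.mh, h.ne, ?_, h.cs, fun j => (h.prov j).trans fun i => Or.inl ⟨Sum.inr i, rfl, rfl⟩⟩
    rintro (i | i)
    · exact hem.elim i
    · exact h.mem i
  | succ m ih =>
    intro R φ
    obtain ⟨M₁, hM₁⟩ := hδ R (fun x => ∑ h ∈ Finset.range (m+2), φ (h + x))
    let Km := ∑ x ∈ Finset.range (m+1+M₁+1), φ x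
    obtain ⟨M₂, hM₂⟩ := ih (M₁ + Km * 2^(δ+1)) φ
    refine ⟨m + 1 + M₁ + M₂, ?_⟩
    intro σ B _ β μ hμ ι ι' _ _ H a L a' hm hR hH hL ha' hta hta'
    obtain ⟨J, _, η, b, h⟩ := hM₁ σ B β μ hμ ι' L a' hR hL ha' hta'
    have hbd : ∀ j, tdeg (b j) ≤ δ := by
      intro j
      rcases h.prov j with ⟨i, -, e⟩ | ⟨i, hlt, -⟩
      · rw [e]; exact hta' i
      · exact (tdeg_lt hlt).le.trans (hta' i)
    by_cases hcs : CS (φ (Fintype.card (ι ⊕ J))) (Sum.elim H η) (Sum.elim a b)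
    · refine ⟨ι ⊕ J, inferInstance, Sum.elim H η, Sum.elim a b, ?_, ?_, ?_, ?_, hcs, ?_⟩
      · rw [Fintype.card_sum]; have := h.card; omega
      · rintro (i | i); exact hH i; exact h.mh i
      · rintro (i | i)
        · intro h0; simp only [Sum.elim_inl] at h0; have := hta i; rw [h0, tdeg_eq_zero.mpr rfl] at this; omega
        · exact h.ne i
      · rintro (i | i)
        · exact Ideal.subset_span ⟨Sum.inl i, rfl⟩
        · exact mem_span_trans (fun j => Ideal.subset_span ⟨Sum.inr j, rfl⟩) (h.mem i)
      · rintro (i | i)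
        · exact Or.inl ⟨Sum.inl i, rfl, rfl⟩
        · exact (h.prov i).trans fun i => Or.inl ⟨Sum.inr i, rfl, rfl⟩
    · unfold CS at hcs
      push Not at hcs
      obtain ⟨c, hc, A, hA, hlow⟩ := hcs
      by_cases hcH : ∃ i0, c (Sum.inl i0) ≠ 0
      · obtain ⟨i0, hi0⟩ := hcH
        have hAi0 : a i0 = A := hA _ hi0
        have hcJ : ∀ j, c (Sum.inr j) = 0 := by
          intro j; by_contra hne
          have h1 : b j = A := hA _ hne
          have h2 := hbd j; have h3 := hta i0
          rw [h1] at h2; rw [hAi0] at h3; omega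
        set K := φ (Fintype.card (ι ⊕ J)) with hK
        have hKm : K ≤ Km := by
          apply le_sum_range; rw [Fintype.card_sum]; have := h.card; omega
        obtain ⟨g, e, p, q, hgh, hsum⟩ := hlow.cmp_decomp (β := β) A
        have hcmp : cmp β A (∑ i, C (c i) * Sum.elim H η i) = ∑ i, C (c i) * Sum.elim H η i := by
          apply cmp_self
          refine IsWeightedHomogeneous.sum _ _ _ fun i _ => ?_
          by_cases hci : c i = 0
          · rw [hci]; simp only [map_zero, zero_mul]; exact isWeightedHomogeneous_zero _ _ _
          · have hmh : MH β (Sum.elim H η i) (Sum.elim a b i) := by rcases i with i | i; exact hH i; exact h.mh i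
            rw [hA i hci] at hmh
            have := (isWeightedHomogeneous_C (wt β) (c i)).mul hmh
            rwa [zero_add] at this
        rw [hcmp] at hsum
        let Pf : Fin K × Finset.Iic A → Prop := fun i => p i ≠ 0 ∧ q i ≠ 0 ∧ p i + q i = A ∧ MH β (g i) (p i) ∧ MH β (e i) (q i)
        let fac : {x // Pf x} → MvPolynomial σ k := fun x => if μ (p x) = μ A then g x else e x
        let facd : {x // Pf x} → B → ℕ := fun x => if μ (p x) = μ A then p x else q x
        have hfacmu : ∀ x, μ (facd x) = μ A := by
          intro x
          simp only [facd]
          split_ifs with hx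
          · exact hx
          · have := hμ (p x) (q x)
            rw [x.2.2.2.1] at this
            rcases max_choice (μ (p x)) (μ (q x)) with h' | h'
            · rw [h'] at this; exact absurd this.symm hx
            · rw [h'] at this; exact this.symm
        have hfaclt : ∀ x, facd x < A := by
          intro x
          obtain ⟨hp, hq, hpq, -, -⟩ := x.2
          simp only [facd]
          split_ifs with hx
          · exact (lt_add_of_pos_right (p x) (pos_iff_ne_zero.mpr hq)).trans_eq hpq
          · exact (lt_add_of_pos_left (q x) (pos_iff_ne_zero.mpr hp)).trans_eq hpq
        have hfac0 : ∀ x, facd x ≠ 0 := by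
          intro x
          obtain ⟨hp, hq, hpq, -, -⟩ := x.2
          simp only [facd]; split_ifs; exact hp; exact hq
        have hfacMH : ∀ x, MH β (fac x) (facd x) := by
          intro x
          obtain ⟨hp, hq, hpq, hg, he⟩ := x.2
          simp only [facd, fac]; split_ifs; exact hg; exact he
        have hcardfac : Fintype.card {x // Pf x} ≤ Km * 2^(δ+1) := by
          refine (Fintype.card_subtype_le _).trans ?_
          rw [Fintype.card_prod, Fintype.card_fin, Fintype.card_coe]
          refine Nat.mul_le_mul hKm ((card_Iic_le A).trans ?_)
          rw [← hAi0, hta i0]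
        obtain ⟨J', _, η', b', h'⟩ := hM₂ σ B β μ hμ {i // i ≠ i0} (J ⊕ {x // Pf x}) (fun i => H i) (fun i => a i)
          (Sum.elim η fac) (Sum.elim b facd) (by
            rw [Fintype.card_subtype_compl, Fintype.card_subtype_eq]; omega) (by
            rw [Fintype.card_sum]; have := h.card; omega) (fun i => hH i) (by
            rintro (j | x); exact h.mh j; exact hfacMH x) (by
            rintro (j | x); exact h.ne j; exact hfac0 x) (fun i => hta i) (by
            rintro (j | x)
            · exact hbd j
            · have h1 := tdeg_lt (hfaclt x)
              have h2 := hta i0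
              rw [hAi0] at h2
              simp only [Sum.elim_inr]; omega)
        refine ⟨J', _, η', b', ?_, h'.mh, h'.ne, ?_, h'.cs, ?_⟩
        · have := h'.card; omega
        · rintro (i | i)
          · by_cases hi : i = i0
            · subst hi
              simp only [Sum.elim_inl]
              have hprod : ∀ x, g x * e x ∈ Ideal.span (Set.range η') := by
                intro x
                rcases hgh x with hx | ⟨hx, -⟩
                · have hm : fac ⟨x, hx⟩ ∈ Ideal.span (Set.range η') := h'.mem (Sum.inr (Sum.inr ⟨x, hx⟩))
                  simp only [fac] at hm
                  split_ifs at hm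
                  · exact Ideal.mul_mem_right _ _ hm
                  · exact Ideal.mul_mem_left _ _ hm
                · rw [hx, zero_mul]; exact Ideal.zero_mem _
              have hs := Ideal.sum_mem (Ideal.span (Set.range η')) (t := Finset.univ) (fun x _ => hprod x)
              rw [← hsum, Fintype.sum_sum_type] at hs
              simp only [Sum.elim_inl, Sum.elim_inr, hcJ, map_zero, zero_mul, Finset.sum_const_zero, add_zero] at hs
              rw [← Finset.add_sum_erase _ _ (Finset.mem_univ i)] at hs
              have h3 : ∑ x ∈ Finset.univ.erase i, C (c (Sum.inl x)) * H x ∈ Ideal.span (Set.range η') := by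
                refine Ideal.sum_mem _ fun x hx => Ideal.mul_mem_left _ _ ?_
                exact h'.mem (Sum.inl ⟨x, Finset.ne_of_mem_erase hx⟩)
              have h4 := (Ideal.add_mem_iff_left _ h3).mp hs
              have h5 := Ideal.mul_mem_left _ (C (c (Sum.inl i))⁻¹) h4
              rwa [← mul_assoc, ← C_mul, inv_mul_cancel₀ hi0, C_1, one_mul] at h5
            · exact h'.mem (Sum.inl ⟨i, hi⟩)
          · exact mem_span_trans (fun j => h'.mem (Sum.inr (Sum.inl j))) (h.mem i)
        · intro j
          refine (h'.prov j).trans ?_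
          rintro (i | j | x)
          · exact Or.inl ⟨Sum.inl i, rfl, rfl⟩
          · exact (h.prov j).trans fun i => Or.inl ⟨Sum.inr i, rfl, rfl⟩
          · refine Or.inr ⟨Sum.inl i0, ?_, ?_⟩
            · simp only [Sum.elim_inl, hAi0]; exact hfaclt x
            · simp only [Sum.elim_inl, hAi0]; exact hfacmu x
      · push Not at hcH
        exfalso
        refine h.cs (fun j => c (Sum.inr j)) ?_ A (fun j hj => hA _ hj) ?_
        · intro h0; apply hc
          funext x; rcases x with x | x
          · exact hcH x
          · exact congrFun h0 x
        · rw [Fintype.sum_sum_type] at hlow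
          simp only [Sum.elim_inl, Sum.elim_inr, hcH, map_zero, zero_mul, Finset.sum_const_zero, zero_add] at hlow
          refine hlow.mono ?_
          rw [Fintype.card_sum]
          exact Finset.single_le_sum (f := fun x => φ (x + Fintype.card J)) (fun _ _ => Nat.zero_le _) (Finset.mem_range.mpr (by omega))

theorem reg (δ : ℕ) : Reg k δ := by
  classical
  induction δ with
  | zero => exact reg_zero
  | succ δ ih =>
    intro R φ
    obtain ⟨M, hM⟩ := regH ih R R φ
    refine ⟨M, ?_⟩
    intro σ B _ β μ hμ ι _ F a hR hF ha hta
    obtain ⟨J, _, η, b, h⟩ := hM σ B β μ hμ {i // tdeg (a i) = δ + 1} {i // ¬ tdeg (a i) = δ + 1} (fun i => F i) (fun i => a i) (fun i => F i) (fun i => a i)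
      ((Fintype.card_subtype_le _).trans hR) ((Fintype.card_subtype_le _).trans hR) (fun i => hF i) (fun i => hF i) (fun i => ha i)
      (fun i => i.2) (fun i => by have := hta i; have := i.2; omega)
    refine ⟨J, _, η, b, h.card, h.mh, h.ne, fun i => ?_, h.cs, fun j => (h.prov j).trans ?_⟩
    · by_cases hi : tdeg (a i) = δ + 1
      · exact h.mem (Sum.inl ⟨i, hi⟩)
      · exact h.mem (Sum.inr ⟨i, hi⟩)
    · rintro (i | i)
      · exact Or.inl ⟨i, rfl, rfl⟩
      · exact Or.inl ⟨i, rfl, rfl⟩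
end RatDense

namespace RatDense
universe u
section lemJ
variable {k : Type u} [Field k] {σ : Type} [Fintype σ] {B : Type} [Fintype B]

def TH (k : Type u) [Field k] (d : ℕ) : Prop := ∀ R : ℕ, ∃ K : ℕ, ∀ (σ B : Type) [Fintype σ] [Fintype B] (β : σ → B)
    (ι : Type) [Fintype ι] (f : ι → MvPolynomial σ k) (a : ι → B → ℕ), Fintype.card B ≤ R → Fintype.card ι ≤ R →
    (∀ i, MH β (f i) (a i)) → (∀ i, a i ≠ 0) → (∀ i, tdeg (a i) ≤ d) → CS K f a → Good f

open Classical in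
/-- partial polarization in block `b` -/
noncomputable def pol (β : σ → B) (b : B) (f : MvPolynomial σ k) : MvPolynomial (σ ⊕ σ) k :=
  ∑ i, if β i = b then X (Sum.inl i) * rename Sum.inr (pderiv i f) else 0

lemma pol_lin {ι : Type} [Fintype ι] (β : σ → B) (b : B) (c : ι → k) (f : ι → MvPolynomial σ k) :
    pol β b (∑ j, C (c j) * f j) = ∑ j, C (c j) * pol β b (f j) := by
  classical
  unfold pol
  simp_rw [Finset.mul_sum]
  rw [Finset.sum_comm]
  refine Finset.sum_congr rfl fun i _ => ?_
  split_ifs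
  · simp only [map_sum, Finset.mul_sum]
    refine Finset.sum_congr rfl fun j _ => ?_
    simp [pderiv_C_mul]; ring
  · simp

lemma chain {τ : Type} (φ : σ → MvPolynomial τ k) (i : τ) (f : MvPolynomial σ k) :
    pderiv i (aeval φ f) = ∑ l, aeval φ (pderiv l f) * pderiv i (φ l) := by
  classical
  induction f using MvPolynomial.induction_on with
  | C a => simp
  | add p q hp hq => simp only [map_add, hp, hq, add_mul, Finset.sum_add_distrib]
  | mul_X p j hp =>
    simp only [map_mul, aeval_X, pderiv_mul, hp, map_add, add_mul, Finset.sum_add_distrib]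
    congr 1
    · rw [Finset.sum_mul]; refine Finset.sum_congr rfl fun l _ => by ring
    · rw [Finset.sum_eq_single j]
      · simp
      · intro l _ hl; simp [pderiv_X_of_ne (Ne.symm hl)]
      · simp

lemma pol_diff (β : σ → B) (f : MvPolynomial σ k) (i : σ) :
    pderiv (Sum.inl i) (pol β (β i) f) = rename Sum.inr (pderiv i f) := by
  classical
  have h0 : ∀ g : MvPolynomial σ k, pderiv (Sum.inl i : σ ⊕ σ) (rename Sum.inr g) = 0 := by
    intro g
    have e : rename (Sum.inr : σ → σ ⊕ σ) = (aeval (fun i => X (Sum.inr i)) : MvPolynomial σ k →ₐ[k] _) := by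
      apply MvPolynomial.algHom_ext; simp
    rw [e, chain]
    refine Finset.sum_eq_zero fun l _ => ?_
    simp [pderiv_X_of_ne]
  unfold pol
  rw [map_sum, Finset.sum_eq_single i]
  · simp [pderiv_mul, h0]
  · intro j _ hj
    split_ifs
    · rw [pderiv_mul, h0, pderiv_X_of_ne]; simp
      simpa using hj
    · simp
  · simp

lemma MH.at {β : σ → B} {f : MvPolynomial σ k} {a : B → ℕ} (hf : MH β f a) (b : B) : 
    IsWeightedHomogeneous (fun i => wt β i b) f (a b) := by
  intro m hm
  rw [← hf hm]
  rw [Finsupp.weight_apply, Finsupp.weight_apply, Finsupp.sum, Finsupp.sum, Finset.sum_apply]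
  rfl

lemma LowRk.of_pol {β : σ → B} {f : MvPolynomial σ k} {a : B → ℕ} (hf : MH β f a) (b : B) (hb : ((a b : ℕ) : k) ≠ 0) {s : ℕ}
    (h : LowRk s (pol β b f)) : LowRk s f := by
  classical
  have h1 := h.aeval (Sum.elim X X : σ ⊕ σ → MvPolynomial σ k) (by rintro (i|i) <;> simp)
  refine LowRk.of_C_mul hb ?_
  convert h1 using 1
  have := (hf.at b).sum_weight_X_mul_pderiv
  rw [show C ((a b : ℕ) : k) * f = a b • f by simp [nsmul_eq_mul], ← this, pol, map_sum]
  refine Finset.sum_congr rfl fun i _ => ?_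
  unfold wt
  split_ifs
  · have : (MvPolynomial.aeval (Sum.elim X X : σ ⊕ σ → MvPolynomial σ k)).comp (rename Sum.inr) = AlgHom.id k (MvPolynomial σ k) := by
      apply MvPolynomial.algHom_ext; simp
    have h2 := DFunLike.congr_fun this (pderiv i f)
    simp only [AlgHom.comp_apply, AlgHom.id_apply] at h2
    rw [map_mul, h2]; simp
  · simp

lemma pderiv_mem_of_pol {β : σ → B} {f : MvPolynomial σ k} {s : ℕ} (g h : Fin s → MvPolynomial (σ ⊕ σ) k) (i : σ) 
    (e : pol β (β i) f = ∑ j, g j * h j) :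
    pderiv i f ∈ Ideal.span (Set.range (Sum.elim (fun j => aeval (Sum.elim 0 X : σ ⊕ σ → MvPolynomial σ k) (g j)) 
      (fun j => aeval (Sum.elim 0 X : σ ⊕ σ → MvPolynomial σ k) (h j)))) := by
  have h1 := pol_diff β f i
  have : (aeval (Sum.elim 0 X : σ ⊕ σ → MvPolynomial σ k)).comp (rename Sum.inr) = AlgHom.id k (MvPolynomial σ k) := by
    apply MvPolynomial.algHom_ext; simp
  have h2 := DFunLike.congr_fun this (pderiv i f)
  simp only [AlgHom.comp_apply, AlgHom.id_apply] at h2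
  rw [← h2, ← h1, e, map_sum, map_sum]
  refine Ideal.sum_mem _ fun j _ => ?_
  rw [pderiv_mul, map_add, map_mul, map_mul]
  refine Ideal.add_mem _ (Ideal.mul_mem_left _ _ (Ideal.subset_span ⟨Sum.inr j, rfl⟩)) (Ideal.mul_mem_right _ _ (Ideal.subset_span ⟨Sum.inl j, rfl⟩))

lemma MH.pderiv' {β : σ → B} {f : MvPolynomial σ k} {a : B → ℕ} (hf : MH β f a) (i : σ) (h0 : MvPolynomial.pderiv i f ≠ 0) :
    wt β i ≤ a ∧ MH β (MvPolynomial.pderiv i f) (a - wt β i) := by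
  constructor
  · obtain ⟨m, hm⟩ := MvPolynomial.ne_zero_iff.mp h0
    rw [← hf.pderiv i m hm]; exact le_add_self
  · intro m hm
    rw [← hf.pderiv i m hm]; simp

lemma tdeg_wt (β : σ → B) (i : σ) : tdeg (wt β i) = 1 := by
  classical
  simp [tdeg, wt]

/-- homogeneous membership -/
lemma mem_cmp_span [DecidableEq B] {β : σ → B} {ι : Type} [Fintype ι] (Q : ι → MvPolynomial σ k) (hQ : ∀ x, constantCoeff (Q x) = 0)
    {g : MvPolynomial σ k} {A : B → ℕ} (hg : MH β g A) (h : g ∈ Ideal.span (Set.range Q)) (T : Set (B → ℕ))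
    (hT : ∀ p, p ≤ A → p ≠ 0 → p ∈ T) :
    g ∈ Ideal.span (Set.range (fun y : ι × T => cmp β y.2 (Q y.1))) := by
  rw [Ideal.span, Submodule.mem_span_range_iff_exists_fun] at h
  obtain ⟨c, hc⟩ := h
  rw [← cmp_self hg, ← hc, cmp_sum]
  refine Ideal.sum_mem _ fun x _ => ?_
  rw [smul_eq_mul, mul_comm, cmp_mul]
  refine Ideal.sum_mem _ fun p hp => ?_
  by_cases h0 : p = 0
  · rw [h0, cmp_zero, hQ]; simp
  · exact Ideal.mul_mem_right _ _ (Ideal.subset_span ⟨(x, ⟨p, hT p (Finset.mem_Iic.mp hp) h0⟩), rfl⟩)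

lemma cmp_dvd [Fintype B] {β : σ → B} {h : MvPolynomial σ k} {a : B → ℕ} {p D : ℕ} [CharP k p] (hD : tdeg a ≤ D) 
    (hh : ∀ i, pderiv i h ∈ (mm k σ) ^ (D+1)) (m : σ →₀ ℕ) (i : σ) (hm : coeff m (cmp β a h) ≠ 0) : p ∣ m i := by
  classical
  rw [coeff_cmp] at hm
  split_ifs at hm with hw
  · by_cases h0 : m i = 0
    · simp [h0]
    have e : m = (m - Finsupp.single i 1) + Finsupp.single i 1 := by
      rw [tsub_add_cancel_of_le]
      rw [Finsupp.single_le_iff]; omega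
    have h1 := hh i
    rw [mem_pow_idealOfVars_iff'] at h1
    have hdeg : m.degree ≤ D := by rw [← tdeg_weight β m, hw]; exact hD
    have h2 : coeff (m - Finsupp.single i 1) (pderiv i h) = 0 := by
      apply h1
      have : (m - Finsupp.single i 1).degree ≤ m.degree := Finsupp.degree_mono tsub_le_self
      omega
    rw [coeff_pderiv, ← e] at h2
    rcases mul_eq_zero.mp h2 with h2 | h2
    · exact absurd h2 hm
    · rw [← CharP.cast_eq_zero_iff k p]
      rw [← h2]
      have : (m i) = (m - Finsupp.single i 1 : σ →₀ ℕ) i + 1 := by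
        simp; omega
      rw [this]; push_cast; rfl
  · simp at hm

theorem lemJ (hk : IsBrauerField k) {d : ℕ} (hT : TH k d) (R s : ℕ) : ∃ s' : ℕ, ∀ (σ B : Type) [Fintype σ] [Fintype B] (β : σ → B)
    (f : MvPolynomial σ k) (a : B → ℕ), Fintype.card B ≤ R → MH β f a → a ≠ 0 → tdeg a ≤ d + 1 → ¬ LowRk s' f → 
    ∃ b, a b ≠ 0 ∧ ¬ LowRk s (pol β b f) := by
  classical
  have hq : ∃ q : ℕ, ∀ p : ℕ, p.Prime → CharP k p → ∀ (σ : Type) (h : MvPolynomial σ k), constantCoeff h = 0 →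
      (∀ m i, coeff m h ≠ 0 → p ∣ m i) → LowRk q h := by
    by_cases hp : ∃ p : ℕ, p.Prime ∧ CharP k p
    · obtain ⟨p, hp, hc⟩ := hp
      haveI : Fact p.Prime := ⟨hp⟩
      obtain ⟨q, hq⟩ := plemma hk p
      refine ⟨q, fun p' hp' hc' => ?_⟩
      obtain rfl := CharP.eq k hc hc'
      exact hq
    · exact ⟨0, fun p h1 h2 => absurd ⟨p, h1, h2⟩ hp⟩
  obtain ⟨q, hq⟩ := hq
  choose K hK using hT
  obtain ⟨M, hM⟩ := reg (k := k) d (R * (s + s) * 2 ^ (d+1)) (fun x => K (R + x))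
  refine ⟨s + (q + M * 2 ^ (d+1)), fun σ B _ _ β f a hB hf ha had hlow => ?_⟩
  by_contra hcon
  push Not at hcon
  apply hlow
  have hall : ∀ b, LowRk s (pol β b f) := by
    intro b
    by_cases hb : a b = 0
    · convert LowRk.zero s
      unfold pol
      refine Finset.sum_eq_zero fun i _ => ?_
      split_ifs with hi
      · by_cases h0 : pderiv i f = 0
        · simp [h0]
        · have := (hf.pderiv' i h0).1 b
          simp [wt, hi, hb] at this
      · rfl
    · exact hcon b hb
  by_cases hch : ∃ b, ((a b : ℕ) : k) ≠ 0
  · obtain ⟨b, hb⟩ := hch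
    exact (LowRk.of_pol hf b hb (hall b)).mono (by omega)
  push Not at hch
  refine LowRk.mono (by omega : q + M * 2 ^ (d+1) ≤ _) ?_
  obtain ⟨p, hp⟩ := CharP.exists k
  have hpp : p.Prime := by
    rcases CharP.char_is_prime_or_zero k p with h | h
    · exact h
    · subst h
      exfalso; apply ha; funext b
      have := (CharP.cast_eq_zero_iff k 0 (a b)).mp (hch b)
      simpa using this
  choose g h hg hh e using hall
  let Q : B × (Fin s ⊕ Fin s) → MvPolynomial σ k := fun x => 
    aeval (Sum.elim 0 X : σ ⊕ σ → MvPolynomial σ k) (Sum.elim (g x.1) (h x.1) x.2)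
  have hQ : ∀ x, constantCoeff (Q x) = 0 := by
    rintro ⟨b, j⟩
    refine constantCoeff_aeval_eq_zero _ (by rintro (i|i) <;> simp) ?_
    rcases j with j | j
    · exact hg b j
    · exact hh b j
  let T : Finset (B → ℕ) := (Finset.Iic a).filter (fun p => p ≠ 0 ∧ tdeg p ≤ d)
  have hTm : ∀ p, p ∈ T ↔ p ≤ a ∧ p ≠ 0 ∧ tdeg p ≤ d := by intro p; simp [T]
  obtain ⟨J, _, η, b, hr⟩ := hM σ B β (fun _ => 0) (by simp) ((B × (Fin s ⊕ Fin s)) × T) 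
    (fun y => cmp β y.2 (Q y.1)) (fun y => y.2) (by
      simp only [Fintype.card_prod, Fintype.card_sum, Fintype.card_fin, Fintype.card_coe]
      have : T.card ≤ 2 ^ (d+1) := (Finset.card_filter_le _ _).trans ((card_Iic_le a).trans (Nat.pow_le_pow_right (by norm_num) had))
      gcongr) (fun y => cmp_MH _ _ _) (fun y => ((hTm _).mp y.2.2).2.1) (fun y => ((hTm _).mp y.2.2).2.2)
  have hbd : ∀ j, tdeg (b j) ≤ d := by
    intro j
    rcases hr.prov j with ⟨i, -, h⟩ | ⟨i, h, -⟩
    · rw [h]; exact ((hTm _).mp i.2.2).2.2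
    · exact (tdeg_mono h.le).trans ((hTm _).mp i.2.2).2.2
  have hgood : Good η := hK (R + Fintype.card J) σ B β J η b (by omega) (by omega) hr.mh hr.ne hbd hr.cs
  have hpd : ∀ i, pderiv i f ∈ Ideal.span (Set.range η) := by
    intro i
    by_cases h0 : pderiv i f = 0
    · rw [h0]; exact Ideal.zero_mem _
    obtain ⟨hle, hmh⟩ := hf.pderiv' i h0
    have h1 := pderiv_mem_of_pol (g (β i)) (h (β i)) i (e (β i))
    have h2 : pderiv i f ∈ Ideal.span (Set.range Q) := by
      refine Ideal.span_mono ?_ h1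
      rintro _ ⟨j | j, rfl⟩
      · exact ⟨(β i, Sum.inl j), rfl⟩
      · exact ⟨(β i, Sum.inr j), rfl⟩
    have h3 := mem_cmp_span Q hQ hmh h2 (T : Set (B → ℕ)) (by
      intro p hp h0
      have e1 : tdeg (a - wt β i) + 1 = tdeg a := by
        rw [← tdeg_wt β i, ← tdeg_add, tsub_add_cancel_of_le hle]
      have := tdeg_mono hp
      exact (hTm p).mpr ⟨hp.trans tsub_le_self, h0, by omega⟩)
    exact mem_span_trans hr.mem h3
  obtain ⟨P, hP, -, hli⟩ := hgood.dense 1 (fun h => hgood.prime.ne_top ((Ideal.eq_top_iff_one _).mpr h))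
  obtain ⟨n, hn⟩ := exists_dual hli
  have hgrad : ∀ i, grad P f i = 0 := by
    intro i
    have h1 : Ideal.span (Set.range η) ≤ RingHom.ker (eval P) := by
      rw [Ideal.span_le]; rintro _ ⟨j, rfl⟩; exact hP j
    exact h1 (hpd i)
  obtain ⟨ψ, hψ, hnew⟩ := newton P n η hP hn (d+1)
  have hsub := sh_sub P n ψ hψ f (by intro c; simp [hgrad])
  have hder : ∀ i, pderiv i (aeval (sh P n ψ) f) ∈ (mm k σ)^(d+1+1) := by
    intro i
    rw [chain]
    refine Ideal.sum_mem _ fun l _ => Ideal.mul_mem_right _ _ ?_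
    have h1 : Ideal.span (Set.range η) ≤ Ideal.comap (aeval (sh P n ψ)) ((mm k σ)^(d+1+1)) := by
      rw [Ideal.span_le]; rintro _ ⟨j, rfl⟩; exact hnew j
    exact h1 (hpd l)
  have h1 : LowRk q (cmp β a (aeval (sh P n ψ) f)) := 
    hq p hpp hp σ _ (constantCoeff_cmp ha _) (fun m i hm => cmp_dvd had hder m i hm)
  have h2 := (hsub.cmp (β := β) a)
  have h3 : f = cmp β a (aeval (sh P n ψ) f) - cmp β a (aeval (sh P n ψ) f - tr P f) := by
    rw [cmp_sub, TopComp hf P a le_rfl, cmp_self hf]; ring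
  rw [h3]
  refine (h1.sub h2).mono ?_
  have := hr.card
  have : 2 ^ tdeg a ≤ 2 ^ (d+1) := Nat.pow_le_pow_right (by norm_num) had
  gcongr

end lemJ
end RatDense

namespace RatDense
universe u
section flag
variable {k : Type u} [Field k]

lemma lowRk_span {τ : Type} {n s : ℕ} (L : (Fin n → k) →ₗ[k] MvPolynomial τ k) (U : Set (Fin n → k)) (hU : ∀ u ∈ U, LowRk s (L u))
    (x : Fin n → k) (hx : x ∈ Submodule.span k U) : LowRk (n * s) (L x) := by
  classical
  obtain ⟨b, hb, hs, hli⟩ := exists_linearIndependent k U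
  rw [← hs] at hx
  haveI : Fintype b := (LinearIndependent.setFinite hli).fintype
  have hc : Fintype.card b ≤ n := by
    have := hli.fintype_card_le_finrank
    simpa using this
  have hx' : x ∈ Submodule.span k (Set.range (Subtype.val : b → (Fin n → k))) := by simpa using hx
  rw [Submodule.mem_span_range_iff_exists_fun] at hx'
  obtain ⟨c, rfl⟩ := hx'
  rw [map_sum]
  refine (LowRk.sum Finset.univ (s := s) fun i _ => ?_).mono (Nat.mul_le_mul_right s (by simpa using hc))
  rw [map_smul, smul_eq_C_mul]
  exact (hU _ (hb i.2)).C_mul _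

/-- linear combination map -/
noncomputable def lc {τ : Type} {n : ℕ} (f : Fin n → MvPolynomial τ k) : (Fin n → k) →ₗ[k] MvPolynomial τ k where
  toFun c := ∑ i, C (c i) * f i
  map_add' c c' := by simp [add_mul, Finset.sum_add_distrib]
  map_smul' c c' := by simp [Finset.mul_sum, smul_eq_C_mul, mul_assoc]

lemma lc_apply {τ : Type} {n : ℕ} (f : Fin n → MvPolynomial τ k) (c : Fin n → k) : lc f c = ∑ i, C (c i) * f i := rfl

lemma lc_lc {τ : Type} {n n' : ℕ} (f : Fin n → MvPolynomial τ k) (m : Fin n' → Fin n → k) (c : Fin n' → k) : 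
    lc (fun j => lc f (m j)) c = lc f (fun i => ∑ j, c j * m j i) := by
  simp only [lc_apply, Finset.mul_sum, map_sum, Finset.sum_mul]
  rw [Finset.sum_comm]
  refine Finset.sum_congr rfl fun i _ => Finset.sum_congr rfl fun j _ => by rw [MvPolynomial.C_mul]; ring

theorem flag_core {σ B : Type} [Fintype σ] [Fintype B] (β : σ → B) (s s' R : ℕ) (d : ℕ) (key : (B → ℕ) → ℕ)
    (hJ : ∀ (f : MvPolynomial σ k) (a : B → ℕ), MH β f a → a ≠ 0 → tdeg a ≤ d → ¬ LowRk s' f → 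
      ∃ b, a b ≠ 0 ∧ ¬ LowRk (R * s) (pol β b f)) :
    ∀ (r : ℕ) (f : Fin r → MvPolynomial σ k) (a : Fin r → B → ℕ), r ≤ R → (∀ i, MH β (f i) (a i)) → (∀ i, a i ≠ 0) →
      (∀ i, tdeg (a i) ≤ d) → CS s' f a → 
    ∃ (m : Fin r → Fin r → k) (a' : Fin r → B → ℕ) (b : Fin r → B), (∀ c : Fin r → k, (∀ i, ∑ j, c j * m j i = 0) → c = 0) ∧
      (∀ j i, m j i ≠ 0 → a i = a' j) ∧ (∀ j, ∃ i, a' j = a i) ∧ (∀ i j, i ≤ j → key (a' i) ≤ key (a' j)) ∧ (∀ l, a' l (b l) ≠ 0) ∧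
      ∀ l (c : Fin r → k), c l ≠ 0 → (∀ j, c j ≠ 0 → a' j = a' l ∧ j ≤ l) → 
        ¬ LowRk s (pol β (b l) (lc (fun j => lc f (m j)) c)) := by
  classical
  intro r
  induction r with
  | zero =>
    intro f a _ _ _ _ _
    exact ⟨fun i => i.elim0, fun i => i.elim0, fun i => i.elim0, fun c _ => Subsingleton.elim _ _, fun i => i.elim0, 
      fun i => i.elim0, fun i => i.elim0, fun i => i.elim0, fun i => i.elim0⟩
  | succ r ih =>
    intro f a hr hf ha hd hcs
    obtain ⟨i0, -, hi0⟩ := Finset.exists_max_image Finset.univ (fun i => key (a i)) ⟨0, Finset.mem_univ _⟩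
    obtain ⟨b0, hb0, hlow⟩ := hJ (f i0) (a i0) (hf i0) (ha i0) (hd i0) (by
      have := hcs (Pi.single i0 1) (by simp) (a i0) (by
        intro i hi
        by_cases h : i = i0
        · rw [h]
        · simp [h] at hi)
      rwa [Finset.sum_eq_single i0 (by intro j _ hj; simp [hj]) (by simp), Pi.single_eq_same, C_1, one_mul] at this)
    let L : (Fin (r+1) → k) →ₗ[k] MvPolynomial (σ ⊕ σ) k := lc (fun j => pol β b0 (f j))
    let U : Set (Fin (r+1) → k) := {c | (∀ i, c i ≠ 0 → a i = a i0) ∧ LowRk s (L c)}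
    have hL : ∀ c, L c = pol β b0 (lc f c) := by
      intro c; rw [lc_apply f, pol_lin]; rfl
    have hnot : (Pi.single i0 1 : Fin (r+1) → k) ∉ Submodule.span k U := by
      intro hmem
      have h1 := lowRk_span L U (fun u hu => hu.2) _ hmem
      apply hlow
      have h2 : L (Pi.single i0 1) = pol β b0 (f i0) := by
        rw [hL, lc_apply, Finset.sum_eq_single i0 (by intro j _ hj; simp [hj]) (by simp), Pi.single_eq_same, C_1, one_mul]
      rw [h2] at h1
      exact h1.mono (Nat.mul_le_mul_right s hr)
    obtain ⟨ℓ, hℓ0, hℓ⟩ := Submodule.exists_le_ker_of_notMem hnot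
    let e : Fin (r+1) → k := fun i => ℓ (Pi.single i 1)
    have he0 : e i0 ≠ 0 := hℓ0
    have hℓe : ∀ c : Fin (r+1) → k, ℓ c = ∑ i, c i * e i := by
      intro c
      conv_lhs => rw [pi_eq_sum_univ' c]
      rw [map_sum]
      refine Finset.sum_congr rfl fun i _ => ?_
      rw [map_smul, smul_eq_mul]
    have hkey : ∀ c : Fin (r+1) → k, (∀ i, c i ≠ 0 → a i = a i0) → ∑ i, c i * e i ≠ 0 → ¬ LowRk s (pol β b0 (lc f c)) := by
      intro c hc hne hl
      apply hne
      rw [← hℓe]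
      have : c ∈ U := ⟨hc, by rw [hL]; exact hl⟩
      exact hℓ (Submodule.subset_span this)
    let sA := i0.succAbove
    let lam : Fin r → k := fun t => if a (sA t) = a i0 then e (sA t) / e i0 else 0
    -- row of the elementary matrix
    let E : Fin r → Fin (r+1) → k := fun t => i0.insertNth (-lam t) (Pi.single t 1)
    have hE0 : ∀ t, E t i0 = - lam t := fun t => by simp [E]
    have hE1 : ∀ t t', E t (sA t') = if t' = t then 1 else 0 := fun t t' => by
      simp [E, sA, Pi.single_apply]
    have hEa : ∀ t i, E t i ≠ 0 → a i = a (sA t) := by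
      intro t i hi
      rcases Fin.eq_self_or_eq_succAbove i0 i with rfl | ⟨t', rfl⟩
      · rw [hE0] at hi
        by_contra hne
        apply hi
        simp only [lam]; rw [if_neg (fun h => hne h.symm), neg_zero]
      · rw [show i0.succAbove t' = sA t' from rfl] at hi ⊢
        rw [hE1] at hi
        by_cases h : t' = t
        · rw [h]
        · simp [h] at hi
    let g : Fin r → MvPolynomial σ k := fun t => lc f (E t)
    have hlcMH : ∀ (c : Fin (r+1) → k) A, (∀ i, c i ≠ 0 → a i = A) → MH β (lc f c) A := by
      intro c A hc
      rw [lc_apply]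
      refine Submodule.sum_mem (weightedHomogeneousSubmodule k (wt β) A) fun i _ => ?_
      by_cases h : c i = 0
      · rw [h, C_0, zero_mul]; exact Submodule.zero_mem _
      · rw [← smul_eq_C_mul]
        refine Submodule.smul_mem _ _ ?_
        rw [← hc i h]; exact hf i
    have hEinj : ∀ c : Fin r → k, (∀ i, ∑ j, c j * E j i = 0) → c = 0 := by
      intro c hc
      funext t
      have := hc (sA t)
      simp_rw [hE1] at this
      simpa using this
    have hcomp : ∀ (c : Fin r → k) A, (∀ t, c t ≠ 0 → a (sA t) = A) → ∀ i, ∑ t, c t * E t i ≠ 0 → a i = A := by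
      intro c A hc i hi
      obtain ⟨t, -, ht⟩ := Finset.exists_ne_zero_of_sum_ne_zero hi
      rw [hEa t i (right_ne_zero_of_mul ht)]
      exact hc t (left_ne_zero_of_mul ht)
    obtain ⟨m, a', b, h1, h2, h2', h3, h4, h5⟩ := ih g (fun t => a (sA t)) (by omega) (fun t => hlcMH _ _ (hEa t)) (fun t => ha _) (fun t => hd _) (by
      intro c hc A hA
      have := hcs (fun i => ∑ t, c t * E t i) (fun h => hc (hEinj c (fun i => congrFun h i))) A (hcomp c A hA)
      rw [← lc_apply, ← lc_lc] at this
      exact this)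
    let m' : Fin (r+1) → Fin (r+1) → k := Fin.snoc (α := fun _ => Fin (r+1) → k) (fun j i => ∑ t, m j t * E t i) (Pi.single i0 1)
    let a'' : Fin (r+1) → B → ℕ := Fin.snoc (α := fun _ => B → ℕ) a' (a i0)
    let b'' : Fin (r+1) → B := Fin.snoc (α := fun _ => B) b b0
    have hmc : ∀ j, m' j.castSucc = (fun i => ∑ t, m j t * E t i) := fun j => by simp only [m', Fin.snoc_castSucc]
    have hml : m' (Fin.last r) = Pi.single i0 1 := by simp only [m', Fin.snoc_last]
    have hac : ∀ j, a'' j.castSucc = a' j := fun j => by simp only [a'', Fin.snoc_castSucc]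
    have hal : a'' (Fin.last r) = a i0 := by simp only [a'', Fin.snoc_last]
    have hbc : ∀ j, b'' j.castSucc = b j := fun j => by simp only [b'', Fin.snoc_castSucc]
    have hbl : b'' (Fin.last r) = b0 := by simp only [b'', Fin.snoc_last]
    have hm2 : ∀ j i, m' j i ≠ 0 → a i = a'' j := by
      intro j
      refine Fin.lastCases ?_ (fun j => ?_) j
      · intro i hi
        rw [hml] at hi
        rw [hal]
        by_cases h : i = i0
        · rw [h]
        · simp [h] at hi
      · intro i hi
        rw [hmc] at hi
        rw [hac]
        exact hcomp _ _ (h2 j) i hi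
    have hsum0 : ∀ c : Fin (r+1) → k, ∀ t', ∑ j, c j * m' j (sA t') = ∑ j : Fin r, c j.castSucc * m j t' := by
      intro c t'
      rw [Fin.sum_univ_castSucc, hml]
      simp only [hmc]
      simp only [hE1]
      simp [sA]
    refine ⟨m', a'', b'', ?_, hm2, ?_, ?_, ?_, ?_⟩
    · intro c hc
      have hc0 : (fun j : Fin r => c j.castSucc) = 0 := by
        apply h1
        intro t'
        rw [← hsum0]; exact hc _
      have hl := hc i0
      rw [Fin.sum_univ_castSucc] at hl
      have hc0' : ∀ j : Fin r, c j.castSucc = 0 := fun j => congrFun hc0 j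
      simp only [hc0', zero_mul, Finset.sum_const_zero, zero_add, hml, Pi.single_eq_same, mul_one] at hl
      funext j
      refine Fin.lastCases hl (fun j => hc0' j) j
    · intro j
      refine Fin.lastCases ⟨i0, hal⟩ (fun j => ?_) j
      obtain ⟨t, ht⟩ := h2' j
      exact ⟨sA t, by rw [hac, ht]⟩
    · intro i j
      refine Fin.lastCases ?_ (fun j => ?_) j
      · refine Fin.lastCases ?_ (fun i => ?_) i
        · intro _; exact le_rfl
        · intro _
          rw [hac, hal]
          obtain ⟨t, ht⟩ := h2' i
          rw [ht]; exact hi0 _ (Finset.mem_univ _)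
      · refine Fin.lastCases ?_ (fun i => ?_) i
        · intro h
          exact absurd h (not_le.mpr (Fin.castSucc_lt_last j))
        · intro h; rw [hac, hac]; exact h3 i j (by simpa using h)
    · intro l
      refine Fin.lastCases ?_ (fun l => ?_) l
      · rw [hal, hbl]; exact hb0
      · rw [hac, hbc]; exact h4 l
    · intro l
      refine Fin.lastCases ?_ (fun l => ?_) l
      · intro c hc hcj
        rw [lc_lc, hbl]
        apply hkey
        · intro i hi
          obtain ⟨j, -, hj⟩ := Finset.exists_ne_zero_of_sum_ne_zero hi
          rw [hm2 j i (right_ne_zero_of_mul hj), (hcj j (left_ne_zero_of_mul hj)).1, hal]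
        · have : ∑ i, (∑ j, c j * m' j i) * e i = c (Fin.last r) * e i0 := by
            simp_rw [Finset.sum_mul]
            rw [Finset.sum_comm, Fin.sum_univ_castSucc]
            have hz : ∀ j : Fin r, ∑ i, c j.castSucc * m' j.castSucc i * e i = 0 := by
              intro j
              by_cases hcz : c j.castSucc = 0
              · simp [hcz]
              have hja : a' j = a i0 := by
                have := (hcj _ hcz).1
                rwa [hac, hal] at this
              simp_rw [mul_assoc]
              rw [← Finset.mul_sum]
              simp only [hmc, Finset.sum_mul]
              rw [Finset.sum_comm]
              refine mul_eq_zero_of_right _ (Finset.sum_eq_zero fun t _ => ?_)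
              by_cases hmt : m j t = 0
              · simp [hmt]
              have hat : a (sA t) = a i0 := by rw [h2 j t hmt, hja]
              simp_rw [mul_assoc]
              rw [← Finset.mul_sum, Fin.sum_univ_succAbove _ i0, hE0]
              rw [show (∑ i, E t (i0.succAbove i) * e (i0.succAbove i)) = e (sA t) by
                rw [Finset.sum_eq_single t]
                · rw [show E t (i0.succAbove t) = 1 from by rw [show i0.succAbove t = sA t from rfl, hE1, if_pos rfl]]; simp [sA]
                · intro t' _ ht'
                  rw [show E t (i0.succAbove t') = 0 from by rw [show i0.succAbove t' = sA t' from rfl, hE1, if_neg ht']]; simp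
                · simp]
              simp only [lam]
              rw [if_pos hat]
              field_simp
              ring
            rw [Finset.sum_eq_zero fun j _ => hz j, zero_add, Finset.sum_eq_single i0]
            · rw [hml]; simp
            · intro i _ hi; rw [hml]; simp [hi]
            · simp
          rw [this]
          exact mul_ne_zero hc he0
      · intro c hc hcj
        rw [hbc]
        have hcl : c (Fin.last r) = 0 := by
          by_contra hne
          exact absurd (hcj _ hne).2 (not_le.mpr (Fin.castSucc_lt_last l))
        have := h5 l (fun j => c j.castSucc) hc (by
          intro j hj
          have := hcj _ hj
          rw [hac, hac] at this
          exact ⟨this.1, by simpa using this.2⟩)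
        convert this using 3
        rw [lc_apply, lc_apply, Fin.sum_univ_castSucc, hcl, C_0, zero_mul, add_zero]
        refine Finset.sum_congr rfl fun j _ => ?_
        rw [hmc, lc_lc]

theorem flag (hk : IsBrauerField k) {d : ℕ} (hT : TH k d) (R s : ℕ) : ∃ s' : ℕ, ∀ (σ B : Type) [Fintype σ] [Fintype B] (β : σ → B)
    (key : (B → ℕ) → ℕ) (r : ℕ) (f : Fin r → MvPolynomial σ k) (a : Fin r → B → ℕ), Fintype.card B ≤ R → r ≤ R → 
    (∀ i, MH β (f i) (a i)) → (∀ i, a i ≠ 0) → (∀ i, tdeg (a i) ≤ d + 1) → CS s' f a → 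
    ∃ (f' : Fin r → MvPolynomial σ k) (a' : Fin r → B → ℕ) (b : Fin r → B), (∀ i, MH β (f' i) (a' i)) ∧ 
      Submodule.span k (Set.range f) = Submodule.span k (Set.range f') ∧ (∀ K, CS K f a → CS K f' a') ∧ (∀ j, ∃ i, a' j = a i) ∧
      (∀ i j, i ≤ j → key (a' i) ≤ key (a' j)) ∧ (∀ l, a' l (b l) ≠ 0) ∧
      ∀ l (c : Fin r → k), c l ≠ 0 → (∀ j, c j ≠ 0 → a' j = a' l ∧ j ≤ l) → 
        ¬ LowRk s (pol β (b l) (∑ j, C (c j) * f' j)) := by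
  classical
  obtain ⟨s', hs'⟩ := lemJ hk hT R (R * s)
  refine ⟨s', fun σ B _ _ β key r f a hB hr hf ha hd hcs => ?_⟩
  obtain ⟨m, a', b, h1, h2, h2', h3, h4, h5⟩ := flag_core β s s' R (d+1) key (fun f a h1 h2 h3 h4 => hs' σ B β f a hB h1 h2 h3 h4) 
    r f a hr hf ha hd hcs
  have hinj : Function.Injective (fun c : Fin r → k => Matrix.vecMul c (Matrix.of m)) := by
    intro c c' h
    have := h1 (c - c') (fun i => by
      have := congrFun h i
      simp only [Matrix.vecMul, dotProduct, Matrix.of_apply] at this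
      simp [sub_mul, this])
    exact sub_eq_zero.mp this
  have hu : IsUnit (Matrix.of m) := Matrix.vecMul_injective_iff_isUnit.mp hinj
  refine ⟨fun j => lc f (m j), a', b, ?_, ?_, ?_, h2', h3, h4, h5⟩
  · intro j
    beta_reduce
    rw [lc_apply]
    refine Submodule.sum_mem (weightedHomogeneousSubmodule k (wt β) (a' j)) fun i _ => ?_
    by_cases h : m j i = 0
    · rw [h, C_0, zero_mul]; exact Submodule.zero_mem _
    · rw [← smul_eq_C_mul]
      refine Submodule.smul_mem _ _ ?_
      rw [← h2 j i h]; exact hf i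
  · apply le_antisymm
    · rw [Submodule.span_le]
      rintro _ ⟨i, rfl⟩
      obtain ⟨c, hc⟩ : ∃ c : Fin r → k, Matrix.vecMul c (Matrix.of m) = Pi.single i 1 := 
        ⟨Matrix.vecMul (Pi.single i 1) (Matrix.of m)⁻¹, by
          rw [Matrix.vecMul_vecMul, Matrix.nonsing_inv_mul _ ((Matrix.isUnit_iff_isUnit_det _).mp hu), Matrix.vecMul_one]⟩
      have : f i = ∑ j, c j • lc f (m j) := by
        simp_rw [smul_eq_C_mul]
        rw [← lc_apply (fun j => lc f (m j)) c, lc_lc]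
        rw [show (fun i => ∑ j, c j * m j i) = Pi.single i 1 from hc]
        rw [lc_apply, Finset.sum_eq_single i (by intro j _ hj; simp [hj]) (by simp), Pi.single_eq_same, C_1, one_mul]
      rw [this]
      exact Submodule.sum_mem _ fun j _ => Submodule.smul_mem _ _ (Submodule.subset_span ⟨j, rfl⟩)
    · rw [Submodule.span_le]
      rintro _ ⟨j, rfl⟩
      simp only [lc_apply, ← smul_eq_C_mul]
      exact Submodule.sum_mem _ fun j _ => Submodule.smul_mem _ _ (Submodule.subset_span ⟨j, rfl⟩)
  · intro K hK c hc A hA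
    have := hK (fun i => ∑ t, c t * m t i) (fun h => hc (h1 c (fun i => congrFun h i))) A (by
      intro i hi
      obtain ⟨t, -, ht⟩ := Finset.exists_ne_zero_of_sum_ne_zero hi
      rw [h2 t i (right_ne_zero_of_mul ht)]
      exact hA t (left_ne_zero_of_mul ht))
    rw [← lc_apply, ← lc_lc] at this
    exact this

end flag
end RatDense

namespace RatDense
universe u
section phi
variable {k : Type u} [Field k] {σ τ : Type} {B B' B'' : Type} 

open Classical in
/-- push-forward of degrees -/
noncomputable def psh [Fintype B] (j : B → B') (a : B → ℕ) : B' → ℕ := fun b' => ∑ b, if j b = b' then a b else 0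

lemma psh_add [Fintype B] (j : B → B') (a a' : B → ℕ) : psh j (a + a') = psh j a + psh j a' := by
  classical
  funext b'
  simp only [psh, Pi.add_apply, ← Finset.sum_add_distrib]
  refine Finset.sum_congr rfl fun b _ => ?_
  split_ifs <;> simp

lemma psh_zero [Fintype B] (j : B → B') : psh j 0 = 0 := by
  funext b'; simp [psh]

lemma psh_psh [Fintype B] [Fintype B'] (j : B → B') (j' : B' → B'') (a : B → ℕ) : psh j' (psh j a) = psh (j' ∘ j) a := by
  classical
  funext b''
  simp only [psh, Finset.sum_ite, Finset.sum_const_zero, add_zero, Function.comp]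
  rw [Finset.sum_comm' (t' := Finset.univ.filter (fun b => j' (j b) = b'')) (s' := fun b => {j b})]
  · simp
  · intro x y; simp; constructor
    · rintro ⟨h, rfl⟩; exact ⟨rfl, h⟩
    · rintro ⟨rfl, h⟩; exact ⟨h, rfl⟩

lemma tdeg_psh [Fintype B] [Fintype B'] (j : B → B') (a : B → ℕ) : tdeg (psh j a) = tdeg a := by
  classical
  simp only [tdeg, psh]
  rw [Finset.sum_comm]
  simp

lemma psh_single [Fintype B] [DecidableEq B] [DecidableEq B'] (j : B → B') (b : B) (n : ℕ) :
    psh j (Pi.single b n) = Pi.single (j b) n := by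
  classical
  funext b'
  simp only [psh, Pi.single_apply]
  rw [Finset.sum_eq_single b]
  · by_cases h : j b = b'
    · simp [h]
    · simp [h, Ne.symm h]
  · intro c _ hc; simp [hc]
  · simp

lemma psh_inj [Fintype B] (j : B → B') (hj : Function.Injective j) (a : B → ℕ) (b : B) : psh j a (j b) = a b := by
  classical
  simp [psh, hj.eq_iff]

lemma psh_notMem [Fintype B] (j : B → B') (a : B → ℕ) (b' : B') (h : ∀ b, a b ≠ 0 → j b ≠ b') : psh j a b' = 0 := by
  classical
  unfold psh
  refine Finset.sum_eq_zero fun b _ => ?_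
  split_ifs with hb
  · by_contra h0; exact h b h0 hb
  · rfl

lemma le_psh [Fintype B] (j : B → B') (a : B → ℕ) (b : B) : a b ≤ psh j a (j b) := by
  classical
  unfold psh
  have := Finset.single_le_sum (f := fun c => if j c = j b then a c else 0) (fun _ _ => Nat.zero_le _) (Finset.mem_univ b)
  simpa using this

lemma wt_eq [DecidableEq B] (β : σ → B) (i : σ) : wt β i = Pi.single (β i) 1 := by
  funext b; simp [wt, Pi.single_apply, eq_comm]

lemma weight_psh [Fintype B] (j : B → B') (β : σ → B) (m : σ →₀ ℕ) :
    Finsupp.weight (wt (j ∘ β)) m = psh j (Finsupp.weight (wt β) m) := by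
  classical
  induction m using Finsupp.induction_linear with
  | zero => simp [psh_zero]
  | add f g hf hg => rw [map_add, map_add, psh_add, hf, hg]
  | single i n =>
    rw [Finsupp.weight_single, Finsupp.weight_single, wt_eq, wt_eq]
    have : ∀ n : ℕ, psh j (n • Pi.single (β i) 1) = n • psh j (Pi.single (β i) 1) := by
      intro n; induction n with
      | zero => simp [psh_zero]
      | succ n ih => rw [succ_nsmul, succ_nsmul, psh_add, ih]
    rw [this, psh_single]; rfl

lemma MH.pushBlocks [Fintype B] {β : σ → B} {f : MvPolynomial σ k} {a : B → ℕ} (hf : MH β f a) (j : B → B') :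
    MH (j ∘ β) f (psh j a) := by
  intro m hm
  rw [weight_psh, hf hm]

lemma MH.aeval {β : σ → B} {γ : τ → B} {ψ : σ → MvPolynomial τ k} (hψ : ∀ i, MH γ (ψ i) (wt β i))
    {f : MvPolynomial σ k} {a : B → ℕ} (hf : MH β f a) : MH γ (aeval ψ f) a := by
  classical
  rw [f.as_sum, map_sum]
  refine Submodule.sum_mem (weightedHomogeneousSubmodule k (wt γ) a) fun m hm => ?_
  rw [mem_weightedHomogeneousSubmodule, aeval_monomial, algebraMap_eq]
  have hw := hf (mem_support_iff.mp hm)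
  have h1 : MH γ (m.prod fun i e => ψ i ^ e) a := by
    rw [← hw, Finsupp.weight_apply]
    unfold Finsupp.prod Finsupp.sum
    exact IsWeightedHomogeneous.prod _ _ _ fun i _ => (hψ i).pow _
  have h2 := (isWeightedHomogeneous_C (wt γ) (coeff m f)).mul h1
  simpa using h2

lemma aeval_cmp {β : σ → B} {γ : τ → B} {ψ : σ → MvPolynomial τ k} (hψ : ∀ i, MH γ (ψ i) (wt β i))
    (G : MvPolynomial σ k) (A : B → ℕ) : MvPolynomial.aeval ψ (cmp β A G) = cmp γ A (MvPolynomial.aeval ψ G) := by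
  classical
  conv_rhs => rw [← sum_cmp β G (degs β G) le_rfl]
  rw [map_sum]
  change _ = weightedHomogeneousComponent (wt γ) A _
  rw [map_sum]
  by_cases hA : A ∈ degs β G
  · rw [Finset.sum_eq_single A]
    · exact (cmp_self ((cmp_MH β A G).aeval hψ)).symm
    · intro c _ hc; exact cmp_ne ((cmp_MH β c G).aeval hψ) hc
    · simp [hA]
  · rw [cmp_eq_zero_of_notMem hA, map_zero, Finset.sum_eq_zero]
    intro c hc
    exact cmp_ne ((cmp_MH β c G).aeval hψ) (by rintro rfl; exact hA hc)

variable {J : Type} [Fintype J]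

/-- generic splitting -/
noncomputable def Ph (J : Type) [Fintype J] : MvPolynomial σ k →ₐ[k] MvPolynomial (σ × J) k :=
  MvPolynomial.aeval (fun i => ∑ ν, X (i, ν))

abbrev βJ (J : Type) (β : σ → B) : σ × J → B × J := Prod.map β id

noncomputable def FF (β : σ → B) (A : B × J → ℕ) (f : MvPolynomial σ k) : MvPolynomial (σ × J) k := cmp (βJ J β) A (Ph J f)

lemma FF_MH (β : σ → B) (A : B × J → ℕ) (f : MvPolynomial σ k) : MH (βJ J β) (FF β A f) A := cmp_MH _ _ _

lemma FF_sum (β : σ → B) (A : B × J → ℕ) {ι : Type} [Fintype ι] (c : ι → k) (f : ι → MvPolynomial σ k) :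
    FF β A (∑ i, C (c i) * f i) = ∑ i, C (c i) * FF β A (f i) := by
  unfold FF cmp
  rw [map_sum, map_sum]
  refine Finset.sum_congr rfl fun i _ => ?_
  rw [← smul_eq_C_mul, ← smul_eq_C_mul, map_smul, map_smul]

lemma MH_X (β : σ → B) (i : σ) : MH β (X i : MvPolynomial σ k) (wt β i) := isWeightedHomogeneous_X _ _ _

lemma FF_psh [Fintype B] {β : σ → B} {A : B × J → ℕ} {f : MvPolynomial σ k} {a : B → ℕ} (hf : MH β f a) (h : FF β A f ≠ 0) :
    psh Prod.fst A = a := by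
  have h1 : MH (Prod.fst ∘ βJ J β) (Ph J f) a := by
    refine MH.aeval (β := β) (fun i => ?_) hf
    refine Submodule.sum_mem (weightedHomogeneousSubmodule k (wt (Prod.fst ∘ βJ J β)) _) fun ν _ => ?_
    exact MH_X (Prod.fst ∘ βJ J β) (i, ν)
  obtain ⟨m, hm⟩ := ne_zero_iff.mp h
  unfold FF at hm
  rw [coeff_cmp] at hm
  split_ifs at hm with hw
  · rw [← hw, ← weight_psh]; exact h1 hm
  · exact absurd rfl hm

lemma eval_FF {A' : Type*} [CommRing A'] [Algebra k A'] [Fintype B] (β : σ → B) (θ : B × J → A') (Q : σ × J → k)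
    (f : MvPolynomial σ k) (S : Finset (B × J → ℕ)) (hS : ∀ A, A ∉ S → FF β A f = 0) :
    MvPolynomial.aeval (fun i => ∑ ν, Q (i, ν) • θ (β i, ν)) f = ∑ A ∈ S, eval Q (FF β A f) • ∏ p, θ p ^ A p := by
  classical
  have h0 : MvPolynomial.aeval (fun i => ∑ ν, Q (i, ν) • θ (β i, ν)) f =
      MvPolynomial.aeval (fun p : σ × J => Q p • θ (βJ J β p)) (Ph J f) := by
    have : (MvPolynomial.aeval (fun i => ∑ ν, Q (i, ν) • θ (β i, ν)) : MvPolynomial σ k →ₐ[k] A') =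
      (MvPolynomial.aeval (fun p : σ × J => Q p • θ (βJ J β p))).comp (Ph J) := by
      apply MvPolynomial.algHom_ext; intro i; simp [Ph, βJ]
    rw [this]; rfl
  have h1 : Ph J f = ∑ A ∈ S, FF β A f := by
    refine (sum_cmp (βJ J β) (Ph J f) (degs (βJ J β) (Ph J f) ∪ S) Finset.subset_union_left).symm.trans ?_
    refine (Finset.sum_subset Finset.subset_union_right fun A _ hA => hS A hA).symm
  rw [h0, h1, map_sum]
  refine Finset.sum_congr rfl fun A _ => ?_
  have hMH := FF_MH β A f
  generalize FF β A f = G at hMH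
  conv_lhs => rw [G.as_sum]
  conv_rhs => rw [G.as_sum]
  rw [map_sum, map_sum, Finset.sum_smul]
  refine Finset.sum_congr rfl fun m hm => ?_
  have hw := hMH (mem_support_iff.mp hm)
  rw [aeval_monomial, eval_monomial]
  have : ∏ p, θ p ^ A p = m.prod fun q e => θ (βJ J β q) ^ e := by
    rw [← hw]
    clear hw hm
    induction m using Finsupp.induction_linear with
    | zero => simp
    | add f g hf hg => 
      rw [Finsupp.prod_add_index' (by simp) (by intros; rw [pow_add]), ← hf, ← hg, ← Finset.prod_mul_distrib]
      refine Finset.prod_congr rfl fun p _ => by rw [map_add, Pi.add_apply, pow_add]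
    | single i n =>
      rw [Finsupp.prod_single_index (by simp), Finsupp.weight_single, wt_eq, Finset.prod_eq_single (βJ J β i)]
      · simp
      · intro p _ hp; simp [hp]
      · simp
  rw [this, Algebra.smul_def, map_mul, mul_assoc]
  congr 1
  unfold Finsupp.prod
  rw [map_prod, ← Finset.prod_mul_distrib]
  refine Finset.prod_congr rfl fun q _ => ?_
  simp only [Algebra.smul_def, mul_pow, map_pow]

lemma MH_zero (β : σ → B) (a : B → ℕ) : MH β (0 : MvPolynomial σ k) a := 
  (weightedHomogeneousSubmodule k (wt β) a).zero_mem

/-- unsplit component recovers the form -/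
lemma LowRk.of_FF_un [Fintype B] {β : σ → B} {a : B → ℕ} {g : MvPolynomial σ k} (hg : MH β g a) (ν : B → J) {K : ℕ}
    (h : LowRk K (FF β (psh (fun b => (b, ν b)) a) g)) : LowRk K g := by
  classical
  set γ : σ → B × J := (fun b => (b, ν b)) ∘ β
  set ψ : σ × J → MvPolynomial σ k := fun p => if p.2 = ν (β p.1) then X p.1 else 0
  have hψ : ∀ p, MH γ (ψ p) (wt (βJ J β) p) := by
    rintro ⟨i, v⟩
    simp only [ψ]
    split_ifs with h
    · convert MH_X γ i using 1
      simp [wt_eq, γ, h]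
    · exact MH_zero _ _
  have h1 := h.aeval ψ (by rintro ⟨i, v⟩; simp only [ψ]; split_ifs <;> simp)
  rw [FF, aeval_cmp hψ] at h1
  have h2 : (MvPolynomial.aeval ψ).comp (Ph J) = AlgHom.id k (MvPolynomial σ k) := by
    apply MvPolynomial.algHom_ext; intro i; simp [Ph, ψ]
  have h3 := DFunLike.congr_fun h2 g
  simp only [AlgHom.comp_apply, AlgHom.id_apply] at h3
  rw [h3, cmp_self (hg.pushBlocks _)] at h1
  exact h1

lemma LowRk.of_FF_pol [Fintype σ] [Fintype B] [DecidableEq B] [DecidableEq J] {β : σ → B} {a : B → ℕ} {g : MvPolynomial σ k} (hg : MH β g a) (ν : B → J) {K : ℕ}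
    (b : B) (v : J) (hv : ν b ≠ v)
    (h : LowRk K (FF β (Pi.single (b, v) 1 + psh (fun b => (b, ν b)) (a - Pi.single b 1)) g)) : LowRk K (pol β b g) := by
  set A := Pi.single (b, v) 1 + psh (fun b => (b, ν b)) (a - Pi.single b 1) with hAdef
  have hinj : Function.Injective (fun b => (b, ν b)) := fun x y h => (Prod.ext_iff.mp h).1
  have hA1 : A (b, v) = 1 := by
    simp only [A, Pi.add_apply, Pi.single_eq_same]
    rw [psh_notMem]
    intro b' _ h'
    simp only [Prod.mk.injEq] at h'
    obtain ⟨rfl, h'⟩ := h'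
    exact hv h'
  set γ : σ ⊕ σ → B × J := Sum.elim (fun i => (β i, v)) (fun i => (β i, ν (β i)))
  set ψ : σ × J → MvPolynomial (σ ⊕ σ) k := fun p => (if β p.1 = b ∧ p.2 = v then X (Sum.inl p.1) else 0) + if p.2 = ν (β p.1) then X (Sum.inr p.1) else 0
  have hψ : ∀ p, MH γ (ψ p) (wt (βJ J β) p) := by
    rintro ⟨i, v'⟩
    simp only [ψ]
    refine Submodule.add_mem (weightedHomogeneousSubmodule k (wt γ) _) ?_ ?_
    · change MH γ _ _
      split_ifs with h
      · convert MH_X γ (Sum.inl i) using 1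
        simp [wt_eq, γ, h.2]
      · exact MH_zero _ _
    · change MH γ _ _
      split_ifs with h
      · convert MH_X γ (Sum.inr i) using 1
        simp [wt_eq, γ, h]
      · exact MH_zero _ _
  have h1 := h.aeval ψ (by rintro ⟨i, v⟩; simp only [ψ]; split_ifs <;> simp)
  rw [FF, aeval_cmp hψ] at h1
  set δ : σ → MvPolynomial (σ ⊕ σ) k := fun i => if β i = b then X (Sum.inl i) else 0
  set x : σ → MvPolynomial (σ ⊕ σ) k := fun i => X (Sum.inr i)
  have h2 : (MvPolynomial.aeval ψ).comp (Ph J) = (MvPolynomial.aeval (x + δ) : MvPolynomial σ k →ₐ[k] _) := by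
    apply MvPolynomial.algHom_ext; intro i
    simp only [AlgHom.comp_apply, Ph, ψ, aeval_X, map_sum, Pi.add_apply, x, δ, Finset.sum_add_distrib]
    rw [add_comm]; congr 1
    · simp
    · by_cases hb : β i = b <;> simp [hb]
  have h3 := DFunLike.congr_fun h2 g
  simp only [AlgHom.comp_apply] at h3
  rw [h3] at h1
  convert h1 using 1
  have hx : ∀ q : MvPolynomial σ k, MvPolynomial.aeval x q = rename Sum.inr q := by
    intro q
    have : MvPolynomial.aeval x = (rename Sum.inr : MvPolynomial σ k →ₐ[k] _) := by
      apply MvPolynomial.algHom_ext; intro i; simp [x]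
    rw [this]
  have hren : ∀ (q : MvPolynomial σ k) (c : B → ℕ), MH β q c → MH γ (rename Sum.inr q) (psh (fun b => (b, ν b)) c) := by
    intro q c hq
    rw [← hx]
    refine MH.aeval (fun i => ?_) (hq.pushBlocks (fun b => (b, ν b)))
    exact MH_X γ (Sum.inr i)
  have hpol : MH γ (pol β b g) A := by
    unfold pol
    refine Submodule.sum_mem (weightedHomogeneousSubmodule k (wt γ) _) fun i _ => ?_
    change MH γ _ _
    split_ifs with hi
    · by_cases h0 : pderiv i g = 0
      · rw [h0, map_zero, mul_zero]; exact MH_zero _ _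
      · obtain ⟨hle, hd⟩ := hg.pderiv' i h0
        have := (MH_X γ (Sum.inl i) (k := k)).mul (hren _ _ hd)
        convert this using 1
        rw [hAdef, wt_eq, wt_eq, hi]; simp [γ, hi]
    · exact MH_zero _ _
  have ht := taylor2 g x δ (Ideal.span (Set.range fun p : σ × σ => δ p.1 * δ p.2)) (fun i j => Ideal.subset_span ⟨(i, j), rfl⟩)
  have hsum : ∑ i, δ i * MvPolynomial.aeval x (pderiv i g) = pol β b g := by
    unfold pol
    refine Finset.sum_congr rfl fun i _ => ?_
    rw [hx]; simp only [δ]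
    split_ifs <;> simp
  rw [hsum, hx] at ht
  have hI : ∀ q ∈ Ideal.span (Set.range fun p : σ × σ => δ p.1 * δ p.2), RatDense.cmp γ A q = 0 := by
    intro q hq
    obtain ⟨c, rfl⟩ := (Ideal.mem_span_range_iff_exists_fun).mp hq
    unfold RatDense.cmp
    rw [map_sum]
    refine Finset.sum_eq_zero fun p _ => ?_
    rw [mul_comm]
    have hM : MH γ (δ p.1 * δ p.2) (Pi.single (b, v) 2) := by
      simp only [δ]
      split_ifs with h1 h2
      · convert (MH_X γ (Sum.inl p.1) (k := k)).mul (MH_X γ (Sum.inl p.2) (k := k)) using 1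
        rw [wt_eq, wt_eq]; simp only [γ, Sum.elim_inl, h1, h2]
        rw [← Pi.single_add]
      all_goals simp only [mul_zero, zero_mul]; exact MH_zero _ _
    refine (cmp_mul γ A _ _).trans (Finset.sum_eq_zero fun q hq => ?_)
    rw [cmp_ne hM, zero_mul]
    rintro rfl
    have := (Finset.mem_Iic.mp hq) (b, v)
    rw [hA1] at this
    simp at this
  have := hI _ ht
  unfold RatDense.cmp at this
  rw [map_sub, map_sub] at this
  change RatDense.cmp γ A _ - RatDense.cmp γ A _ - RatDense.cmp γ A _ = 0 at this
  rw [cmp_self hpol, cmp_ne (hren g a hg), sub_zero, sub_eq_zero] at this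
  · exact this.symm
  · intro h'
    have h'' := congrFun h' (b, v)
    rw [hA1, psh_notMem] at h''
    · exact absurd h'' (by norm_num)
    · intro b1 _ h5
      simp only [Prod.mk.injEq] at h5
      obtain ⟨rfl, h6⟩ := h5
      exact hv h6
end phi
end RatDense

namespace RatDense
universe u
section comb
variable {B : Type} [Fintype B] [DecidableEq B] {r : ℕ}

abbrev JJ (n : Fin r → ℕ) : Type := (Fin r ⊕ Unit) ⊕ (Σ l : Fin r, Fin (n l) ⊕ Fin (n l))

variable {n : Fin r → ℕ}

def idx : JJ n → ℕ
  | Sum.inl _ => 0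
  | Sum.inr x => x.1 + 1

def mu (A : B × JJ n → ℕ) : ℕ := Finset.univ.sup fun p => if A p ≠ 0 then idx p.2 else 0

lemma mu_le_iff {A : B × JJ n → ℕ} {m : ℕ} : mu A ≤ m ↔ ∀ p, A p ≠ 0 → idx p.2 ≤ m := by
  unfold mu
  rw [Finset.sup_le_iff]
  constructor
  · intro h p hp; simpa [hp] using h p (Finset.mem_univ p)
  · intro h p _; split_ifs with hp
    · exact h p hp
    · exact Nat.zero_le _

lemma le_mu {A : B × JJ n → ℕ} {p : B × JJ n} (hp : A p ≠ 0) : idx p.2 ≤ mu A := mu_le_iff.mp le_rfl p hp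

lemma mu_add (A A' : B × JJ n → ℕ) : mu (A + A') = max (mu A) (mu A') := by
  apply le_antisymm
  · rw [mu_le_iff]
    intro p hp
    simp only [Pi.add_apply] at hp
    by_cases h : A p = 0
    · exact le_max_of_le_right (le_mu (by omega))
    · exact le_max_of_le_left (le_mu h)
  · apply max_le <;> rw [mu_le_iff] <;> intro p hp <;> apply le_mu <;> simp <;> omega

lemma exists_mu {A : B × JJ n → ℕ} {m : ℕ} (h : mu A = m + 1) : ∃ p, A p ≠ 0 ∧ idx p.2 = m + 1 := by
  by_contra hc
  push Not at hc
  have : mu A ≤ m := mu_le_iff.mpr fun p hp => by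
    have := le_mu hp
    have := hc p hp
    omega
  omega

def alw (b : Fin r → B) (A : B × JJ n → ℕ) : Prop := ∀ c x, A (c, Sum.inr x) ≠ 0 → c = b x.1

def uns {J : Type} (A : B × J → ℕ) : Prop := ∀ c v v', A (c, v) ≠ 0 → A (c, v') ≠ 0 → v = v'

abbrev vx (l : Fin r) (x : Fin (n l) ⊕ Fin (n l)) : JJ n := Sum.inr ⟨l, x⟩
abbrev wl : JJ n := Sum.inl (Sum.inr ())

lemma uns_eq {J : Type} [Fintype J] [Nonempty J] {A : B × J → ℕ} (h : uns A) : ∃ ν : B → J, A = psh (fun b => (b, ν b)) (psh Prod.fst A) := by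
  classical
  have : ∀ c, ∃ v : J, ∀ v', A (c, v') ≠ 0 → v' = v := by
    intro c
    by_cases hc : ∃ v, A (c, v) ≠ 0
    · obtain ⟨v, hv⟩ := hc
      exact ⟨v, fun v' hv' => h c v' v hv' hv⟩
    · push Not at hc
      exact ⟨Classical.arbitrary J, fun v' hv' => absurd (hc v') hv'⟩
  choose ν hν using this
  refine ⟨ν, ?_⟩
  rw [psh_psh]
  have : ∀ p, A p ≠ 0 → ((fun b => (b, ν b)) ∘ Prod.fst) p = p := by
    rintro ⟨c, v⟩ hp
    simp [hν c v hp]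
  funext p
  unfold psh
  rw [Finset.sum_eq_single p]
  · by_cases hp : A p = 0
    · simp [hp]
    · simp only [this p hp, if_true]
  · intro q _ hq
    by_cases hp : A q = 0
    · simp [hp]
    · rw [this q hp, if_neg hq]
  · simp

/-- square norm -/
def nu {B : Type} [Fintype B] (a : B → ℕ) : ℕ := ∑ c, a c ^ 2

lemma nu_psh {B B' : Type} [Fintype B] [Fintype B'] (j : B → B') (A : B → ℕ) :
    nu A ≤ nu (psh j A) ∧ (nu (psh j A) ≤ nu A → ∀ x y, A x ≠ 0 → A y ≠ 0 → j x = j y → x = y) := by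
  classical
  have h1 : nu (psh j A) = ∑ x, ∑ y, if j x = j y then A x * A y else 0 := by
    simp only [nu, psh, sq, Finset.sum_mul_sum]
    rw [Finset.sum_comm]
    refine Finset.sum_congr rfl fun x _ => ?_
    rw [Finset.sum_comm]
    refine Finset.sum_congr rfl fun y _ => ?_
    rw [Finset.sum_eq_single (j x)]
    · by_cases h : j x = j y
      · simp [h]
      · simp [h, Ne.symm h]
    · intro c _ hc; simp [Ne.symm hc]
    · simp
  have h2 : ∀ x, A x ^ 2 ≤ ∑ y, if j x = j y then A x * A y else 0 := by
    intro x
    have := Finset.single_le_sum (f := fun y => if j x = j y then A x * A y else 0) (fun _ _ => Nat.zero_le _) (Finset.mem_univ x)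
    simpa [sq] using this
  refine ⟨by rw [h1]; exact Finset.sum_le_sum fun x _ => h2 x, ?_⟩
  intro hle x y hx hy hxy
  by_contra hne
  have : nu A < nu (psh j A) := by
    rw [h1]
    refine Finset.sum_lt_sum (fun x _ => h2 x) ⟨x, Finset.mem_univ x, ?_⟩
    have h3 := Finset.sum_le_sum_of_subset (f := fun y => if j x = j y then A x * A y else 0) (Finset.subset_univ {x, y})
    rw [Finset.sum_pair hne] at h3
    simp only [if_true, hxy] at h3 
    have : 0 < A x * A y := Nat.mul_pos (by omega) (by omega)
    simp only [hxy]
    rw [sq]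
    omega
  omega

lemma psh_apply_of_inj {B B' : Type} [Fintype B] (κ : B → B') (a : B → ℕ) (h : ∀ x y, a x ≠ 0 → a y ≠ 0 → κ x = κ y → x = y)
    {x : B} (hx : a x ≠ 0) : psh κ a (κ x) = a x := by
  classical
  unfold psh
  rw [Finset.sum_eq_single x]
  · simp
  · intro y _ hy
    by_cases h0 : a y = 0
    · simp [h0]
    · rw [if_neg]; intro he; exact hy (h y x h0 hx he)
  · simp

variable (a : Fin r → B → ℕ) (b : Fin r → B)

def dg (l : Fin r) (q : B × JJ n → ℕ) (x : Fin (n l) ⊕ Fin (n l)) : B × JJ n → ℕ := 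
  q + Pi.single (b l, vx l x) (a l (b l))

noncomputable def sp (l : Fin r) (c c' : Fin (n l)) : B × JJ n → ℕ :=
  Pi.single (b l, vx l (Sum.inl c)) 1 + Pi.single (b l, vx l (Sum.inr c')) (a l (b l) - 1) +
    psh (fun c => (c, (wl : JJ n))) (Function.update (a l) (b l) 0)

def Rc (l : Fin r) (j : Fin r) (q : B × JJ n → ℕ) : Prop :=
  j ≤ l ∧ tdeg (a j) = tdeg (a l) ∧ mu q ≤ l ∧ uns q ∧ alw b q ∧ (∀ v, q (b l, v) = 0) ∧ psh Prod.fst q + Pi.single (b l) (a l (b l)) = a j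

def NI (l j : Fin r) (A : B × JJ n → ℕ) : Prop :=
  (∃ q x, Rc a b l j q ∧ A = dg a b l q x) ∨ (2 ≤ a l (b l) ∧ j = l ∧ ∃ c c', A = sp a b l c c')

variable {a b}

lemma idx_vx (l : Fin r) (x : Fin (n l) ⊕ Fin (n l)) : idx (vx l x : JJ n) = l + 1 := rfl

lemma mu_single (c : B) (v : JJ n) {m : ℕ} (hm : m ≠ 0) : mu (Pi.single (c, v) m) = idx v := by
  apply le_antisymm
  · rw [mu_le_iff]
    intro p hp
    by_cases h : p = (c, v)
    · rw [h]
    · simp [h] at hp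
  · exact le_mu (p := (c, v)) (by simpa using hm)

lemma mu_wl (g : B → ℕ) : mu (psh (fun c => (c, (wl : JJ n))) g) = 0 := by
  refine Nat.le_zero.mp (mu_le_iff.mpr ?_)
  rintro ⟨c, v⟩ hp
  by_contra hv
  refine hp (psh_notMem _ _ _ ?_)
  intro b' _ h
  simp only [Prod.mk.injEq] at h
  rw [← h.2] at hv
  simp [idx] at hv

lemma psh_fst_wl {J : Type} [Fintype J] (ν : B → J) (g : B → ℕ) : psh Prod.fst (psh (fun c => (c, ν c)) g) = g := by
  rw [psh_psh]
  funext c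
  exact psh_inj (id : B → B) Function.injective_id g c

lemma alw_add {A A' : B × JJ n → ℕ} (h : alw b A) (h' : alw b A') : alw b (A + A') := by
  intro c x hx
  simp only [Pi.add_apply] at hx
  by_cases h0 : A (c, Sum.inr x) = 0
  · exact h' c x (by omega)
  · exact h c x h0

lemma alw_single (l : Fin r) (x) (m : ℕ) : alw b (Pi.single (b l, (vx l x : JJ n)) m) := by
  intro c y hy
  by_cases h : (c, (Sum.inr y : JJ n)) = (b l, vx l x)
  · simp only [Prod.mk.injEq, Sum.inr.injEq] at h
    obtain ⟨rfl, rfl⟩ := h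
    rfl
  · simp [Pi.single_apply, h] at hy

lemma alw_wl (g : B → ℕ) : alw b (psh (fun c => (c, (wl : JJ n))) g) := by
  intro c x hx
  have := le_mu hx
  rw [mu_wl] at this
  simp [idx] at this

section
variable (hb : ∀ l, a l (b l) ≠ 0)

lemma upd_add (l : Fin r) : Function.update (a l) (b l) 0 + Pi.single (b l) (a l (b l)) = a l := by
  funext c
  by_cases h : c = b l
  · subst h; simp
  · simp [h]

lemma NI_le {l j : Fin r} {A : B × JJ n → ℕ} (h : NI a b l j A) : j ≤ l := by
  rcases h with ⟨q, x, h, _⟩ | ⟨_, h, _⟩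
  · exact h.1
  · exact h.le

lemma NI_tdeg {l j : Fin r} {A : B × JJ n → ℕ} (h : NI a b l j A) : tdeg (a j) = tdeg (a l) := by
  rcases h with ⟨q, x, h, _⟩ | ⟨_, h, _⟩
  · exact h.2.1
  · rw [h]

lemma NI_psh {l j : Fin r} {A : B × JJ n → ℕ} (h : NI a b l j A) : psh Prod.fst A = a j := by
  rcases h with ⟨q, x, h, rfl⟩ | ⟨he, rfl, c, c', rfl⟩
  · rw [dg, psh_add, psh_single]; exact h.2.2.2.2.2.2
  · rw [sp, psh_add, psh_add, psh_single, psh_single, psh_fst_wl, ← Pi.single_add, add_comm]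
    rw [show 1 + (a j (b j) - 1) = a j (b j) by omega]
    exact upd_add j

lemma NI_alw {l j : Fin r} {A : B × JJ n → ℕ} (h : NI a b l j A) : alw b A := by
  rcases h with ⟨q, x, h, rfl⟩ | ⟨he, rfl, c, c', rfl⟩
  · exact alw_add h.2.2.2.2.1 (alw_single _ _ _)
  · exact alw_add (alw_add (alw_single _ _ _) (alw_single _ _ _)) (alw_wl _)

lemma NI_mu (hb : ∀ l, a l (b l) ≠ 0) {l j : Fin r} {A : B × JJ n → ℕ} (h : NI a b l j A) : mu A = l + 1 := by
  rcases h with ⟨q, x, h, rfl⟩ | ⟨he, rfl, c, c', rfl⟩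
  · rw [dg, mu_add, mu_single _ _ (hb l), idx_vx]
    have := h.2.2.1
    omega
  · rw [sp, mu_add, mu_add, mu_single _ _ (by norm_num), mu_single _ _ (by omega), mu_wl, idx_vx, idx_vx]
    omega

lemma dg_uns {l j : Fin r} {q : B × JJ n → ℕ} (h : Rc a b l j q) (x) : uns (dg a b l q x) := by
  intro c v v' hv hv'
  obtain ⟨-, -, -, hu, -, h0, -⟩ := h
  simp only [dg, Pi.add_apply, Pi.single_apply, Prod.mk.injEq] at hv hv'
  by_cases hc : c = b l
  · subst hc
    simp only [h0, true_and, zero_add] at hv hv'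
    split_ifs at hv hv' with h1 h2
    · rw [h1, h2]
    all_goals simp_all
  · simp only [hc, false_and, if_false, add_zero] at hv hv'
    exact hu c v v' hv hv'

lemma sp_eq (hb : ∀ l, a l (b l) ≠ 0) (l : Fin r) (c c' : Fin (n l)) : sp a b l c c' = Pi.single (b l, vx l (Sum.inl c)) 1 +
    psh (fun x => (x, if x = b l then (vx l (Sum.inr c') : JJ n) else wl)) (a l - Pi.single (b l) 1) := by
  rw [sp, add_assoc]
  congr 1
  have : a l - Pi.single (b l) 1 = Pi.single (b l) (a l (b l) - 1) + Function.update (a l) (b l) 0 := by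
    funext x
    by_cases h : x = b l
    · subst h; simp
    · simp [h]
  rw [this, psh_add, psh_single, if_pos rfl]
  congr 1
  funext p
  unfold psh
  refine Finset.sum_congr rfl fun x _ => ?_
  by_cases h : x = b l
  · subst h; simp
  · simp [h]

lemma dg_of_uns (hb : ∀ l, a l (b l) ≠ 0) {l j : Fin r} {A : B × JJ n → ℕ} (hu : uns A) (hp : psh Prod.fst A = a j) (ha : alw b A) (hm : mu A = l + 1)
    (hjl : j ≤ l) (hdeg : tdeg (a j) = tdeg (a l)) (he : a j (b l) ≠ 0 → a j (b l) = a l (b l)) : NI a b l j A := by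
  left
  obtain ⟨⟨c, v⟩, hcv, hv⟩ := exists_mu hm
  rcases v with v | ⟨l', x⟩
  · simp [idx] at hv
  simp only [idx] at hv
  have hl : l' = l := by ext; simpa using hv
  subst hl
  have hc := ha _ _ hcv
  simp only at hc
  subst hc
  have hAe : A (b l', vx l' x) = a j (b l') := by
    rw [← hp]; exact (psh_apply_of_inj Prod.fst A (by
      rintro ⟨c, v⟩ ⟨c', v'⟩ h1 h2 h3
      simp only at h3; subst h3
      rw [hu c v v' h1 h2]) hcv).symm
  have hAe' : A (b l', vx l' x) = a l' (b l') := by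
    rw [hAe]; apply he; rw [← hAe]; exact hcv
  set q : B × JJ n → ℕ := Function.update A (b l', vx l' x) 0 with hq
  have hAq : A = dg a b l' q x := by
    rw [dg]
    funext p
    by_cases h : p = (b l', vx l' x)
    · subst h; simp [q, hAe']
    · simp [q, h]
  have hqA : ∀ p, q p ≠ 0 → A p ≠ 0 ∧ p ≠ (b l', vx l' x) := by
    intro p h
    have h1 : p ≠ (b l', vx l' x) := by rintro rfl; simp [q] at h
    exact ⟨by simpa [q, h1] using h, h1⟩
  have hq0 : ∀ v, q (b l', v) = 0 := by
    intro v
    by_contra h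
    obtain ⟨h1, h2⟩ := hqA _ h
    exact h2 (by rw [hu _ _ _ h1 hcv])
  refine ⟨q, x, ⟨hjl, hdeg, ?_, ?_, ?_, hq0, ?_⟩, hAq⟩
  · rw [mu_le_iff]
    rintro ⟨c, v⟩ h
    obtain ⟨h1, h2⟩ := hqA _ h
    have h3 := le_mu h1
    rw [hm] at h3
    by_contra h4
    rcases v with v | ⟨l'', y⟩
    · simp [idx] at h4
    have : l'' = l' := by ext; simp [idx] at h3 h4; omega
    subst this
    have h5 := ha _ _ h1
    simp only at h5; subst h5
    exact h (hq0 _)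
  · intro c v v' h1 h2
    exact hu c v v' (hqA _ h1).1 (hqA _ h2).1
  · intro c x h
    exact ha c x (hqA _ h).1
  · rw [← hp]; conv_rhs => rw [hAq, dg, psh_add, psh_single]

lemma dg_inj (hb : ∀ l, a l (b l) ≠ 0) {l j j' : Fin r} {q q' : B × JJ n → ℕ} {x x'} (h : Rc a b l j q) (h' : Rc a b l j' q') 
    (he : dg a b l q x = dg a b l q' x') : q = q' ∧ x = x' := by
  have hx : x = x' := by
    have h1 := congrFun he (b l, vx l x)
    simp only [dg, Pi.add_apply, h.2.2.2.2.2.1, h'.2.2.2.2.2.1, Pi.single_eq_same, zero_add, Pi.single_apply] at h1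
    split_ifs at h1 with h2
    · simpa using h2
    · exact absurd h1 (hb l)
  subst hx
  exact ⟨add_right_cancel he, rfl⟩

lemma sp_apply_l (l : Fin r) (c c' : Fin (n l)) (x) : sp a b l c c' (b l, vx l x) = (if x = Sum.inl c then 1 else 0) + if x = Sum.inr c' then a l (b l) - 1 else 0 := by
  rw [sp]
  simp only [Pi.add_apply]
  rw [psh_notMem _ _ (b l, vx l x) (by intro b' _ h; simp at h)]
  simp [Pi.single_apply]

lemma sp_inj {l : Fin r} (h2 : 2 ≤ a l (b l)) {c c' d d' : Fin (n l)} (h : sp a b l c c' = sp a b l d d') : c = d ∧ c' = d' := by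
  constructor
  · have := congrFun h (b l, vx l (Sum.inl c))
    rw [sp_apply_l, sp_apply_l] at this
    by_contra hne
    simp [hne] at this
  · have := congrFun h (b l, vx l (Sum.inr c'))
    rw [sp_apply_l, sp_apply_l] at this
    by_contra hne
    simp [hne] at this
    omega

lemma sp_not_uns {l : Fin r} (h2 : 2 ≤ a l (b l)) (c c' : Fin (n l)) : ¬ uns (sp a b l c c') := by
  intro h
  have := h (b l) (vx l (Sum.inl c)) (vx l (Sum.inr c')) (by rw [sp_apply_l]; simp) (by rw [sp_apply_l]; simp; omega)
  simp at this

variable (a b)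
noncomputable def qz (n : Fin r → ℕ) (l : Fin r) : B × JJ n → ℕ := psh (fun c => (c, (wl : JJ n))) (Function.update (a l) (b l) 0)
variable {a b}

lemma qz_Rc (l : Fin r) : Rc a b l l (qz a b n l) := by
  refine ⟨le_rfl, rfl, by rw [qz, mu_wl]; omega, ?_, alw_wl _, ?_, ?_⟩
  · intro c v v' h h'
    have : ∀ v, psh (fun c => (c, (wl : JJ n))) (Function.update (a l) (b l) 0) (c, v) ≠ 0 → v = wl := by
      intro v hv
      by_contra hne
      exact hv (psh_notMem _ _ _ (by intro b' _ h; simp only [Prod.mk.injEq] at h; exact hne h.2.symm))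
    rw [this v h, this v' h']
  · intro v
    refine psh_notMem _ _ _ ?_
    intro b' hb' h
    simp only [Prod.mk.injEq] at h
    rw [h.1] at hb'; simp at hb'
  · rw [qz, psh_fst_wl, upd_add]

/-- exponent box -/
def Box (n : Fin r → ℕ) (D : ℕ) : Finset (B × JJ n → ℕ) := Fintype.piFinset (fun _ => Finset.range (D + 1))

lemma mem_Box {D : ℕ} {A : B × JJ n → ℕ} (h : tdeg (psh Prod.fst A) ≤ D) : A ∈ Box n D := by
  rw [Box, Fintype.mem_piFinset]
  intro p
  rw [Finset.mem_range]
  rw [tdeg_psh] at h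
  have : A p ≤ tdeg A := Finset.single_le_sum (f := A) (fun _ _ => Nat.zero_le _) (Finset.mem_univ p)
  omega

variable (a b)
open Classical in
noncomputable def Rho (n : Fin r → ℕ) (D : ℕ) (l : Fin r) : Finset (Fin r × (B × JJ n → ℕ)) :=
  (Finset.univ ×ˢ Fintype.piFinset (fun p : B × JJ n => Finset.range (if idx p.2 ≤ l then D + 1 else 1))).filter
    fun z => Rc a b l z.1 z.2
variable {a b}

lemma mem_Rho {D : ℕ} (hD : ∀ j, tdeg (a j) ≤ D) {l : Fin r} {z : Fin r × (B × JJ n → ℕ)} : z ∈ Rho a b n D l ↔ Rc a b l z.1 z.2 := by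
  classical
  rw [Rho, Finset.mem_filter]
  refine ⟨fun h => h.2, fun h => ⟨?_, h⟩⟩
  rw [Finset.mem_product]
  refine ⟨Finset.mem_univ _, ?_⟩
  rw [Fintype.mem_piFinset]
  intro p
  rw [Finset.mem_range]
  split_ifs with hp
  · have h1 := h.2.2.2.2.2.2
    have h2 : tdeg (psh Prod.fst z.2) ≤ tdeg (a z.1) := by
      rw [← h1]; exact tdeg_mono (by intro c; simp)
    have := mem_Box (h2.trans (hD z.1))
    rw [Box, Fintype.mem_piFinset] at this
    exact Finset.mem_range.mp (this p)
  · by_contra h0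
    exact hp ((le_mu (by omega)).trans h.2.2.1)

lemma level_sum (hb : ∀ l, a l (b l) ≠ 0) {D : ℕ} (hD : ∀ j, tdeg (a j) ≤ D) (l j : Fin r) {M : Type*} [AddCommMonoid M]
    (G : (B × JJ n → ℕ) → M) (hG : ∀ A, mu A = l + 1 → ¬ NI a b l j A → G A = 0) :
    ∑ A ∈ (Box n D).filter (fun A => mu A = l + 1), G A = 
      (∑ z ∈ (Rho a b n D l).filter (fun z => z.1 = j), ∑ x, G (dg a b l z.2 x)) +
      if 2 ≤ a l (b l) ∧ j = l then ∑ c, ∑ c', G (sp a b l c c') else 0 := by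
  classical
  set T1 := ((Rho a b n D l).filter (fun z => z.1 = j) ×ˢ (Finset.univ : Finset (Fin (n l) ⊕ Fin (n l)))).image (fun z => dg a b l z.1.2 z.2) with hT1
  set T2 : Finset (B × JJ n → ℕ) := if 2 ≤ a l (b l) ∧ j = l then (Finset.univ : Finset (Fin (n l) × Fin (n l))).image (fun z => sp a b l z.1 z.2) else ∅ with hT2
  have m1 : ∀ A, A ∈ T1 ↔ ∃ q x, Rc a b l j q ∧ A = dg a b l q x := by
    intro A
    rw [hT1, Finset.mem_image]
    constructor
    · rintro ⟨⟨⟨j', q⟩, x⟩, h, rfl⟩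
      simp only [Finset.mem_product, Finset.mem_filter, mem_Rho hD, Finset.mem_univ, and_true] at h
      obtain ⟨h, rfl⟩ := h
      exact ⟨q, x, h, rfl⟩
    · rintro ⟨q, x, h, rfl⟩
      exact ⟨⟨⟨j, q⟩, x⟩, by simp only [Finset.mem_product, Finset.mem_filter, mem_Rho hD, Finset.mem_univ, and_true]; exact h, rfl⟩
  have m2 : ∀ A, A ∈ T2 ↔ 2 ≤ a l (b l) ∧ j = l ∧ ∃ c c', A = sp a b l c c' := by
    intro A
    rw [hT2]
    split_ifs with h
    · simp only [Finset.mem_image, Finset.mem_univ, true_and, Prod.exists, h.1, h.2]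
      simp only [eq_comm]
    · simp only [Finset.notMem_empty, false_iff]
      rintro ⟨h1, h2, -⟩; exact h ⟨h1, h2⟩
  have hdis : Disjoint T1 T2 := by
    rw [Finset.disjoint_left]
    intro A h1 h2
    obtain ⟨q, x, h, rfl⟩ := (m1 _).mp h1
    obtain ⟨h3, rfl, c, c', h5⟩ := (m2 _).mp h2
    exact sp_not_uns h3 c c' (h5 ▸ dg_uns h x)
  have hmem : ∀ A, A ∈ T1 ∪ T2 ↔ NI a b l j A := by
    intro A; rw [Finset.mem_union, m1, m2, NI]
  have hsub : T1 ∪ T2 ⊆ (Box n D).filter (fun A => mu A = l + 1) := by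
    intro A hA
    rw [hmem] at hA
    rw [Finset.mem_filter]
    exact ⟨mem_Box (by rw [NI_psh hA]; exact hD j), NI_mu hb hA⟩
  rw [← Finset.sum_subset hsub, Finset.sum_union hdis]
  · congr 1
    · rw [hT1, Finset.sum_image, Finset.sum_product]
      rintro ⟨⟨j1, q1⟩, x1⟩ h1 ⟨⟨j2, q2⟩, x2⟩ h2 h
      simp only [Finset.coe_product, Set.mem_prod, Finset.mem_coe, Finset.mem_filter, mem_Rho hD] at h1 h2
      obtain ⟨h3, h4⟩ := dg_inj hb h1.1.1 h2.1.1 h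
      simp only at h3 h4
      rw [h1.1.2, h2.1.2, h3, h4]
    · rw [hT2]
      split_ifs with h
      · rw [Finset.sum_image, ← Finset.univ_product_univ, Finset.sum_product]
        rintro ⟨c, c'⟩ _ ⟨d, d'⟩ _ h'
        obtain ⟨h3, h4⟩ := sp_inj h.1 h'
        exact Prod.ext h3 h4
      · simp
  · intro A hA hA'
    rw [hmem] at hA'
    exact hG A (Finset.mem_filter.mp hA).2 hA'

lemma prod_JJ (nn : ℕ → ℕ) (D l : ℕ) (hl : l ≤ r) : ∏ v : JJ (fun i : Fin r => nn i), (if idx v ≤ l then D + 1 else 1) =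
    (D + 1) ^ (r + 1 + 2 * ∑ i ∈ Finset.range l, nn i) := by
  rw [Fintype.prod_sum_type, pow_add, Finset.mul_sum, ← Finset.prod_pow_eq_pow_sum]
  congr 1
  · simp [idx]
  · rw [Fintype.prod_sigma]
    have : ∀ i : Fin r, (∏ x : Fin (nn i) ⊕ Fin (nn i), (if idx (Sum.inr ⟨i, x⟩ : JJ (fun i : Fin r => nn i)) ≤ l then D + 1 else 1)) = 
      (fun i : ℕ => if i < l then (D + 1) ^ (2 * nn i) else 1) i := by
      intro i
      simp only [idx]
      by_cases h : (i : ℕ) < l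
      · have : (i : ℕ) + 1 ≤ l := h
        simp [this, h, two_mul]
      · have : ¬ (i : ℕ) + 1 ≤ l := by omega
        simp [this, h]
    rw [Finset.prod_congr rfl fun i _ => this i, Fin.prod_univ_eq_prod_range (fun i : ℕ => if i < l then (D + 1) ^ (2 * nn i) else 1), ← Finset.prod_filter]
    refine Finset.prod_congr ?_ fun _ _ => rfl
    ext i; simp; omega

lemma Rho_card (nn : ℕ → ℕ) (D : ℕ) (l : Fin r) : (Rho a b (fun i => nn i) D l).card ≤ 
    r * ((D + 1) ^ (r + 1 + 2 * ∑ i ∈ Finset.range l, nn i)) ^ Fintype.card B := by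
  classical
  rw [Rho]
  refine (Finset.card_filter_le _ _).trans ?_
  rw [Finset.card_product, Fintype.card_piFinset, Finset.card_univ, Fintype.card_fin]
  refine Nat.mul_le_mul_left _ ?_
  simp only [Finset.card_range]
  rw [Fintype.prod_prod_type]
  simp only [prod_JJ nn D l l.2.le]
  simp

lemma Box_card (nn : ℕ → ℕ) (D : ℕ) : (Box (B := B) (fun i : Fin r => nn i) D).card =
    ((D + 1) ^ (r + 1 + 2 * ∑ i ∈ Finset.range r, nn i)) ^ Fintype.card B := by
  rw [Box, Fintype.card_piFinset, Fintype.prod_prod_type]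
  simp only [Finset.card_range]
  rw [Finset.prod_const, Finset.card_univ]
  congr 1
  rw [← prod_JJ nn D r le_rfl]
  refine Finset.prod_congr rfl fun v _ => ?_
  rw [if_pos]
  rcases v with v | ⟨i, x⟩
  · simp [idx]
  · simp only [idx]; exact i.2

lemma JJ_card (nn : ℕ → ℕ) : Fintype.card (JJ (fun i : Fin r => nn i)) = r + 1 + 2 * ∑ i ∈ Finset.range r, nn i := by
  simp only [Fintype.card_sum, Fintype.card_sigma, Fintype.card_fin, Fintype.card_unit, ← two_mul, ← Finset.mul_sum]
  rw [Fin.sum_univ_eq_sum_range nn]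
end
end comb
end RatDense

namespace RatDense
universe u
section csx
variable {k : Type u} [Field k] {σ : Type} [Fintype σ] {B : Type} [Fintype B] [DecidableEq B] {r : ℕ} {n : Fin r → ℕ}
variable {β : σ → B} {f : Fin r → MvPolynomial σ k} {a : Fin r → B → ℕ} {b : Fin r → B} {s : ℕ}

lemma MH_comb {g : Fin r → MvPolynomial σ k} (hf : ∀ i, MH β (g i) (a i)) (C' : Fin r → k) (A : B → ℕ) (h : ∀ j, C' j ≠ 0 → a j = A) :
    MH β (∑ j, C (C' j) * g j) A := by
  refine Submodule.sum_mem (weightedHomogeneousSubmodule k (wt β) A) fun j _ => ?_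
  rw [← smul_eq_C_mul]
  by_cases h0 : C' j = 0
  · rw [h0, zero_smul]; exact Submodule.zero_mem _
  · exact Submodule.smul_mem _ _ (h j h0 ▸ hf j)

lemma noLow (hf : ∀ i, MH β (f i) (a i)) (hb : ∀ l, a l (b l) ≠ 0) (hcs : CS s f a)
    (hfl : ∀ l (c : Fin r → k), c l ≠ 0 → (∀ j, c j ≠ 0 → a j = a l ∧ j ≤ l) → ¬ LowRk s (pol β (b l) (∑ j, C (c j) * f j)))
    {l j : Fin r} {A : B × JJ n → ℕ} (h : NI a b l j A) (C' : Fin r → k) (h1 : C' j ≠ 0) (h2 : ∀ j', C' j' ≠ 0 → a j' = a j ∧ j' ≤ l) :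
    ¬ LowRk s (FF β A (∑ i, C (C' i) * f i)) := by
  intro hL
  have hp := NI_psh h
  have hg := MH_comb hf C' (a j) (fun j' hj' => (h2 j' hj').1)
  rcases h with ⟨q, x, h, rfl⟩ | ⟨he, rfl, c, c', rfl⟩
  · obtain ⟨ν, hν⟩ := uns_eq (dg_uns h x)
    rw [hν, hp] at hL
    exact hcs C' (by rintro rfl; exact h1 rfl) (a j) (fun j' hj' => (h2 j' hj').1) (LowRk.of_FF_un hg ν hL)
  · rw [sp_eq hb] at hL
    exact hfl j C' h1 h2 (LowRk.of_FF_pol hg _ (b j) _ (by simp) hL)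

lemma CSX {I : Type} {jI : I → Fin r} {AI : I → B × JJ n → ℕ} {M : ℕ} {φ : ℕ → ℕ} {Jη : Type} [Fintype Jη] {η : Jη → MvPolynomial (σ × JJ n) k}
    {bη : Jη → B × JJ n → ℕ} (hR : RegOut M φ (βJ (JJ n) β) mu (fun i => FF β (AI i) (f (jI i))) AI Jη η bη)
    (hf : ∀ i, MH β (f i) (a i)) (hb : ∀ l, a l (b l) ≠ 0) (hcs : CS s f a)
    (hfl : ∀ l (c : Fin r → k), c l ≠ 0 → (∀ j, c j ≠ 0 → a j = a l ∧ j ≤ l) → ¬ LowRk s (pol β (b l) (∑ j, C (c j) * f j)))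
    (hsort : ∀ i j, i ≤ j → tdeg (a i) ≤ tdeg (a j))
    (hI : ∀ i, psh Prod.fst (AI i) = a (jI i) ∧ ∃ l : Fin r, jI i ≤ l ∧ mu (AI i) = l + 1 ∧ ¬ NI a b l (jI i) (AI i))
    {l : Fin r} {P : Type} [Fintype P] {jj : P → Fin r} {AA : P → B × JJ n → ℕ} (hinj : ∀ p p', jj p = jj p' → AA p = AA p' → p = p')
    (hP : ∀ p, NI a b l (jj p) (AA p)) {K : ℕ} (hK : K ≤ φ (Fintype.card Jη)) (hK' : K ≤ s) :
    CS K (Sum.elim η (fun p => FF β (AA p) (f (jj p)))) (Sum.elim bη AA) := by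
  classical
  intro c hc A hA hL
  rw [Fintype.sum_sum_type] at hL
  simp only [Sum.elim_inl, Sum.elim_inr] at hL
  by_cases hz : ∀ p, c (Sum.inr p) = 0
  · simp only [hz, map_zero, zero_mul, Finset.sum_const_zero, add_zero] at hL
    refine hR.cs (fun j => c (Sum.inl j)) ?_ A (fun i hi => hA (Sum.inl i) hi) (hL.mono hK)
    rintro h0
    apply hc
    funext x
    rcases x with x | x
    · exact congrFun h0 x
    · exact hz x
  push Not at hz
  obtain ⟨p0, hp0⟩ := hz
  have hA0 : AA p0 = A := hA (Sum.inr p0) hp0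
  have hmA : mu A = l + 1 := hA0 ▸ NI_mu hb (hP p0)
  have hpA : psh Prod.fst A = a (jj p0) := hA0 ▸ NI_psh (hP p0)
  have key : ∀ e : Jη, ∃ j : Fin r, c (Sum.inl e) ≠ 0 → η e = FF β A (f j) ∧ a j = a (jj p0) ∧ j ≤ l ∧ j ≠ jj p0 := by
    intro e
    by_cases hce : c (Sum.inl e) = 0
    · exact ⟨jj p0, fun h => absurd hce h⟩
    have hbe : bη e = A := hA (Sum.inl e) hce
    rcases hR.prov e with ⟨i, h1, h2⟩ | ⟨i, h1, h2⟩
    · refine ⟨jI i, fun _ => ?_⟩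
      have hAi : AI i = A := h2 ▸ hbe
      obtain ⟨h3, l', h4, h5, h6⟩ := hI i
      have hl : l' = l := by rw [hAi, hmA] at h5; ext; omega
      subst hl
      refine ⟨by rw [h1, ← hAi], by rw [← h3, hAi, hpA], h4, ?_⟩
      intro h7
      apply h6
      rw [h7, hAi, ← hA0]
      exact hP p0
    · exfalso
      obtain ⟨h3, l', h4, h5, h6⟩ := hI i
      have hl : l' = l := by rw [hbe, hmA] at h2; rw [← h2] at h5; ext; omega
      subst hl
      have h7 := tdeg_lt h1
      rw [hbe, ← tdeg_psh Prod.fst A, hpA, NI_tdeg (hP p0), ← tdeg_psh Prod.fst (AI i), h3] at h7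
      have := hsort _ _ h4
      omega
  choose jc hjc using key
  set C' : Fin r → k := fun j => (∑ e, if jc e = j then c (Sum.inl e) else 0) + ∑ p, if jj p = j then c (Sum.inr p) else 0 with hC'
  have hcomb : ∑ e, C (c (Sum.inl e)) * η e + ∑ p, C (c (Sum.inr p)) * FF β (AA p) (f (jj p)) = FF β A (∑ j, C (C' j) * f j) := by
    rw [FF_sum]
    simp only [hC', map_add, map_sum, add_mul, Finset.sum_mul, Finset.sum_add_distrib]
    congr 1
    · rw [Finset.sum_comm]
      refine Finset.sum_congr rfl fun e _ => ?_
      rw [Finset.sum_eq_single (jc e)]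
      · rw [if_pos rfl]
        by_cases h0 : c (Sum.inl e) = 0
        · simp [h0]
        · rw [(hjc e h0).1]
      · intro j _ hj; rw [if_neg (Ne.symm hj)]; simp
      · simp
    · rw [Finset.sum_comm]
      refine Finset.sum_congr rfl fun e _ => ?_
      rw [Finset.sum_eq_single (jj e)]
      · rw [if_pos rfl]
        by_cases h0 : c (Sum.inr e) = 0
        · simp [h0]
        · rw [← hA (Sum.inr e) h0]; rfl
      · intro j _ hj; rw [if_neg (Ne.symm hj)]; simp
      · simp
  rw [hcomb] at hL
  rw [← hA0] at hL
  refine noLow hf hb hcs hfl (hP p0) C' ?_ ?_ (hL.mono hK')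
  · have h1 : ∑ e, (if jc e = jj p0 then c (Sum.inl e) else 0) = 0 := by
      refine Finset.sum_eq_zero fun e _ => ?_
      split_ifs with h
      · by_contra h0; exact (hjc e h0).2.2.2 h
      · rfl
    have h2 : ∑ p, (if jj p = jj p0 then c (Sum.inr p) else 0) = c (Sum.inr p0) := by
      rw [Finset.sum_eq_single p0]
      · simp
      · intro p _ hp
        split_ifs with h
        · by_contra h0
          exact hp (hinj p p0 h ((hA (Sum.inr p) h0).trans hA0.symm))
        · rfl
      · simp
    simp only [hC']
    rw [h1, h2, zero_add]; exact hp0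
  · intro j hj
    by_cases h1 : ∃ e, jc e = j ∧ c (Sum.inl e) ≠ 0
    · obtain ⟨e, rfl, h0⟩ := h1
      exact ⟨(hjc e h0).2.1, (hjc e h0).2.2.1⟩
    by_cases h2 : ∃ p, jj p = j ∧ c (Sum.inr p) ≠ 0
    · obtain ⟨p, rfl, h0⟩ := h2
      refine ⟨?_, NI_le (hP p)⟩
      rw [← NI_psh (hP p), ← hpA]
      congr 1
      exact hA (Sum.inr p) h0
    · exfalso
      apply hj
      push Not at h1 h2
      simp only [hC']
      rw [Finset.sum_eq_zero, Finset.sum_eq_zero, add_zero]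
      · intro p _; split_ifs with h
        · exact h2 p h
        · rfl
      · intro p _; split_ifs with h
        · exact h1 p h
        · rfl

def Br (k : Type u) [Field k] (e E n : ℕ) : Prop := ∀ (β β' : Fin E → Fin n → k) (s : Matrix (Fin n) (Fin n) k),
      s.det ≠ 0 → ∃ Y Z : Fin n → k, (∀ q, ∑ a, β q a * Y a ^ e = 0) ∧
        (∀ q, ∑ a, β' q a * Z a ^ e = 0) ∧ ∑ a, ∑ a', s a a' * (Y a * Z a' ^ (e - 1)) ≠ 0

variable (β f a b) in
def LV (D : ℕ) (l : Fin r) (Q : σ × JJ n → k) (Y Z : Fin (n l) → k) : Prop :=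
  (a l (b l) = 1 ∧ Z = 0 ∧ ∀ z ∈ Rho a b n D l, ∑ c, eval Q (FF β (dg a b l z.2 (Sum.inl c)) (f z.1)) * Y c = if z = (l, qz a b n l) then 1 else 0) ∨
  (2 ≤ a l (b l) ∧ (∀ z ∈ Rho a b n D l, ∑ c, eval Q (FF β (dg a b l z.2 (Sum.inl c)) (f z.1)) * Y c ^ (a l (b l)) = 0) ∧
    (∀ z ∈ Rho a b n D l, ∑ c, eval Q (FF β (dg a b l z.2 (Sum.inr c)) (f z.1)) * Z c ^ (a l (b l)) = 0) ∧
    ∑ c, ∑ c', eval Q (FF β (sp a b l c c') (f l)) * (Y c * Z c' ^ (a l (b l) - 1)) ≠ 0)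

lemma Lev (hb : ∀ l, a l (b l) ≠ 0) {D : ℕ} (hD : ∀ j, tdeg (a j) ≤ D) (l : Fin r) {E : ℕ} (h1 : (Rho a b n D l).card ≤ n l)
    (hE : (Rho a b n D l).card ≤ E) (h2 : 2 ≤ a l (b l) → Br k (a l (b l)) E (n l)) :
    ∃ m ≤ n l, ∃ (jj : Fin m × Fin m → Fin r) (AA : Fin m × Fin m → B × JJ n → ℕ), (∀ p, NI a b l (jj p) (AA p)) ∧
      (∀ p p', jj p = jj p' → AA p = AA p' → p = p') ∧ 
      ∀ Q, (Matrix.of fun x y => eval Q (FF β (AA (x, y)) (f (jj (x, y))))).det ≠ 0 → ∃ Y Z, LV β f a b D l Q Y Z := by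
  classical
  by_cases he : 2 ≤ a l (b l)
  · refine ⟨n l, le_rfl, fun _ => l, fun p => sp a b l p.1 p.2, fun p => Or.inr ⟨he, rfl, p.1, p.2, rfl⟩, ?_, ?_⟩
    · rintro p p' - h
      exact Prod.ext (sp_inj he h).1 (sp_inj he h).2
    · intro Q hdet
      obtain ⟨emb⟩ : Nonempty ((Rho a b n D l) ↪ Fin E) := Function.Embedding.nonempty_of_card_le (by simpa using hE)
      obtain ⟨Y, Z, h3, h4, h5⟩ := h2 he (Function.extend emb (fun z c => eval Q (FF β (dg a b l z.1.2 (Sum.inl c)) (f z.1.1))) 0)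
        (Function.extend emb (fun z c => eval Q (FF β (dg a b l z.1.2 (Sum.inr c)) (f z.1.1))) 0) _ hdet
      refine ⟨Y, Z, Or.inr ⟨he, ?_, ?_, h5⟩⟩
      · intro z hz
        have := h3 (emb ⟨z, hz⟩)
        rwa [emb.injective.extend_apply] at this
      · intro z hz
        have := h4 (emb ⟨z, hz⟩)
        rwa [emb.injective.extend_apply] at this
  · have he1 : a l (b l) = 1 := by have := hb l; omega
    set m := (Rho a b n D l).card with hm
    set ε := (Rho a b n D l).equivFin.symm
    have hmem : ∀ x, Rc a b l (ε x).1.1 (ε x).1.2 := fun x => (mem_Rho hD).mp (ε x).2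
    refine ⟨m, h1, fun p => (ε p.1).1.1, fun p => dg a b l (ε p.1).1.2 (Sum.inl (Fin.castLE h1 p.2)), 
      fun p => Or.inl ⟨_, _, hmem p.1, rfl⟩, ?_, ?_⟩
    · rintro ⟨x, y⟩ ⟨x', y'⟩ h3 h4
      obtain ⟨h5, h6⟩ := dg_inj hb (hmem x) (hmem x') h4
      refine Prod.ext ?_ ?_
      · exact ε.injective (Subtype.ext (Prod.ext h3 h5))
      · simpa using h6
    · intro Q hdet
      set Mt := (Matrix.of fun x y => eval Q (FF β (dg a b l (ε x).1.2 (Sum.inl (Fin.castLE h1 y))) (f (ε x).1.1))) with hMt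
      set z0 : Rho a b n D l := ⟨(l, qz a b n l), (mem_Rho hD).mpr (qz_Rc l)⟩
      set y := Mt⁻¹.mulVec (Pi.single (ε.symm z0) 1) with hy
      have hMy : Mt.mulVec y = Pi.single (ε.symm z0) 1 := by
        rw [hy, Matrix.mulVec_mulVec, Matrix.mul_nonsing_inv _ (isUnit_iff_ne_zero.mpr hdet), Matrix.one_mulVec]
      refine ⟨Function.extend (Fin.castLE h1) y 0, 0, Or.inl ⟨he1, rfl, ?_⟩⟩
      intro z hz
      have h3 := congrFun hMy (ε.symm ⟨z, hz⟩)
      simp only [Matrix.mulVec, dotProduct, hMt, Matrix.of_apply, Equiv.apply_symm_apply] at h3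
      have h4 : ∑ c, eval Q (FF β (dg a b l z.2 (Sum.inl c)) (f z.1)) * Function.extend (Fin.castLE h1) y 0 c = 
        ∑ x, eval Q (FF β (dg a b l z.2 (Sum.inl (Fin.castLE h1 x))) (f z.1)) * y x := by
        symm
        refine Finset.sum_of_injOn (Fin.castLE h1) (Fin.castLE_injective h1).injOn (by simp) ?_ ?_
        · intro c _ hc
          rw [Function.extend_apply' _ _ _ (by rintro ⟨x, rfl⟩; exact hc ⟨x, by simp, rfl⟩)]; simp
        · intro x _
          rw [(Fin.castLE_injective h1).extend_apply]
      rw [h4, h3, Pi.single_apply]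
      simp only [ε.symm.injective.eq_iff, z0, Subtype.mk.injEq]
end csx
end RatDense

namespace RatDense
universe u
section eestep
variable {k : Type u} [Field k] {σ : Type} [Fintype σ] {B : Type} [Fintype B] [DecidableEq B] {r : ℕ} {n : Fin r → ℕ}
variable {β : σ → B} {f : Fin r → MvPolynomial σ k} {a : Fin r → B → ℕ} {b : Fin r → B}
variable {A' : Type u} [CommRing A'] [Algebra k A']

def mon {P : Type} [Fintype P] (θ : P → A') (A : P → ℕ) : A' := ∏ p, θ p ^ A p

lemma mon_add {P : Type} [Fintype P] (θ : P → A') (A A2 : P → ℕ) : mon θ (A + A2) = mon θ A * mon θ A2 := by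
  simp only [mon, Pi.add_apply, pow_add, Finset.prod_mul_distrib]

lemma mon_single {P : Type} [Fintype P] [DecidableEq P] (θ : P → A') (p : P) (m : ℕ) : mon θ (Pi.single p m) = θ p ^ m := by
  rw [mon, Finset.prod_eq_single p]
  · simp
  · intro q _ hq; simp [hq]
  · simp

lemma mon_one {P : Type} [Fintype P] (θ : P → A') (A : P → ℕ) (h : ∀ p, A p ≠ 0 → θ p = 1) : mon θ A = 1 := by
  refine Finset.prod_eq_one fun p _ => ?_
  by_cases h0 : A p = 0
  · simp [h0]
  · simp [h p h0]

lemma mon_zero {P : Type} [Fintype P] (θ : P → A') (A : P → ℕ) (p : P) (h : A p ≠ 0) (h' : θ p = 0) : mon θ A = 0 := 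
  Finset.prod_eq_zero (Finset.mem_univ p) (by rw [h', zero_pow h])

lemma mon_congr {P : Type} [Fintype P] (θ θ' : P → A') (A : P → ℕ) (h : ∀ p, A p ≠ 0 → θ p = θ' p) : mon θ A = mon θ' A := by
  refine Finset.prod_congr rfl fun p _ => ?_
  by_cases h0 : A p = 0
  · simp [h0]
  · simp [h p h0]

variable (b) in
/-- substitution values -/
def th (Y Z : ∀ l, Fin (n l) → k) (t : k) (ξ y : Fin r → A') : B × JJ n → A'
  | (_, Sum.inl (Sum.inl i)) => ξ i
  | (_, Sum.inl (Sum.inr _)) => 1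
  | (b', Sum.inr ⟨l, Sum.inl c⟩) => if b' = b l then Y l c • y l else 0
  | (b', Sum.inr ⟨l, Sum.inr c⟩) => if b' = b l then algebraMap k A' (t * Z l c) else 0

variable (β b) in
noncomputable def Wt (Q : σ × JJ n → k) (Z : ∀ l, Fin (n l) → k) (t : k) : σ × (Fin r ⊕ Unit) → k
  | (i, Sum.inl j) => Q (i, Sum.inl (Sum.inl j))
  | (i, Sum.inr _) => Q (i, wl) + t * ∑ l, ∑ c, if β i = b l then Z l c * Q (i, vx l (Sum.inr c)) else 0

variable (β b) in
noncomputable def vt (Q : σ × JJ n → k) (Y : ∀ l, Fin (n l) → k) (l : Fin r) (i : σ) : k :=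
  ∑ c, if β i = b l then Y l c * Q (i, vx l (Sum.inl c)) else 0

lemma pt_eq (Q : σ × JJ n → k) (Y Z : ∀ l, Fin (n l) → k) (t : k) (ξ y : Fin r → A') :
    pt (Wt β b Q Z t) (vt β b Q Y) A' ξ y = fun i => ∑ ν, Q (i, ν) • th b Y Z t ξ y (β i, ν) := by
  funext i
  rw [Fintype.sum_sum_type, Fintype.sum_sum_type, Fintype.sum_sigma]
  simp only [pt, Wt, vt, th, Fintype.sum_sum_type, Finset.univ_unique, Finset.sum_singleton, Finset.sum_add_distrib]
  rw [map_add, add_assoc, add_assoc, add_assoc]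
  congr 1
  congr 1
  · simp [Algebra.smul_def]
  rw [add_comm]
  congr 1
  · refine Finset.sum_congr rfl fun l _ => ?_
    rw [Finset.sum_smul]
    refine Finset.sum_congr rfl fun c _ => ?_
    split_ifs
    · rw [smul_smul, mul_comm]
    · simp
  · rw [Finset.mul_sum, map_sum]
    refine Finset.sum_congr rfl fun l _ => ?_
    rw [Finset.mul_sum, map_sum]
    refine Finset.sum_congr rfl fun c _ => ?_
    split_ifs
    · rw [Algebra.smul_def, ← map_mul]; congr 1; ring
    · simp

lemma level_eval (hf : ∀ i, MH β (f i) (a i)) (hb : ∀ l, a l (b l) ≠ 0) {D : ℕ} (hD : ∀ j, tdeg (a j) ≤ D) (Q : σ × JJ n → k)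
    (hQ : ∀ (j l : Fin r) (A : B × JJ n → ℕ), j ≤ l → mu A = l + 1 → psh Prod.fst A = a j → alw b A → ¬ NI a b l j A → eval Q (FF β A (f j)) = 0)
    (Y Z : ∀ l, Fin (n l) → k) (hLV : ∀ l, LV β f a b D l Q (Y l) (Z l)) (t : k) (ht : t ≠ 0) (l : Fin r) :
    ∃ c : k, c ≠ 0 ∧ ∀ (A' : Type u) [CommRing A'] [Algebra k A'] (ξ y : Fin r → A') (j : Fin r), j ≤ l → 
     ∑ A ∈ (Box n D).filter (fun A => mu A = l + 1), eval Q (FF β A (f j)) • mon (th b Y Z t ξ y) A = if j = l then c • y l else 0 := by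
  classical
  have hz : ∀ (A' : Type u) [CommRing A'] [Algebra k A'] (ξ y : Fin r → A') (j : Fin r), j ≤ l → ∀ A : B × JJ n → ℕ, mu A = l + 1 → ¬ NI a b l j A → 
      eval Q (FF β A (f j)) • mon (th b Y Z t ξ y) A = 0 := by
    intro A' _ _ ξ y j hj A hA hN
    by_cases h1 : FF β A (f j) = 0
    · simp [h1]
    by_cases h2 : alw b A
    · rw [hQ j l A hj hA (FF_psh (hf j) h1) h2 hN, zero_smul]
    · unfold alw at h2
      push Not at h2
      obtain ⟨c, x, h3, h4⟩ := h2
      rw [mon_zero _ _ _ h3, smul_zero]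
      obtain ⟨l', x | x⟩ := x <;> simp only [th] <;> rw [if_neg h4]
  have hwl : ∀ (A' : Type u) [CommRing A'] [Algebra k A'] (ξ y : Fin r → A') (g : B → ℕ), mon (th b Y Z t ξ y) (psh (fun c => (c, (wl : JJ n))) g) = 1 := by
    intro A' _ _ ξ y g
    refine mon_one _ _ ?_
    rintro ⟨c, v⟩ hp
    have : v = wl := by
      by_contra hne
      refine hp (psh_notMem _ _ _ ?_)
      intro b' _ h
      simp only [Prod.mk.injEq] at h
      exact hne h.2.symm
    subst this; rfl
  have hdg : ∀ (A' : Type u) [CommRing A'] [Algebra k A'] (ξ y : Fin r → A') (q : B × JJ n → ℕ) (j : Fin r),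
     ∑ x, eval Q (FF β (dg a b l q x) (f j)) • mon (th b Y Z t ξ y) (dg a b l q x) = 
     (∑ c, eval Q (FF β (dg a b l q (Sum.inl c)) (f j)) * Y l c ^ (a l (b l))) • (mon (th b Y Z t ξ y) q * y l ^ (a l (b l))) +
     (∑ c, eval Q (FF β (dg a b l q (Sum.inr c)) (f j)) * Z l c ^ (a l (b l))) • (mon (th b Y Z t ξ y) q * algebraMap k A' (t ^ (a l (b l)))) := by
    intro A' _ _ ξ y q j
    rw [Fintype.sum_sum_type, Finset.sum_smul, Finset.sum_smul]
    congr 1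
    · refine Finset.sum_congr rfl fun c _ => ?_
      conv_lhs => rw [dg, mon_add, mon_single]
      simp only [th, if_true, smul_pow, mul_smul_comm, smul_smul]
      rfl
    · refine Finset.sum_congr rfl fun c _ => ?_
      conv_lhs => rw [dg, mon_add, mon_single]
      simp only [th, if_true, Algebra.smul_def, map_mul, map_pow, mul_pow]
      simp only [dg]
      ring
  rcases hLV l with ⟨h1, h2, h3⟩ | ⟨h1, h2, h3, h4⟩
  · refine ⟨1, one_ne_zero, ?_⟩
    intro A' _ _ ξ y j hj
    rw [level_sum hb hD l j _ (hz A' ξ y j hj), if_neg (by omega), add_zero]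
    have : ∀ z ∈ (Rho a b n D l).filter (fun z => z.1 = j), ∑ x, eval Q (FF β (dg a b l z.2 x) (f j)) • mon (th b Y Z t ξ y) (dg a b l z.2 x) = 
       if z = (l, qz a b n l) then y l else 0 := by
      intro z hz
      rw [Finset.mem_filter] at hz
      obtain ⟨hz, rfl⟩ := hz
      rw [hdg]
      simp only [h1, pow_one, h2, Pi.zero_apply, mul_zero, Finset.sum_const_zero, zero_smul, add_zero]
      rw [h3 z hz]
      split_ifs with h
      · rw [h, one_smul]
        simp only [qz]
        rw [hwl, one_mul]
      · simp
    rw [Finset.sum_congr rfl this, Finset.sum_ite_eq']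
    simp only [Finset.mem_filter, mem_Rho hD, one_smul]
    by_cases h : j = l
    · subst h; rw [if_pos ⟨qz_Rc j, rfl⟩, if_pos rfl]
    · rw [if_neg (fun hh => h hh.2.symm), if_neg h]
  · refine ⟨_, mul_ne_zero (pow_ne_zero (a l (b l) - 1) ht) h4, ?_⟩
    intro A' _ _ ξ y j hj
    rw [level_sum hb hD l j _ (hz A' ξ y j hj), Finset.sum_eq_zero, zero_add]
    · simp only [h1, true_and]
      by_cases h : j = l
      · subst h
        rw [if_pos rfl, if_pos rfl, Finset.mul_sum, Finset.sum_smul]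
        refine Finset.sum_congr rfl fun c _ => ?_
        rw [Finset.mul_sum, Finset.sum_smul]
        refine Finset.sum_congr rfl fun c' _ => ?_
        conv_lhs => rw [sp, mon_add, mon_add, mon_single, mon_single, hwl]
        simp only [th, if_true, Algebra.smul_def, map_mul, map_pow, mul_pow, sp]
        ring
      · rw [if_neg h, if_neg h]
    · intro z hz
      rw [Finset.mem_filter] at hz
      obtain ⟨hz, rfl⟩ := hz
      rw [hdg, h2 z hz, h3 z hz]; simp

lemma ee_of_point (hf : ∀ i, MH β (f i) (a i)) (hb : ∀ l, a l (b l) ≠ 0) {D : ℕ} (hD : ∀ j, tdeg (a j) ≤ D) (Q : σ × JJ n → k)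
    (hQ : ∀ (j l : Fin r) (A : B × JJ n → ℕ), j ≤ l → mu A = l + 1 → psh Prod.fst A = a j → alw b A → ¬ NI a b l j A → eval Q (FF β A (f j)) = 0)
    (Y Z : ∀ l, Fin (n l) → k) (hLV : ∀ l, LV β f a b D l Q (Y l) (Z l)) (t : k) (ht : t ≠ 0) :
    ∃ (c : Fin r → k), (∀ l, c l ≠ 0) ∧ ∀ (A : Type u) [CommRing A] [Algebra k A] (ξ y : Fin r → A) (j : Fin r), 
      aeval (pt (Wt β b Q Z t) (vt β b Q Y) A ξ y) (f j) = 
       aeval (pt (Wt β b Q Z t) (vt β b Q Y) A ξ (fun l => if l < j then y l else 0)) (f j) + c j • y j := by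
  classical
  choose c hc hlev using level_eval hf hb hD Q hQ Y Z hLV t ht
  refine ⟨c, hc, ?_⟩
  intro A' _ _ ξ y j
  have hS : ∀ A, A ∉ Box n D → FF β A (f j) = 0 := by
    intro A hA
    by_contra h
    exact hA (mem_Box (by rw [FF_psh (hf j) h]; exact hD j))
  have hmu : ∀ A : B × JJ n → ℕ, mu A ≤ r := by
    intro A
    rw [mu_le_iff]
    rintro ⟨c, v | ⟨l, x⟩⟩ _
    · simp [idx]
    · simp only [idx]; exact l.2
  have hsplit : ∀ y : Fin r → A', aeval (pt (Wt β b Q Z t) (vt β b Q Y) A' ξ y) (f j) = 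
      ∑ A ∈ (Box n D).filter (fun A => mu A ≤ j), eval Q (FF β A (f j)) • mon (th b Y Z t ξ y) A + c j • y j := by
    intro y
    rw [pt_eq, eval_FF β _ Q (f j) (Box n D) hS, ← Finset.sum_filter_add_sum_filter_not _ (fun A => mu A ≤ j)]
    congr 1
    have : (Box n D).filter (fun A : B × JJ n → ℕ => ¬ mu A ≤ j) = (Finset.univ.filter (fun l : Fin r => j ≤ l)).biUnion 
        (fun l => (Box n D).filter (fun A => mu A = l + 1)) := by
      ext A
      simp only [Finset.mem_filter, Finset.mem_biUnion, Finset.mem_univ, true_and]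
      constructor
      · rintro ⟨h1, h2⟩
        have := hmu A
        exact ⟨⟨mu A - 1, by omega⟩, by rw [Fin.le_def]; simp; omega, h1, by simp; omega⟩
      · rintro ⟨l, h1, h2, h3⟩
        rw [Fin.le_def] at h1
        exact ⟨h2, by omega⟩
    rw [this, Finset.sum_biUnion]
    · rw [Finset.sum_congr rfl (g := fun l => if j = l then c l • y l else 0)]
      · rw [Finset.sum_ite_eq]; simp
      · intro l hl
        exact hlev l A' ξ y j (Finset.mem_filter.mp hl).2
    · intro l _ l' _ hne
      rw [Function.onFun, Finset.disjoint_left]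
      intro A h1 h2
      rw [Finset.mem_filter] at h1 h2
      apply hne; ext; omega
  rw [hsplit y, hsplit]
  simp only [lt_irrefl, if_false, smul_zero, add_zero]
  congr 1
  refine Finset.sum_congr rfl fun A hA => ?_
  congr 1
  refine mon_congr _ _ _ ?_
  rintro ⟨b', v⟩ hp
  have h1 := (le_mu hp).trans (Finset.mem_filter.mp hA).2
  rcases v with (v | v) | ⟨l, x | x⟩
  · rfl
  · rfl
  · simp only [idx] at h1
    simp only [th]
    rw [if_pos (show l < j by rw [Fin.lt_def]; omega)]
  · rfl
end eestep
end RatDense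

namespace RatDense
universe u
section core
variable {k : Type u} [Field k] {σ : Type} [Fintype σ] {B : Type} [Fintype B] [DecidableEq B] {r : ℕ} {n : Fin r → ℕ}
variable {β : σ → B} {f : Fin r → MvPolynomial σ k} {a : Fin r → B → ℕ} {b : Fin r → B}

lemma exists_of_weight {p : B} (β : σ → B) (m : σ →₀ ℕ) (h : Finsupp.weight (wt β) m p ≠ 0) : ∃ i, m i ≠ 0 ∧ β i = p := by
  by_contra hc
  push Not at hc
  apply h
  rw [Finsupp.weight_apply, Finsupp.sum, Finset.sum_apply]
  refine Finset.sum_eq_zero fun i hi => ?_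
  rw [wt_eq]
  have := hc i (Finsupp.mem_support_iff.mp hi)
  simp [this, Ne.symm this]

lemma Ht_notMem {Jη : Type} {η : Jη → MvPolynomial (σ × JJ n) k} {bη : Jη → B × JJ n → ℕ} (hη : ∀ j, MH (βJ (JJ n) β) (η j) (bη j))
    (hmu : ∀ j, mu (bη j) ≠ 0) (H : MvPolynomial (σ × (Fin r ⊕ Unit)) k) (hH : H ≠ 0) :
    rename (Prod.map id Sum.inl : σ × (Fin r ⊕ Unit) → σ × JJ n) H ∉ rad η := by
  classical
  intro hmem
  set x : σ × JJ n → MvPolynomial (σ × (Fin r ⊕ Unit)) k := fun p => match p with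
    | (i, Sum.inl j) => X (i, j)
    | (i, Sum.inr _) => 0 with hx
  have := aeval_rad_zero (f := η) (x := x) ?_ hmem
  · rw [aeval_rename] at this
    have h2 : x ∘ (Prod.map id Sum.inl : σ × (Fin r ⊕ Unit) → σ × JJ n) = X := by
      funext p; rfl
    rw [h2, aeval_X_left_apply] at this
    exact hH this
  · intro j
    rw [(η j).as_sum, map_sum]
    refine Finset.sum_eq_zero fun m hm => ?_
    rw [aeval_monomial]
    have hw := hη j (mem_support_iff.mp hm)
    obtain ⟨m', hm'⟩ : ∃ m', mu (bη j) = m' + 1 := ⟨mu (bη j) - 1, by have := hmu j; omega⟩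
    obtain ⟨p, hp, hpi⟩ := exists_mu hm'
    rw [← hw] at hp
    obtain ⟨⟨i, v⟩, hi, hiv⟩ := exists_of_weight (βJ (JJ n) β) m hp
    rw [Finsupp.prod, Finset.prod_eq_zero (Finsupp.mem_support_iff.mpr hi), mul_zero]
    have hv : v = p.2 := by rw [← hiv]; rfl
    rcases v with v | v
    · rw [← hv] at hpi; simp [idx] at hpi
    · simp only [hx]; exact zero_pow hi

lemma exists_t [Infinite k] (Q : σ × JJ n → k) (Z : ∀ l, Fin (n l) → k) (H : MvPolynomial (σ × (Fin r ⊕ Unit)) k)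
    (h : eval Q (rename (Prod.map id Sum.inl : σ × (Fin r ⊕ Unit) → σ × JJ n) H) ≠ 0) : ∃ t : k, t ≠ 0 ∧ eval (Wt β b Q Z t) H ≠ 0 := by
  classical
  set w : σ × (Fin r ⊕ Unit) → Polynomial k := fun p => match p with
    | (i, Sum.inl j) => Polynomial.C (Q (i, Sum.inl (Sum.inl j)))
    | (i, Sum.inr _) => Polynomial.C (Q (i, wl)) + Polynomial.X * Polynomial.C (∑ l, ∑ c, if β i = b l then Z l c * Q (i, vx l (Sum.inr c)) else 0) with hw
  have hev : ∀ t, Polynomial.eval t (aeval w H) = eval (Wt β b Q Z t) H := by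
    intro t
    have : (Polynomial.aeval t).comp (aeval w) = aeval (R := k) (Wt β b Q Z t) := by
      apply MvPolynomial.algHom_ext
      rintro ⟨i, j | j⟩
      · simp [hw, Wt]
      · simp only [AlgHom.comp_apply, MvPolynomial.aeval_X, hw, Wt, map_add, map_mul, Polynomial.aeval_C, Polynomial.aeval_X, Algebra.algebraMap_self, RingHom.id_apply]
    have h2 := DFunLike.congr_fun this H
    simpa [Polynomial.coe_aeval_eq_eval, MvPolynomial.aeval_eq_eval] using h2
  have h0 : eval (Wt β b Q Z 0) H ≠ 0 := by
    rw [eval_rename] at h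
    convert h using 2
    congr 1
    funext p
    rcases p with ⟨i, j | j⟩
    · rfl
    · simp [Wt]
  have hp : (aeval w H : Polynomial k) * Polynomial.X ≠ 0 := by
    refine mul_ne_zero ?_ Polynomial.X_ne_zero
    intro h1
    apply h0
    rw [← hev, h1, Polynomial.eval_zero]
  by_contra hc
  push Not at hc
  apply hp
  apply Polynomial.funext
  intro t
  rw [Polynomial.eval_mul, Polynomial.eval_X, Polynomial.eval_zero, hev]
  by_cases ht : t = 0
  · rw [ht, mul_zero]
  · rw [hc t ht, zero_mul]

lemma core [Infinite k] {D s : ℕ} {I : Type} {jI : I → Fin r} {AI : I → B × JJ n → ℕ} {M : ℕ} {φ : ℕ → ℕ} {Jη : Type} [Fintype Jη] {η : Jη → MvPolynomial (σ × JJ n) k}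
    {bη : Jη → B × JJ n → ℕ} (hR : RegOut M φ (βJ (JJ n) β) mu (fun i => FF β (AI i) (f (jI i))) AI Jη η bη)
    (hf : ∀ i, MH β (f i) (a i)) (hb : ∀ l, a l (b l) ≠ 0) (hcs : CS s f a)
    (hfl : ∀ l (c : Fin r → k), c l ≠ 0 → (∀ j, c j ≠ 0 → a j = a l ∧ j ≤ l) → ¬ LowRk s (pol β (b l) (∑ j, C (c j) * f j)))
    (hsort : ∀ i j, i ≤ j → tdeg (a i) ≤ tdeg (a j)) (hD : ∀ j, tdeg (a j) ≤ D)
    (hI : ∀ i, psh Prod.fst (AI i) = a (jI i) ∧ ∃ l : Fin r, jI i ≤ l ∧ mu (AI i) = l + 1 ∧ ¬ NI a b l (jI i) (AI i))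
    (hI0 : ∀ (j l : Fin r) (A : B × JJ n → ℕ), j ≤ l → mu A = l + 1 → psh Prod.fst A = a j → alw b A → ¬ NI a b l j A → ∃ i, jI i = j ∧ AI i = A)
    (hgood : Good η) (E : Fin r → ℕ) (h1 : ∀ l, (Rho a b n D l).card ≤ n l) (hE : ∀ l, (Rho a b n D l).card ≤ E l)
    (h2 : ∀ l, 2 ≤ a l (b l) → Br k (a l (b l)) (E l) (n l)) (nmax : ℕ) (hn : ∀ l, n l ≤ nmax)
    (hφ : (Fintype.card Jη + nmax * nmax) * 2 ^ D ≤ φ (Fintype.card Jη)) (hs : (M + nmax * nmax) * 2 ^ D ≤ s) : EE f := by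
  classical
  intro H hH
  have hmu : ∀ j, mu (bη j) ≠ 0 := by
    intro j
    rcases hR.prov j with ⟨i, -, e⟩ | ⟨i, -, e⟩
    · obtain ⟨-, l, -, h, -⟩ := hI i
      rw [e]; omega
    · obtain ⟨-, l, -, h, -⟩ := hI i
      omega
  have htb : ∀ j, tdeg (bη j) ≤ D := by
    intro j
    have hAI : ∀ i, tdeg (AI i) ≤ D := fun i => by
      rw [← tdeg_psh Prod.fst, (hI i).1]; exact hD _
    rcases hR.prov j with ⟨i, -, e⟩ | ⟨i, e, -⟩
    · rw [e]; exact hAI i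
    · exact (tdeg_mono e.le).trans (hAI i)
  choose m hm jj AA hNI hinj hLv using fun l => Lev (β := β) (f := f) hb hD l (h1 l) (hE l) (h2 l)
  have hdet : ∀ l, (Matrix.of fun x y => FF β (AA l (x, y)) (f (jj l (x, y)))).det ∉ rad η := by
    intro l
    have hml : m l * m l ≤ nmax * nmax := Nat.mul_le_mul ((hm l).trans (hn l)) ((hm l).trans (hn l))
    refine det_not_mem (A := fun x y => AA l (x, y)) (d := D) hR.mh (fun x y => FF_MH _ _ _) hR.ne ?_ htb ?_ hgood ?_
    · intro x y h0
      have h := NI_mu hb (hNI l (x, y))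
      rw [show AA l (x, y) = 0 from h0] at h
      have : mu (0 : B × JJ n → ℕ) ≤ 0 := mu_le_iff.mpr (by simp)
      omega
    · intro x y
      rw [← tdeg_psh Prod.fst, NI_psh (hNI l (x, y))]; exact hD _
    · exact CSX hR hf hb hcs hfl hsort hI (hinj l) (hNI l) ((Nat.mul_le_mul_right _ (Nat.add_le_add_left hml _)).trans hφ)
        ((Nat.mul_le_mul_right _ (Nat.add_le_add hR.card hml)).trans hs)
  have hHt := Ht_notMem hR.mh hmu H hH
  have hprime := hgood.prime
  have hprod : (∏ l, (Matrix.of fun x y => FF β (AA l (x, y)) (f (jj l (x, y)))).det) ∉ rad η := by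
    intro h
    obtain ⟨l, -, hl⟩ := (hprime.prod_mem_iff).mp h
    exact hdet l hl
  obtain ⟨Q, hQ0, hQ1, -⟩ := hgood.dense _ (fun h => (hprime.mem_or_mem h).elim hHt hprod)
  rw [map_mul, map_prod] at hQ1
  have hQH := left_ne_zero_of_mul hQ1
  have hQd : ∀ l, (Matrix.of fun x y => eval Q (FF β (AA l (x, y)) (f (jj l (x, y))))).det ≠ 0 := by
    intro l
    have := Finset.prod_ne_zero_iff.mp (right_ne_zero_of_mul hQ1) l (Finset.mem_univ l)
    rw [RingHom.map_det] at this
    exact this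
  choose Y Z hLV using fun l => hLv l Q (hQd l)
  have hspan : ∀ g ∈ Ideal.span (Set.range η), eval Q g = 0 := by
    intro g hg
    have : Ideal.span (Set.range η) ≤ RingHom.ker (eval Q) := by
      rw [Ideal.span_le]; rintro _ ⟨j, rfl⟩; exact hQ0 j
    exact this hg
  obtain ⟨t, ht, htH⟩ := exists_t (β := β) (b := b) Q Z H hQH
  obtain ⟨c, hc, hid⟩ := ee_of_point hf hb hD Q (fun j l A h1 h2 h3 h4 h5 => by
    obtain ⟨i, rfl, rfl⟩ := hI0 j l A h1 h2 h3 h4 h5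
    exact hspan _ (hR.mem i)) Y Z hLV t ht
  exact ⟨_, htH, _, c, hc, hid⟩
end core
end RatDense

namespace RatDense
universe u
section main
variable {k : Type u} [Field k] 

def Th (k : Type u) [Field k] (D ν t : ℕ) : Prop := ∀ R : ℕ, ∃ K : ℕ, ∀ (σ B B₀ : Type) [Fintype σ] [Fintype B] [Fintype B₀] (β : σ → B) (κ : B → B₀)
    (T : Finset (B₀ → ℕ)) (ι : Type) [Fintype ι] (f : ι → MvPolynomial σ k) (a : ι → B → ℕ), Fintype.card B ≤ R → Fintype.card ι ≤ R → T.card ≤ t →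
    (∀ i, MH β (f i) (a i)) → (∀ i, a i ≠ 0) → (∀ i, tdeg (a i) ≤ D) → (∀ i, tdeg (a i) = D → nu (a i) ≤ ν) → 
    (∀ i, tdeg (a i) = D → nu (a i) = ν → (∀ x y, a i x ≠ 0 → a i y ≠ 0 → κ x = κ y → x = y) ∧ psh κ (a i) ∈ T) → 
    CS K f a → Good f

lemma CS.reindex {σ B ι ι' : Type} [Fintype ι] [Fintype ι'] {K : ℕ} {f : ι → MvPolynomial σ k} {a : ι → B → ℕ} (h : CS K f a) (e : ι' ≃ ι) :
    CS K (f ∘ e) (a ∘ e) := by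
  intro c hc A hA hL
  refine h (c ∘ e.symm) ?_ A ?_ ?_
  · intro h0
    apply hc
    funext i
    simpa using congrFun h0 (e i)
  · intro i hi
    have := hA (e.symm i) hi
    simpa using this
  · rw [← e.sum_comp]
    simpa using hL

lemma exists_nn (hk : IsBrauerField k) (D : ℕ) (E : ℕ → ℕ) : ∃ nn : ℕ → ℕ, ∀ l, E (∑ i ∈ Finset.range l, nn i) ≤ nn l ∧ 
    ∀ e, 2 ≤ e → e ≤ D → Br k e (E (∑ i ∈ Finset.range l, nn i)) (nn l) := by
  have hG : ∀ S, ∃ g, E S ≤ g ∧ ∀ e, 2 ≤ e → e ≤ D → Br k e (E S) g := by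
    intro S
    have : ∀ e, ∃ n₁, 2 ≤ e → ∀ n, n₁ ≤ n → Br k e (E S) n := by
      intro e
      by_cases he : 2 ≤ e
      · obtain ⟨n₁, h⟩ := br2 hk e he (E S)
        exact ⟨n₁, fun _ => h⟩
      · exact ⟨0, fun h => absurd h he⟩
    choose n₁ hn₁ using this
    refine ⟨E S + ∑ y ∈ Finset.range (D + 1), n₁ y, by omega, fun e he heD => hn₁ e he _ ?_⟩
    exact (le_sum_range n₁ heD).trans (by omega)
  choose G hG1 hG2 using hG
  set S : ℕ → ℕ := fun l => Nat.rec 0 (fun _ s => s + G s) l with hS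
  have hsum : ∀ l, ∑ i ∈ Finset.range l, G (S i) = S l := by
    intro l
    induction l with
    | zero => simp [hS]
    | succ l ih => rw [Finset.sum_range_succ, ih]
  refine ⟨fun l => G (S l), fun l => ?_⟩
  rw [hsum]
  exact ⟨hG1 _, hG2 _⟩

theorem main_step [Infinite k] (hk : IsBrauerField k) {d ν t : ℕ} (hT : TH k d) (h : Th k (d + 1) ν t) : Th k (d + 1) ν (t + 1) := by
  classical
  intro R
  set D := d + 1 with hDdef
  obtain ⟨nn, hnn⟩ := exists_nn hk D (fun S => R * ((D + 1) ^ (R + 1 + 2 * S)) ^ R)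
  set nmax := ∑ i ∈ Finset.range R, nn i with hnmax
  set RI := R * ((D + 1) ^ (R + 1 + 2 * nmax)) ^ R
  set JB := R + 1 + 2 * nmax
  choose Cθ hΘ using h
  set φ : ℕ → ℕ := fun x => Cθ (R * JB + x) + (x + nmax * nmax) * 2 ^ D with hφ
  obtain ⟨M, hM⟩ := reg (k := k) D RI φ
  set s := (M + nmax * nmax) * 2 ^ D with hs
  obtain ⟨s', hs'⟩ := flag hk hT R s
  refine ⟨s' + s + Cθ R, ?_⟩
  intro σ B B₀ _ _ _ β κ T ι _ f₀ a₀ hB hι hTc hf₀ ha₀ hD₀ hν₀ htop₀ hcs₀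
  rcases T.eq_empty_or_nonempty with hTe | ⟨τ, hτ⟩
  · exact hΘ R σ B B₀ β κ T ι f₀ a₀ hB hι (by simp [hTe]) hf₀ ha₀ hD₀ hν₀ htop₀ (hcs₀.mono (by omega))
  set e := (Fintype.equivFin ι).symm
  set r := Fintype.card ι with hr
  set key : (B → ℕ) → ℕ := fun a => 2 * tdeg a + if tdeg a = D ∧ nu a = ν ∧ psh κ a = τ then 1 else 0 with hkey
  have hcs1 := hcs₀.reindex e
  obtain ⟨f, a, b, hf, hspan, hCS, hai, hsk, hb, hfl⟩ := hs' σ B β key r (f₀ ∘ e) (a₀ ∘ e) hB hι (fun i => hf₀ _) (fun i => ha₀ _) (fun i => hD₀ _)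
    (hcs1.mono (by omega))
  have hcs : CS s f a := hCS s (hcs1.mono (by omega))
  have ha : ∀ j, a j ≠ 0 := fun j => by obtain ⟨i, hi⟩ := hai j; rw [hi]; exact ha₀ _
  have hD : ∀ j, tdeg (a j) ≤ D := fun j => by obtain ⟨i, hi⟩ := hai j; rw [hi]; exact hD₀ _
  have hν : ∀ j, tdeg (a j) = D → nu (a j) ≤ ν := fun j => by obtain ⟨i, hi⟩ := hai j; rw [hi]; exact hν₀ _
  have htop : ∀ j, tdeg (a j) = D → nu (a j) = ν → (∀ x y, a j x ≠ 0 → a j y ≠ 0 → κ x = κ y → x = y) ∧ psh κ (a j) ∈ T := 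
    fun j => by obtain ⟨i, hi⟩ := hai j; rw [hi]; exact htop₀ _
  have hsort : ∀ i j, i ≤ j → tdeg (a i) ≤ tdeg (a j) := by
    intro i j hij
    have := hsk i j hij
    simp only [hkey] at this
    split_ifs at this <;> omega
  have htopl : ∀ j l, j ≤ l → (tdeg (a j) = D ∧ nu (a j) = ν ∧ psh κ (a j) = τ) → (tdeg (a l) = D ∧ nu (a l) = ν ∧ psh κ (a l) = τ) := by
    intro j l hjl hj
    have := hsk j l hjl
    simp only [hkey] at this
    rw [if_pos hj] at this
    by_contra hl
    rw [if_neg hl] at this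
    have := hD l
    omega
  set n : Fin r → ℕ := fun i => nn i with hn
  have hsumle : ∑ i ∈ Finset.range r, nn i ≤ nmax := Finset.sum_le_sum_of_subset (Finset.range_mono hι)
  have hnle : ∀ l, n l ≤ nmax := by
    intro l
    refine le_trans ?_ hsumle
    exact Finset.single_le_sum (f := nn) (fun _ _ => Nat.zero_le _) (Finset.mem_range.mpr l.2)
  set E : Fin r → ℕ := fun l => R * ((D + 1) ^ (R + 1 + 2 * ∑ i ∈ Finset.range l, nn i)) ^ R with hE
  have hRhoE : ∀ l, (Rho a b n D l).card ≤ E l := by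
    intro l
    refine (Rho_card nn D l).trans ?_
    simp only [hE]
    refine Nat.mul_le_mul hι ?_
    refine (Nat.pow_le_pow_left (Nat.pow_le_pow_right (Nat.succ_pos _) ?_) _).trans (Nat.pow_le_pow_right (Nat.pow_pos (Nat.succ_pos _)) hB)
    omega
  set Imp : Fin r × (B × JJ n → ℕ) → Prop := fun p => psh Prod.fst p.2 = a p.1 ∧ alw b p.2 ∧ ∃ l : Fin r, p.1 ≤ l ∧ mu p.2 = l + 1 ∧ ¬ NI a b l p.1 p.2 with hImp
  set IS : Finset (Fin r × (B × JJ n → ℕ)) := (Finset.univ ×ˢ Box n D).filter Imp with hIS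
  have hI : ∀ i : IS, Imp i.1 := fun i => (Finset.mem_filter.mp i.2).2
  have hIc : Fintype.card IS ≤ RI := by
    rw [Fintype.card_coe]
    refine (Finset.card_filter_le _ _).trans ?_
    rw [Finset.card_product, Finset.card_univ, Fintype.card_fin]
    refine Nat.mul_le_mul hι ?_
    rw [Box_card nn D]
    refine (Nat.pow_le_pow_left (Nat.pow_le_pow_right (Nat.succ_pos _) ?_) _).trans (Nat.pow_le_pow_right (Nat.pow_pos (Nat.succ_pos _)) hB)
    omega
  have hmu0 : mu (0 : B × JJ n → ℕ) = 0 := Nat.le_zero.mp (mu_le_iff.mpr (by simp))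
  obtain ⟨Jη, _, η, bη, hR⟩ := hM (σ × JJ n) (B × JJ n) (βJ (JJ n) β) mu mu_add IS (fun i => FF β i.1.2 (f i.1.1)) (fun i => i.1.2) hIc
    (fun i => FF_MH _ _ _) (fun i h0 => by
      obtain ⟨-, -, l, -, hl, -⟩ := hI i
      rw [h0, hmu0] at hl; omega) (fun i => by
      rw [← tdeg_psh Prod.fst, (hI i).1]; exact hD _)
  have hgood : Good η := by
    refine hΘ (R * JB + Fintype.card Jη) (σ × JJ n) (B × JJ n) B₀ (βJ (JJ n) β) (κ ∘ Prod.fst) (T.erase τ) Jη η bη ?_ (by omega) ?_ hR.mh hR.ne ?_ ?_ ?_ (hR.cs.mono ?_)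
    · rw [Fintype.card_prod, JJ_card nn]
      have : Fintype.card B * (r + 1 + 2 * ∑ i ∈ Finset.range r, nn i) ≤ R * JB := Nat.mul_le_mul hB (by omega)
      omega
    · rw [Finset.card_erase_of_mem hτ]; omega
    · intro j
      rcases hR.prov j with ⟨i, -, h2⟩ | ⟨i, h1, -⟩
      · rw [h2, ← tdeg_psh Prod.fst, (hI i).1]; exact hD _
      · refine (tdeg_mono h1.le).trans ?_
        rw [← tdeg_psh Prod.fst, (hI i).1]; exact hD _
    · intro j hj
      rcases hR.prov j with ⟨i, -, h2⟩ | ⟨i, h1, -⟩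
      · rw [h2]; rw [h2] at hj
        refine (nu_psh Prod.fst _).1.trans ?_
        rw [← tdeg_psh Prod.fst] at hj
        rw [(hI i).1] at hj ⊢
        exact hν _ hj
      · have := tdeg_lt h1
        rw [← tdeg_psh Prod.fst i.1.2, (hI i).1] at this
        have := hD i.1.1
        omega
    · intro j hj hjν
      rcases hR.prov j with ⟨i, -, h2⟩ | ⟨i, h1, -⟩
      · rw [h2] at hj hjν ⊢
        obtain ⟨⟨j', A⟩, hi⟩ := i
        obtain ⟨hp, hal, l, hjl, hml, hNI⟩ := hI ⟨⟨j', A⟩, hi⟩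
        simp only at hj hjν hp hal hjl hml hNI ⊢
        have hpt : tdeg (a j') = D := by rw [← hp, tdeg_psh]; exact hj
        have hn1 := nu_psh Prod.fst A
        rw [hp] at hn1
        have hn2 := hν j' hpt
        have hnj : nu (a j') = ν := by omega
        have hinj := hn1.2 (by omega)
        obtain ⟨hκ, hκT⟩ := htop j' hpt hnj
        have hpk : psh (κ ∘ Prod.fst) A = psh κ (a j') := by rw [← hp, psh_psh]
        have hsupp : ∀ x, A x ≠ 0 → a j' x.1 ≠ 0 := by
          intro x hx
          have := le_psh Prod.fst A x
          rw [hp] at this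
          omega
        refine ⟨?_, ?_⟩
        · intro x y hx hy hxy
          exact hinj x y hx hy (hκ _ _ (hsupp x hx) (hsupp y hy) hxy)
        · rw [hpk, Finset.mem_erase]
          refine ⟨?_, hκT⟩
          intro hτ'
          apply hNI
          obtain ⟨hl1, hl2, hl3⟩ := htopl j' l hjl ⟨hpt, hnj, hτ'⟩
          refine dg_of_uns hb ?_ hp hal hml hjl (hpt.trans hl1.symm) ?_
          · intro c v v' h1 h2
            have := hinj (c, v) (c, v') h1 h2 rfl
            exact (Prod.mk.inj this).2
          · intro h0
            rw [← psh_apply_of_inj κ (a j') hκ h0, ← psh_apply_of_inj κ (a l) (htop l hl1 hl2).1 (hb l), hτ', hl3]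
      · exfalso
        have := tdeg_lt h1
        rw [← tdeg_psh Prod.fst i.1.2, (hI i).1] at this
        have := hD i.1.1
        omega
    · simp only [hφ]; omega
  have hEE : EE f := by
    refine core (D := D) (s := s) (jI := fun i : IS => i.1.1) (AI := fun i : IS => i.1.2) hR hf hb hcs hfl hsort hD 
      (fun i => ⟨(hI i).1, (hI i).2.2⟩) ?_ hgood E (fun l => (hRhoE l).trans (hnn l).1) hRhoE (fun l hl => (hnn l).2 _ hl ?_) nmax hnle ?_ le_rfl
    · intro j l A h1 h2 h3 h4 h5
      refine ⟨⟨(j, A), ?_⟩, rfl, rfl⟩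
      rw [hIS, Finset.mem_filter, Finset.mem_product]
      exact ⟨⟨Finset.mem_univ _, mem_Box (by rw [h3]; exact hD j)⟩, h3, h4, l, h1, h2, h5⟩
    · refine le_trans ?_ (hD l)
      exact Finset.single_le_sum (f := a l) (fun _ _ => Nat.zero_le _) (Finset.mem_univ _)
    · simp only [hφ]; omega
  have hg1 : Good f := good_of_EE f hEE
  have hg2 : Good (f₀ ∘ e) := Good.of_span hspan rfl hg1
  refine Good.of_span (f' := f₀ ∘ e) ?_ (by simp [hr]) hg2
  rw [e.surjective.range_comp]
end main
end RatDense

namespace RatDense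
universe u
section fin
variable {k : Type u} [Field k] 

lemma good_empty [Infinite k] {σ ι : Type} [Fintype σ] [Fintype ι] (hι : IsEmpty ι) (f : ι → MvPolynomial σ k) : Good f := by
  have h0 : Good (fun i : Fin 0 => (i.elim0 : MvPolynomial σ k)) := by
    apply good_of_EE
    intro H hH
    obtain ⟨W, hW⟩ := exists_eval_ne_zero hH
    exact ⟨W, hW, fun l => l.elim0, fun l => l.elim0, fun l => l.elim0, fun A _ _ ξ y j => j.elim0⟩
  refine Good.of_span ?_ (by simp) h0
  rw [Set.range_eq_empty, Set.range_eq_empty]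

lemma TH_zero [Infinite k] : TH k 0 := by
  intro R
  refine ⟨0, fun σ B _ _ β ι _ f a _ _ _ ha hd _ => ?_⟩
  exact good_empty ⟨fun i => ha i (tdeg_eq_zero.mp (Nat.le_zero.mp (hd i)))⟩ f

lemma nu_le {B : Type} [Fintype B] (a : B → ℕ) : nu a ≤ tdeg a ^ 2 := by
  rw [nu, tdeg, sq, Finset.sum_mul_sum]
  refine Finset.sum_le_sum fun x _ => ?_
  rw [sq]
  exact Finset.single_le_sum (f := fun y => a x * a y) (fun _ _ => Nat.zero_le _) (Finset.mem_univ x)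

lemma nu_eq_zero {B : Type} [Fintype B] {a : B → ℕ} (h : nu a = 0) : a = 0 := by
  funext x
  have := (Finset.sum_eq_zero_iff.mp h) x (Finset.mem_univ x)
  simpa using this

lemma psh_id {B : Type} [Fintype B] (a : B → ℕ) : psh id a = a := by
  funext x; exact psh_inj id Function.injective_id a x

lemma Th_all [Infinite k] (hk : IsBrauerField k) {d : ℕ} (hT : TH k d) (ν : ℕ) : ∀ t, Th k (d + 1) ν t := by
  classical
  induction ν with
  | zero =>
    intro t
    induction t with
    | zero =>
      intro R
      obtain ⟨K, hK⟩ := hT R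
      refine ⟨K, fun σ B B₀ _ _ _ β κ T ι _ f a hB hι hTc hf ha hD hν htop hcs => ?_⟩
      refine hK σ B β ι f a hB hι hf ha (fun i => ?_) hcs
      by_contra h
      have h1 : tdeg (a i) = d + 1 := by have := hD i; omega
      exact ha i (nu_eq_zero (Nat.le_zero.mp (hν i h1)))
    | succ t ih => exact main_step hk hT ih
  | succ ν ihν =>
    intro t
    induction t with
    | zero =>
      intro R
      obtain ⟨K, hK⟩ := ihν R R
      refine ⟨K, fun σ B B₀ _ _ _ β κ T ι _ f a hB hι hTc hf ha hD hν htop hcs => ?_⟩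
      refine hK σ B B β id (Finset.univ.image a) ι f a hB hι (Finset.card_image_le.trans (by simpa using hι)) hf ha hD ?_ ?_ hcs
      · intro i hi
        have h1 := hν i hi
        by_contra h2
        have h3 := (htop i hi (by omega)).2
        rw [Finset.card_eq_zero.mp (Nat.le_zero.mp hTc)] at h3
        simp at h3
      · intro i _ _
        refine ⟨fun x y _ _ h => h, ?_⟩
        rw [psh_id]; simp
    | succ t ih => exact main_step hk hT ih

lemma TH_all [Infinite k] (hk : IsBrauerField k) (d : ℕ) : TH k d := by
  induction d with
  | zero => exact TH_zero
  | succ d ih =>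
    intro R
    obtain ⟨K, hK⟩ := Th_all hk ih ((d + 1) ^ 2 + 1) 0 R
    refine ⟨K, fun σ B _ _ β ι _ f a hB hι hf ha hD hcs => ?_⟩
    have hn : ∀ i, tdeg (a i) = d + 1 → nu (a i) ≤ (d + 1) ^ 2 := fun i hi => hi ▸ nu_le (a i)
    refine hK σ B B β id ∅ ι f a hB hι (by simp) hf ha hD (fun i hi => (hn i hi).trans (by omega)) (fun i hi h => ?_) hcs
    have := hn i hi
    omega

lemma weight_unit {σ : Type} (m : σ →₀ ℕ) : Finsupp.weight (wt (fun _ : σ => ())) m = fun _ => m.degree := by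
  have h := tdeg_weight (fun _ : σ => ()) m
  funext x
  rw [← h]
  simp [tdeg]

lemma MH_unit {σ : Type} {f : MvPolynomial σ k} {e : ℕ} : MH (fun _ => ()) f (fun _ => e) ↔ f.IsHomogeneous e := by
  have h1 : ∀ m : σ →₀ ℕ, Finsupp.weight (1 : σ → ℕ) m = m.degree := fun m => by
    rw [Finsupp.degree_eq_weight_one]; rfl
  constructor
  · intro h m hm
    have := h hm
    rw [weight_unit] at this
    rw [h1]
    exact congrFun this ()
  · intro h m hm
    have := h hm
    rw [h1] at this
    rw [weight_unit, this]

lemma decomp_of_LowRk {σ : Type} {f : MvPolynomial σ k} {e K : ℕ} (hf : f.IsHomogeneous e) (h : LowRk K f) : 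
    ∃ m, m ≤ K * 2 ^ e ∧ HasStrengthDecomp f e m := by
  classical
  obtain ⟨g, h', p, q, H, he⟩ := h.cmp_decomp (β := fun _ => ()) (fun _ => e)
  rw [cmp_self (MH_unit.mpr hf)] at he
  set P := fun i => p i ≠ 0 ∧ q i ≠ 0 ∧ p i + q i = (fun _ => e) ∧ MH (fun _ => ()) (g i) (p i) ∧ MH (fun _ => ()) (h' i) (q i) with hP
  set S := Finset.univ.filter P
  set ε := S.equivFin.symm
  have hε : ∀ x, P (ε x).1 := fun x => (Finset.mem_filter.mp (ε x).2).2
  refine ⟨S.card, ?_, fun x => g (ε x), fun x => h' (ε x), fun x => p (ε x) (), fun x => q (ε x) (), ?_, ?_⟩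
  · refine (Finset.card_le_univ S).trans ?_
    rw [Fintype.card_prod, Fintype.card_fin, Fintype.card_coe]
    refine Nat.mul_le_mul_left _ ((card_Iic_le _).trans ?_)
    simp [tdeg]
  · intro x
    obtain ⟨h1, h2, h3, h4, h5⟩ := hε x
    have h6 : p (ε x).1 () ≠ 0 := fun h => h1 (funext fun _ => h)
    have h7 : q (ε x).1 () ≠ 0 := fun h => h2 (funext fun _ => h)
    have h8 : p (ε x).1 () + q (ε x).1 () = e := congrFun h3 ()
    dsimp only
    exact ⟨by omega, by omega, by omega, by omega, MH_unit.mp h4, MH_unit.mp h5⟩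
  · rw [he, ε.sum_comp (fun i => g i.1 * h' i.1), Finset.sum_coe_sort S (fun i => g i * h' i)]
    symm
    refine Finset.sum_subset (Finset.subset_univ S) fun i _ hi => ?_
    rcases H i with h1 | h1
    · have h2 : i ∈ S := (Finset.mem_filter (p := P)).mpr ⟨Finset.mem_univ i, h1⟩
      exact absurd h2 hi
    · rw [h1.1, zero_mul]

theorem final [Infinite k] (hk : IsBrauerField k) (r : ℕ) (d : Fin r → ℕ) (hpos : ∀ i, 1 ≤ d i) :
    ∃ C : ℕ, ∀ (N : ℕ) (f : Fin r → MvPolynomial (Fin N) k),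
      (∀ i, (f i).IsHomogeneous (d i)) → (C : ℕ∞) < tupleStrength f d →
      ∀ g : MvPolynomial (Fin N) k,
        (∀ x : Fin N → k, (∀ i, eval x (f i) = 0) → eval x g = 0) →
        g ∈ (Ideal.span (Set.range f)).radical := by
  classical
  set D := ∑ i, d i
  have hdD : ∀ i, d i ≤ D := fun i => Finset.single_le_sum (f := d) (fun _ _ => Nat.zero_le _) (Finset.mem_univ i)
  obtain ⟨K, hK⟩ := TH_all hk D (r + 1)
  refine ⟨K * 2 ^ D, fun N f hf hstr g hg => ?_⟩
  have hgood : Good f := by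
    refine hK (Fin N) Unit (fun _ => ()) (Fin r) f (fun i _ => d i) (by simp) (by simp) (fun i => MH_unit.mpr (hf i)) ?_ ?_ ?_
    · intro i h
      have := congrFun h ()
      have := hpos i
      simp at *
      omega
    · intro i; simpa [tdeg] using hdD i
    · intro c hc A hA hL
      obtain ⟨i0, hi0⟩ := Function.ne_iff.mp hc
      have hde : ∀ i, c i ≠ 0 → d i = d i0 := fun i hi => by
        have h1 := hA i hi
        have h2 := hA i0 hi0
        exact congrFun (h1.trans h2.symm) ()
      have hhom : (∑ i, C (c i) * f i).IsHomogeneous (d i0) := by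
        refine Submodule.sum_mem (homogeneousSubmodule (Fin N) k (d i0)) fun i _ => ?_
        rw [← smul_eq_C_mul]
        by_cases h0 : c i = 0
        · rw [h0, zero_smul]; exact Submodule.zero_mem _
        · exact Submodule.smul_mem _ _ (hde i h0 ▸ hf i)
      obtain ⟨m, hm, hdec⟩ := decomp_of_LowRk hhom hL
      have h1 : tupleStrength f d ≤ strength (∑ i, C (c i) * f i) (d i0) := sInf_le ⟨c, d i0, hc, hde, rfl⟩
      have h2 : strength (∑ i, C (c i) * f i) (d i0) ≤ (m : ℕ∞) := sInf_le ⟨m, rfl, hdec⟩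
      have h3 : (m : ℕ∞) ≤ ((K * 2 ^ D : ℕ) : ℕ∞) := by
        exact_mod_cast hm.trans (Nat.mul_le_mul_left _ (Nat.pow_le_pow_right (by norm_num) (hdD i0)))
      exact absurd hstr (not_lt.mpr (h1.trans (h2.trans h3)))
  by_contra hgn
  obtain ⟨P, hP, hPg, -⟩ := hgood.dense g hgn
  exact hPg (hg P hP)
end fin
end RatDense

/-- For every multi-degree `d` over an infinite Brauer field `k` there is a constant `C`
such that for any tuple `f` of homogeneous polynomials of degrees `d_1 ≥ ⋯ ≥ d_r ≥ 1` with
`str(f) > C`, the `k`-points of `Z(f)` are Zariski dense in `Z(f)`: every polynomial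
vanishing at all common `k`-zeros of `f` lies in the radical of the ideal generated
by the `f_i`. -/
theorem rat_points_dense_of_high_strength (k : Type*) [Field k] [Infinite k]
    (hk : IsBrauerField k) (r : ℕ) (d : Fin r → ℕ)
    (hanti : Antitone d) (hpos : ∀ i, 1 ≤ d i) :
    ∃ C : ℕ, ∀ (N : ℕ) (f : Fin r → MvPolynomial (Fin N) k),
      (∀ i, (f i).IsHomogeneous (d i)) → (C : ℕ∞) < tupleStrength f d →
      ∀ g : MvPolynomial (Fin N) k,
        (∀ x : Fin N → k, (∀ i, eval x (f i) = 0) → eval x g = 0) →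
        g ∈ (Ideal.span (Set.range f)).radical := by
  exact RatDense.final hk r d hpos
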